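/- Let n ≥ 2 and let g : ℂ^{n+1} → ℂ be complex-analytic on an open neighborhood of 0, non-constant, with g(0) = 0. Then there exists ε₀ > 0 such that for every ε with 0 < ε ≤ ε₀ the link K_ε = g⁻¹(0) ∩ S_ε^{2n+1} is (n−2)-connected: K_ε is nonempty and path-connected, and for every x ∈ K_ε and every j with 1 ≤ j ≤ n−2 the homotopy group π_j(K_ε, x) is trivial. -/

import Mathlib

open Metric Topology Set

noncomputable section

section MLinkHelpers

open Filter

set_option linter.unusedSectionVars false

namespace MLink

section Analytic

variable {E F : Type*} [NormedAddCommGroup E] [NormedSpace ℝ E]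
  [NormedAddCommGroup F] [NormedSpace ℝ F] [CompleteSpace F]

/-- Averaging an analytic function over a family of linear contractions is analytic. -/
theorem analyticAt_integral {G : E → F} (hG : AnalyticAt ℝ G 0) {L : ℝ → E →L[ℝ] E}
    (hL : Continuous L) (hL1 : ∀ s ∈ Icc (0 : ℝ) 1, ‖L s‖ ≤ 1) :
    AnalyticAt ℝ (fun x => ∫ s in (0 : ℝ)..1, G (L s x)) 0 := by
  obtain ⟨p, r, hp⟩ := hG
  let c : (n : ℕ) → ℝ → ContinuousMultilinearMap ℝ (fun _ : Fin n => E) F :=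
    fun n s => (p n).compContinuousLinearMap (fun _ => L s)
  have hc : ∀ n, Continuous (c n) := by
    intro n
    have h1 : Continuous fun s : ℝ =>
        (ContinuousMultilinearMap.compContinuousLinearMapContinuousMultilinear ℝ
          (fun _ : Fin n => E) (fun _ : Fin n => E) F) (fun _ => L s) :=
      (ContinuousMultilinearMap.cont _).comp (by fun_prop)
    exact h1.clm_apply continuous_const
  have hcn : ∀ n, ∀ s ∈ Icc (0 : ℝ) 1, ‖c n s‖ ≤ ‖p n‖ := by
    intro n s hs
    refine ((p n).norm_compContinuousLinearMap_le _).trans ?_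
    have : ∏ _i : Fin n, ‖L s‖ ≤ 1 := by
      rw [Finset.prod_const]
      exact pow_le_one₀ (norm_nonneg _) (hL1 s hs)
    exact mul_le_of_le_one_right (norm_nonneg _) this
  let q : FormalMultilinearSeries ℝ E F := fun n => ∫ s in (0 : ℝ)..1, c n s
  have hsub : uIoc (0 : ℝ) 1 ⊆ Icc (0 : ℝ) 1 := by
    rw [uIoc_of_le zero_le_one]; exact Ioc_subset_Icc_self
  have hqn : ∀ n, ‖q n‖ ≤ ‖p n‖ := by
    intro n
    have := intervalIntegral.norm_integral_le_of_norm_le_const (a := (0 : ℝ)) (b := 1)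
      (f := c n) (C := ‖p n‖) (fun s hs => hcn n s (hsub hs))
    simpa using this
  refine ⟨q, r, ⟨hp.r_le.trans (FormalMultilinearSeries.radius_le_of_le hqn), hp.r_pos, ?_⟩⟩
  intro y hy
  have hyr : (‖y‖₊ : ENNReal) < r := by
    have := Metric.mem_eball.1 hy
    rwa [edist_zero_right] at this
  have hsum : Summable fun n => ‖p n‖ * ‖y‖ ^ n := by
    simpa using p.summable_norm_mul_pow (hyr.trans_le hp.r_le)
  have hqy : ∀ n, (q n) (fun _ => y) = ∫ s in (0 : ℝ)..1, c n s (fun _ => y) := by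
    intro n
    have := ContinuousLinearMap.intervalIntegral_comp_comm (a := (0 : ℝ)) (b := 1)
      (μ := MeasureTheory.volume)
      (ContinuousMultilinearMap.apply ℝ (fun _ : Fin n => E) F (fun _ => y))
      ((hc n).intervalIntegrable 0 1)
    simpa using this.symm
  simp only [hqy, zero_add]
  refine intervalIntegral.hasSum_integral_of_dominated_convergence
    (fun n _ => ‖p n‖ * ‖y‖ ^ n) ?_ ?_ ?_ ?_ ?_
  · intro n
    have : Continuous fun s => c n s (fun _ => y) :=
      (ContinuousMultilinearMap.apply ℝ (fun _ : Fin n => E) F (fun _ => y)).continuous.comp (hc n)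
    exact this.aestronglyMeasurable
  · intro n
    refine Eventually.of_forall fun s hs => ?_
    refine ((c n s).le_opNorm _).trans ?_
    simp only [Finset.prod_const, Finset.card_univ, Fintype.card_fin]
    exact mul_le_mul_of_nonneg_right (hcn n s (hsub hs)) (by positivity)
  · exact Eventually.of_forall fun s _ => hsum
  · exact intervalIntegrable_const
  · refine Eventually.of_forall fun s hs => ?_
    have hmem : L s y ∈ Metric.eball (0 : E) r := by
      have h1 : ‖L s y‖ ≤ ‖y‖ := by
        have := (L s).le_opNorm y
        nlinarith [hL1 s (hsub hs), norm_nonneg y]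
      have h2 : (‖L s y‖₊ : ENNReal) ≤ ‖y‖₊ := by exact_mod_cast h1
      rw [Metric.mem_eball, edist_zero_right]
      exact h2.trans_lt hyr
    have := hp.hasSum hmem
    simpa [c] using this

/-- Division of an analytic function by a linear form, when it vanishes on the kernel. -/
theorem exists_div {f : E → ℝ} (hf : AnalyticAt ℝ f 0) (ℓ : E →L[ℝ] ℝ) (e : E)
    (hn : ∀ s ∈ Icc (0 : ℝ) 1, ∀ x, ‖x - ((1 - s) * ℓ x) • e‖ ≤ ‖x‖) :
    ∃ q : E → ℝ, AnalyticAt ℝ q 0 ∧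
      ∀ᶠ x in 𝓝 (0 : E), f x = f (x - ℓ x • e) + ℓ x * q x := by
  let L : ℝ → E →L[ℝ] E := fun s => ContinuousLinearMap.id ℝ E - (1 - s) • (ℓ.smulRight e)
  have hLx : ∀ s x, L s x = x - ((1 - s) * ℓ x) • e := by
    intro s x; simp [L, smul_smul]
  have hL : Continuous L := by fun_prop
  have hL1 : ∀ s ∈ Icc (0 : ℝ) 1, ‖L s‖ ≤ 1 := by
    intro s hs
    refine ContinuousLinearMap.opNorm_le_bound _ zero_le_one fun x => ?_
    rw [hLx, one_mul]; exact hn s hs x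
  let G : E → ℝ := fun x => fderiv ℝ f x e
  have hG : AnalyticAt ℝ G 0 :=
    ((ContinuousLinearMap.apply ℝ ℝ e).analyticAt _).comp hf.fderiv
  refine ⟨_, analyticAt_integral hG hL hL1, ?_⟩
  obtain ⟨R, hR, hball⟩ := Metric.eventually_nhds_iff_ball.1
    (hf.eventually_analyticAt)
  filter_upwards [Metric.ball_mem_nhds (0 : E) hR] with x hx
  have hmem : ∀ s ∈ Icc (0 : ℝ) 1, L s x ∈ ball (0 : E) R := by
    intro s hs
    rw [mem_ball_zero_iff] at hx ⊢
    rw [hLx]; exact (hn s hs x).trans_lt hx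
  have hd : ∀ s ∈ uIcc (0 : ℝ) 1, HasDerivAt (fun s => f (L s x)) (ℓ x * G (L s x)) s := by
    intro s hs
    rw [uIcc_of_le zero_le_one] at hs
    have h1 : HasFDerivAt f (fderiv ℝ f (L s x)) (L s x) :=
      (hball _ (hmem s hs)).differentiableAt.hasFDerivAt
    have h2 : HasDerivAt (fun s => L s x) (ℓ x • e) s := by
      simp only [hLx]
      have h3 : HasDerivAt (fun s : ℝ => (1 - s) * ℓ x) (-1 * ℓ x) s :=
        ((hasDerivAt_id s).const_sub 1).mul_const _
      have := (h3.smul_const e).const_sub x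
      simpa using this
    have := h1.comp_hasDerivAt s h2
    refine HasDerivAt.congr_deriv this ?_
    simp [G]
  have hcont : ContinuousOn (fun s => ℓ x * G (L s x)) (uIcc (0 : ℝ) 1) := by
    intro s hs
    rw [uIcc_of_le zero_le_one] at hs
    have h1 : ContinuousAt G (L s x) :=
      (((ContinuousLinearMap.apply ℝ ℝ e).analyticAt _).comp
        (hball _ (hmem s hs)).fderiv).continuousAt
    have h2 : ContinuousAt (fun s => L s x) s := by fun_prop
    exact ((h1.comp (f := fun s => L s x) h2).const_mul (ℓ x)).continuousWithinAt
  have := intervalIntegral.integral_eq_sub_of_hasDerivAt hd hcont.intervalIntegrable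
  rw [intervalIntegral.integral_const_mul] at this
  have e1 : L 1 x = x := by simp [hLx]
  have e0 : L 0 x = x - ℓ x • e := by simp [hLx]
  rw [e1, e0] at this
  linarith

end Analytic

/-- The germ at `0` of the function is not zero. -/
def NZ {E : Type*} [TopologicalSpace E] [Zero E] (f : E → ℝ) : Prop := ¬ (f =ᶠ[𝓝 0] 0)

section Germs

variable {E : Type*} [NormedAddCommGroup E] [NormedSpace ℝ E]

theorem NZ.mul {f g : E → ℝ} (hf : AnalyticAt ℝ f 0) (hg : AnalyticAt ℝ g 0)
    (nf : NZ f) (ng : NZ g) : NZ (fun x => f x * g x) := by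
  intro h
  obtain ⟨R, hR, hb⟩ := Metric.eventually_nhds_iff_ball.1
    (hf.eventually_analyticAt.and (hg.eventually_analyticAt.and h))
  by_cases hz : ∃ v ∈ ball (0 : E) R, f v ≠ 0
  · obtain ⟨v, hv, hfv⟩ := hz
    apply ng
    have h1 : g =ᶠ[𝓝 v] 0 := by
      filter_upwards [(hb v hv).1.continuousAt.eventually_ne hfv, isOpen_ball.mem_nhds hv]
        with x hx hxb
      have := (hb x hxb).2.2
      simp only [Pi.zero_apply, mul_eq_zero] at this
      exact this.resolve_left hx
    have hA : AnalyticOnNhd ℝ g (ball 0 R) := fun x hx => (hb x hx).2.1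
    have := hA.eqOn_zero_of_preconnected_of_eventuallyEq_zero
      (convex_ball (0 : E) R).isPreconnected hv h1
    filter_upwards [ball_mem_nhds (0 : E) hR] with x hx using this hx
  · push Not at hz
    apply nf
    filter_upwards [ball_mem_nhds (0 : E) hR] with x hx using hz x hx

theorem NZ.pow {f : E → ℝ} (nf : NZ f) (k : ℕ) : NZ (fun x => f x ^ k) := by
  intro h
  apply nf
  filter_upwards [h] with x hx
  simpa using eq_zero_of_pow_eq_zero hx

theorem NZ.prod {ι : Type*} (s : Finset ι) (f : ι → E → ℝ)
    (hf : ∀ i ∈ s, AnalyticAt ℝ (f i) 0) (nf : ∀ i ∈ s, NZ (f i)) :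
    NZ (fun x => ∏ i ∈ s, f i x) := by
  classical
  induction s using Finset.induction_on with
  | empty =>
    intro h
    have := h.self_of_nhds
    simp at this
  | insert a s ha ih =>
    simp only [Finset.prod_insert ha]
    refine NZ.mul (hf a (by simp)) ?_ (nf a (by simp)) (ih (fun i hi => hf i (by simp [hi]))
      (fun i hi => nf i (by simp [hi])))
    exact Finset.analyticAt_fun_prod _ fun i hi => hf i (by simp [hi])

theorem NZ.of_ne {f : E → ℝ} (h : f 0 ≠ 0) : NZ f := fun h' => h h'.self_of_nhds

end Germs

end MLink

namespace MLink

section NCdef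

variable {ι : Type*} [Fintype ι]

/-- Monomials. -/
def mon (α : ι → ℕ) (x : ι → ℝ) : ℝ := ∏ i, x i ^ α i

/-- Normal crossings at `0`. -/
def NC (f : (ι → ℝ) → ℝ) : Prop :=
  ∃ (α : ι → ℕ) (u : (ι → ℝ) → ℝ), AnalyticAt ℝ u 0 ∧ u 0 ≠ 0 ∧
    ∀ᶠ x in 𝓝 (0 : ι → ℝ), f x = mon α x * u x

theorem analyticAt_coord (i : ι) (a : ι → ℝ) : AnalyticAt ℝ (fun x : ι → ℝ => x i) a :=
  (ContinuousLinearMap.proj (R := ℝ) (φ := fun _ : ι => ℝ) i).analyticAt a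

theorem mon_analyticAt (α : ι → ℕ) (a : ι → ℝ) : AnalyticAt ℝ (mon α) a :=
  Finset.analyticAt_fun_prod _ fun i _ => (analyticAt_coord i a).pow _

theorem mon_add (α β : ι → ℕ) (x : ι → ℝ) : mon (α + β) x = mon α x * mon β x := by
  simp [mon, pow_add, Finset.prod_mul_distrib]

theorem mon_zero (x : ι → ℝ) : mon (0 : ι → ℕ) x = 1 := by simp [mon]

theorem mon_single [DecidableEq ι] (k : ι) (x : ι → ℝ) : mon (Pi.single k 1) x = x k := by
  unfold mon
  rw [Finset.prod_eq_single k]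
  · simp
  · intro b _ hb; simp [hb]
  · simp

theorem mon_smul (α : ι → ℕ) (m : ℕ) (x : ι → ℝ) : mon (m • α) x = mon α x ^ m := by
  simp [mon, pow_mul, mul_comm m, Finset.prod_pow]

theorem mon_ne_zero (α : ι → ℕ) (x : ι → ℝ) (h : ∀ k, α k ≠ 0 → x k ≠ 0) : mon α x ≠ 0 := by
  unfold mon
  rw [Finset.prod_ne_zero_iff]
  intro k _
  by_cases hk : α k = 0
  · simp [hk]
  · exact pow_ne_zero _ (h k hk)

theorem mon_eq_zero (α : ι → ℕ) (x : ι → ℝ) {k : ι} (h : α k ≠ 0) (hx : x k = 0) :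
    mon α x = 0 := by
  unfold mon
  exact Finset.prod_eq_zero (Finset.mem_univ k) (by simp [hx, h])

/-- points near 0 with prescribed zero coordinates satisfy any eventual property -/
theorem exists_test (p : ι → Prop) {P : (ι → ℝ) → Prop} (h : ∀ᶠ x in 𝓝 (0 : ι → ℝ), P x) :
    ∃ x, P x ∧ (∀ k, p k → x k = 0) ∧ ∀ k, ¬ p k → x k ≠ 0 := by
  classical
  let c : ℝ → (ι → ℝ) := fun s k => if p k then 0 else s
  have hc : Continuous c := by
    refine continuous_pi fun k => ?_
    by_cases hk : p k <;> simp [c, hk] <;> fun_prop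
  have h0 : c 0 = 0 := by ext k; simp [c]
  have h1 : Tendsto c (𝓝[≠] 0) (𝓝 0) := by
    have := hc.tendsto 0
    rw [h0] at this
    exact this.mono_left nhdsWithin_le_nhds
  obtain ⟨s, hs, hs0⟩ := ((h1.eventually h).and self_mem_nhdsWithin).exists
  refine ⟨c s, hs, fun k hk => by simp [c, hk], fun k hk => ?_⟩
  simpa [c, hk] using hs0

theorem mon_NZ (α : ι → ℕ) : NZ (mon α) := by
  intro h
  obtain ⟨x, hx, -, hx2⟩ := exists_test (fun _ => False) h
  exact mon_ne_zero α x (fun k _ => hx2 k (by simp)) hx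

theorem NC.nz {f : (ι → ℝ) → ℝ} (h : NC f) : NZ f := by
  obtain ⟨α, u, hu, hu0, hf⟩ := h
  intro h0
  refine NZ.mul (mon_analyticAt α 0) hu (mon_NZ α) (NZ.of_ne hu0) ?_
  filter_upwards [hf, h0] with x h1 h2
  rw [← h1, h2]

theorem NC.congr {f g : (ι → ℝ) → ℝ} (h : NC f) (hfg : f =ᶠ[𝓝 0] g) : NC g := by
  obtain ⟨α, u, hu, hu0, hf⟩ := h
  refine ⟨α, u, hu, hu0, ?_⟩
  filter_upwards [hf, hfg] with x h1 h2
  rw [← h2, h1]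

theorem NC.mul {f g : (ι → ℝ) → ℝ} (hf : NC f) (hg : NC g) : NC (fun x => f x * g x) := by
  obtain ⟨α, u, hu, hu0, hf⟩ := hf
  obtain ⟨β, v, hv, hv0, hg⟩ := hg
  refine ⟨α + β, fun x => u x * v x, hu.mul hv, mul_ne_zero hu0 hv0, ?_⟩
  filter_upwards [hf, hg] with x h1 h2
  rw [h1, h2, mon_add]; ring

theorem NC.mon (α : ι → ℕ) : NC (mon α) :=
  ⟨α, fun _ => 1, analyticAt_const, one_ne_zero, Eventually.of_forall fun x => by simp⟩

theorem NC.of_unit {u : (ι → ℝ) → ℝ} (hu : AnalyticAt ℝ u 0) (h : u 0 ≠ 0) : NC u :=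
  ⟨0, u, hu, h, Eventually.of_forall fun x => by simp [mon_zero]⟩

/-- cancel a nonzero germ -/
theorem germ_cancel {E : Type*} [NormedAddCommGroup E] [NormedSpace ℝ E] {f a b : E → ℝ}
    (hf : AnalyticAt ℝ f 0) (ha : AnalyticAt ℝ a 0) (hb : AnalyticAt ℝ b 0) (nf : NZ f)
    (h : ∀ᶠ x in 𝓝 (0 : E), f x * a x = f x * b x) : ∀ᶠ x in 𝓝 (0 : E), a x = b x := by
  by_contra hcon
  have : NZ (fun x => a x - b x) := by
    intro h'
    apply hcon
    filter_upwards [h'] with x hx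
    simpa [sub_eq_zero] using hx
  refine NZ.mul hf (ha.sub hb) nf this ?_
  filter_upwards [h] with x hx
  simp [mul_sub, hx]

theorem coord_div {f : (ι → ℝ) → ℝ} (hf : AnalyticAt ℝ f 0) [DecidableEq ι] (k : ι) :
    ∃ q : (ι → ℝ) → ℝ, AnalyticAt ℝ q 0 ∧
      ∀ᶠ x in 𝓝 (0 : ι → ℝ), f x = f (Function.update x k 0) + x k * q x := by
  obtain ⟨q, hq, h⟩ := exists_div hf (ContinuousLinearMap.proj (R := ℝ) (φ := fun _ : ι => ℝ) k)
    (Pi.single k 1) (by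
      intro s hs x
      refine (pi_norm_le_iff_of_nonneg (norm_nonneg x)).2 fun i => ?_
      by_cases hi : i = k
      · subst hi
        simp only [ContinuousLinearMap.proj_apply, Pi.sub_apply, Pi.smul_apply, Pi.single_eq_same,
          smul_eq_mul, mul_one]
        have : x i - (1 - s) * x i = s * x i := by ring
        rw [this, norm_mul, Real.norm_of_nonneg hs.1]
        exact (mul_le_of_le_one_left (norm_nonneg _) hs.2).trans (norm_le_pi_norm x i)
      · simpa [hi] using norm_le_pi_norm x i)
  refine ⟨q, hq, ?_⟩
  filter_upwards [h] with x hx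
  rw [hx]
  congr 2
  ext i
  by_cases hi : i = k
  · subst hi; simp
  · simp [hi]

theorem update_analyticAt [DecidableEq ι] (k : ι) :
    AnalyticAt ℝ (fun x : ι → ℝ => Function.update x k 0) 0 := by
  refine AnalyticAt.pi fun i => ?_
  by_cases hi : i = k
  · subst hi; simpa using analyticAt_const
  · simpa [hi] using analyticAt_coord i _

theorem NC.factor_aux (N : ℕ) : ∀ (α : ι → ℕ) (f1 f2 u : (ι → ℝ) → ℝ), ∑ i, α i = N →
    AnalyticAt ℝ f1 0 → AnalyticAt ℝ f2 0 → AnalyticAt ℝ u 0 → u 0 ≠ 0 →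
    (∀ᶠ x in 𝓝 (0 : ι → ℝ), f1 x * f2 x = MLink.mon α x * u x) → NC f1 := by
  classical
  induction N with
  | zero =>
    intro α f1 f2 u hα h1 h2 hu hu0 h
    have hα0 : α = 0 := by
      ext i; simpa using Finset.sum_eq_zero_iff.1 hα i (Finset.mem_univ i)
    have := h.self_of_nhds
    rw [hα0, mon_zero, one_mul] at this
    refine NC.of_unit h1 fun h0 => hu0 ?_
    rw [← this, h0, zero_mul]
  | succ N ih =>
    intro α f1 f2 u hα h1 h2 hu hu0 h
    obtain ⟨k, hk⟩ : ∃ k, α k ≠ 0 := by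
      by_contra hcon; push Not at hcon
      simp [hcon] at hα
    have hsp : α = Pi.single k 1 + (α - Pi.single k 1) := by
      ext i
      by_cases hi : i = k
      · subst hi; simp; omega
      · simp [hi]
    set α' := α - Pi.single k 1 with hα'
    have hsum : ∑ i, α' i = N := by
      have : ∑ i, α i = 1 + ∑ i, α' i := by
        rw [hsp]; simp [Finset.sum_add_distrib]
      omega
    have hmon : ∀ x, MLink.mon α x = x k * MLink.mon α' x := by
      intro x; rw [hsp, mon_add, mon_single]
    have hxk : NZ (fun x : ι → ℝ => x k) := by
      have := mon_NZ (Pi.single k 1 : ι → ℕ)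
      convert this using 2 with x
      exact (mon_single k x).symm
    have hP := update_analyticAt (ι := ι) k
    have hP0 : Function.update (0 : ι → ℝ) k 0 = 0 := by simp
    have hPt : Tendsto (fun x : ι → ℝ => Function.update x k 0) (𝓝 0) (𝓝 0) := by
      have := hP.continuousAt.tendsto
      rwa [hP0] at this
    have h1P : AnalyticAt ℝ (fun x : ι → ℝ => f1 (Function.update x k 0)) 0 :=
      AnalyticAt.comp (g := f1) (by rwa [hP0]) hP
    have h2P : AnalyticAt ℝ (fun x : ι → ℝ => f2 (Function.update x k 0)) 0 :=
      AnalyticAt.comp (g := f2) (by rwa [hP0]) hP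
    by_cases hz : NZ (fun x : ι → ℝ => f1 (Function.update x k 0))
    · have hz2 : ¬ NZ (fun x : ι → ℝ => f2 (Function.update x k 0)) := by
        intro hz2
        refine NZ.mul h1P h2P hz hz2 ?_
        filter_upwards [hPt.eventually h] with x hx
        rw [hx, mon_eq_zero α _ hk (by simp)]; simp
      obtain ⟨q, hq, hq2⟩ := coord_div h2 k
      refine ih α' f1 q u hsum h1 hq hu hu0 ?_
      refine germ_cancel (analyticAt_coord k 0) (h1.mul hq) ((mon_analyticAt α' 0).mul hu) hxk ?_
      filter_upwards [h, hq2, not_not.1 hz2] with x hx hx2 hx3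
      simp only [Pi.zero_apply] at hx3
      rw [hx3, zero_add] at hx2
      rw [hx2, hmon] at hx
      linarith
    · obtain ⟨q, hq, hq2⟩ := coord_div h1 k
      have hfq : ∀ᶠ x in 𝓝 (0 : ι → ℝ), f1 x = x k * q x := by
        filter_upwards [hq2, not_not.1 hz] with x hx2 hx3
        simp only [Pi.zero_apply] at hx3
        rw [hx2, hx3, zero_add]
      have hqNC : NC q := by
        refine ih α' q f2 u hsum hq h2 hu hu0 ?_
        refine germ_cancel (analyticAt_coord k 0) (hq.mul h2) ((mon_analyticAt α' 0).mul hu) hxk ?_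
        filter_upwards [h, hfq] with x hx hx2
        rw [hx2, hmon] at hx
        linarith
      refine ((NC.mon (Pi.single k 1)).mul hqNC).congr ?_
      filter_upwards [hfq] with x hx
      rw [hx, mon_single]

theorem NC.factor {f1 f2 : (ι → ℝ) → ℝ} (h1 : AnalyticAt ℝ f1 0) (h2 : AnalyticAt ℝ f2 0)
    (h : NC (fun x => f1 x * f2 x)) : NC f1 := by
  obtain ⟨α, u, hu, hu0, hf⟩ := h
  exact NC.factor_aux _ α f1 f2 u rfl h1 h2 hu hu0 hf

theorem NC.factor' {f1 f2 : (ι → ℝ) → ℝ} (h1 : AnalyticAt ℝ f1 0) (h2 : AnalyticAt ℝ f2 0)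
    (h : NC (fun x => f1 x * f2 x)) : NC f2 := by
  refine NC.factor h2 h1 (h.congr (Eventually.of_forall fun x => mul_comm _ _))

theorem NC.of_prod {κ : Type*} (s : Finset κ) (f : κ → (ι → ℝ) → ℝ)
    (hf : ∀ i ∈ s, AnalyticAt ℝ (f i) 0) (h : NC (fun x => ∏ i ∈ s, f i x)) (i : κ) (hi : i ∈ s) :
    NC (f i) := by
  classical
  refine NC.factor (f2 := fun x => ∏ j ∈ s.erase i, f j x) (hf i hi)
    (Finset.analyticAt_fun_prod _ fun j hj => hf j (Finset.mem_of_mem_erase hj))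
    (h.congr (Eventually.of_forall fun x => ?_))
  exact (Finset.mul_prod_erase s (fun j => f j x) hi).symm

/-- Comparability of exponents. -/
theorem comparable {α β : ι → ℕ} {u v : (ι → ℝ) → ℝ} (hu : AnalyticAt ℝ u 0) (hu0 : u 0 ≠ 0)
    (hv : AnalyticAt ℝ v 0) (hv0 : v 0 ≠ 0)
    (h : ¬ NZ (fun x => mon α x * u x - mon β x * v x) ∨
      NC (fun x => mon α x * u x - mon β x * v x)) : α ≤ β ∨ β ≤ α := by
  by_contra hcon
  push Not at hcon
  obtain ⟨h1, h2⟩ := hcon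
  obtain ⟨i, hi⟩ : ∃ i, β i < α i := by
    by_contra h; push Not at h; exact h1 h
  obtain ⟨j, hj⟩ : ∃ i, α i < β i := by
    by_contra h; push Not at h; exact h2 h
  let m : ι → ℕ := α ⊓ β
  have em : ∀ k, m k = min (α k) (β k) := fun k => rfl
  let α' := α - m
  let β' := β - m
  have eα' : ∀ k, α' k = α k - min (α k) (β k) := fun k => rfl
  have eβ' : ∀ k, β' k = β k - min (α k) (β k) := fun k => rfl
  have hα : α = m + α' := by ext k; simp [em, eα']
  have hβ : β = m + β' := by ext k; simp [em, eβ']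
  have hdisj : ∀ k, α' k = 0 ∨ β' k = 0 := by
    intro k; rw [eα', eβ']; omega
  let φ : (ι → ℝ) → ℝ := fun x => mon α' x * u x - mon β' x * v x
  have hφa : AnalyticAt ℝ φ 0 :=
    ((mon_analyticAt α' 0).mul hu).sub ((mon_analyticAt β' 0).mul hv)
  have hfac : ∀ x, mon α x * u x - mon β x * v x = mon m x * φ x := by
    intro x; rw [hα, hβ, mon_add, mon_add]; simp only [φ]; ring
  simp only [hfac] at h
  have hi' : α' i ≠ 0 := by rw [eα']; omega
  have hj' : β' j ≠ 0 := by rw [eβ']; omega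
  have hun := hu.continuousAt.eventually_ne hu0
  have hvn := hv.continuousAt.eventually_ne hv0
  rcases h with h | h
  · have : ¬ NZ φ := fun h' => h (NZ.mul (mon_analyticAt m 0) hφa (mon_NZ m) h')
    obtain ⟨x, ⟨hx1, hx2⟩, hx3, hx4⟩ := exists_test (fun k => β' k ≠ 0) ((not_not.1 this).and hun)
    simp only [φ, Pi.zero_apply] at hx1
    rw [mon_eq_zero β' x hj' (hx3 j hj'), zero_mul, sub_zero, mul_eq_zero] at hx1
    refine hx1.elim ?_ hx2
    exact mon_ne_zero _ _ fun k hk => hx4 k (by simpa using (hdisj k).resolve_left hk)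
  · obtain ⟨γ, w, hw, hw0, hφ⟩ := NC.factor' (mon_analyticAt m 0) hφa h
    have hwn := hw.continuousAt.eventually_ne hw0
    have hγβ : ∀ k, β' k ≠ 0 → γ k = 0 := by
      intro k hk
      by_contra hγ
      obtain ⟨x, ⟨hx1, hx2⟩, hx3, hx4⟩ := exists_test (fun k => β' k ≠ 0) (hφ.and hun)
      simp only [φ] at hx1
      rw [mon_eq_zero β' x hj' (hx3 j hj'), zero_mul, sub_zero, mon_eq_zero γ x hγ (hx3 k hk),
        zero_mul, mul_eq_zero] at hx1
      refine hx1.elim ?_ hx2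
      exact mon_ne_zero _ _ fun k hk => hx4 k (by simpa using (hdisj k).resolve_left hk)
    have hγα : ∀ k, α' k ≠ 0 → γ k = 0 := by
      intro k hk
      by_contra hγ
      obtain ⟨x, ⟨hx1, hx2⟩, hx3, hx4⟩ := exists_test (fun k => α' k ≠ 0) (hφ.and hvn)
      simp only [φ] at hx1
      rw [mon_eq_zero α' x hi' (hx3 i hi'), zero_mul, zero_sub, mon_eq_zero γ x hγ (hx3 k hk),
        zero_mul, neg_eq_zero, mul_eq_zero] at hx1
      refine hx1.elim ?_ hx2
      exact mon_ne_zero _ _ fun k hk => hx4 k (by simpa using (hdisj k).resolve_right hk)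
    obtain ⟨x, ⟨hx1, hx2⟩, hx3, hx4⟩ :=
      exists_test (fun k => α' k ≠ 0 ∨ β' k ≠ 0) (hφ.and hwn)
    simp only [φ] at hx1
    rw [mon_eq_zero α' x hi' (hx3 i (Or.inl hi')), mon_eq_zero β' x hj' (hx3 j (Or.inr hj')),
      zero_mul, zero_mul, sub_zero] at hx1
    refine (mul_ne_zero ?_ hx2) hx1.symm
    refine mon_ne_zero _ _ fun k hk => hx4 k ?_
    rintro (h | h)
    · exact hk (hγα k h)
    · exact hk (hγβ k h)

end NCdef

end MLink

namespace MLink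

section Grad

variable {ι : Type*} [Fintype ι] [DecidableEq ι]

theorem NC.partial {φ : (ι → ℝ) → ℝ} {α : ι → ℕ} {u : (ι → ℝ) → ℝ} (hu : AnalyticAt ℝ u 0)
    (hu0 : u 0 ≠ 0) (hf : ∀ᶠ x in 𝓝 (0 : ι → ℝ), φ x = MLink.mon α x * u x) (i : ι) :
    ∀ᶠ y in 𝓝 (0 : ι → ℝ), DifferentiableAt ℝ φ y ∧
      fderiv ℝ φ y (Pi.single i 1) * y i =
        φ y * (α i + fderiv ℝ u y (Pi.single i 1) * y i / u y) := by
  filter_upwards [hf.eventually_nhds, hu.eventually_analyticAt,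
    hu.continuousAt.eventually_ne hu0] with y hy1 hy2 hy3
  have hφ : AnalyticAt ℝ φ y :=
    ((mon_analyticAt α y).mul hy2).congr (by filter_upwards [hy1] with x hx; simp [hx])
  refine ⟨hφ.differentiableAt, ?_⟩
  have hc : HasDerivAt (fun t => Function.update y i t) (Pi.single i 1) (y i) :=
    hasDerivAt_update y i (y i)
  have hupd : Function.update y i (y i) = y := Function.update_eq_self i y
  have h1 : HasDerivAt (fun t => φ (Function.update y i t)) (fderiv ℝ φ y (Pi.single i 1)) (y i) := by
    have := hφ.differentiableAt.hasFDerivAt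
    rw [← hupd] at this
    have := this.comp_hasDerivAt (y i) hc
    rwa [hupd] at this
  have h2 : HasDerivAt (fun t => u (Function.update y i t)) (fderiv ℝ u y (Pi.single i 1)) (y i) := by
    have := hy2.differentiableAt.hasFDerivAt
    rw [← hupd] at this
    have := this.comp_hasDerivAt (y i) hc
    rwa [hupd] at this
  let P : ℝ := ∏ k ∈ Finset.univ.erase i, y k ^ α k
  have hmon : ∀ t, MLink.mon α (Function.update y i t) = t ^ α i * P := by
    intro t
    unfold MLink.mon
    rw [← Finset.mul_prod_erase _ _ (Finset.mem_univ i)]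
    simp only [Function.update_self, P]
    congr 1
    refine Finset.prod_congr rfl fun k hk => ?_
    rw [Function.update_of_ne (Finset.ne_of_mem_erase hk)]
  have h3 : HasDerivAt (fun t => φ (Function.update y i t))
      ((α i * (y i) ^ (α i - 1) * P) * u y + (y i ^ α i * P) * fderiv ℝ u y (Pi.single i 1))
      (y i) := by
    have h4 := ((hasDerivAt_pow (α i) (y i)).mul_const P).mul h2
    rw [hupd] at h4
    refine h4.congr_of_eventuallyEq ?_
    have ht : Tendsto (fun t => Function.update y i t) (𝓝 (y i)) (𝓝 y) := by
      have := hc.continuousAt.tendsto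
      rwa [hupd] at this
    filter_upwards [ht.eventually hy1] with t ht
    simp only [Pi.mul_apply]
    rw [ht, hmon]
  rw [h1.unique h3, hy1.self_of_nhds]
  have := hmon (y i)
  rw [hupd] at this
  rw [this]
  rcases Nat.eq_zero_or_pos (α i) with h0 | hpos
  · simp only [h0]
    field_simp
    simp
    ring
  · obtain ⟨a, ha⟩ : ∃ a, α i = a + 1 := ⟨α i - 1, by omega⟩
    rw [ha]
    field_simp
    simp
    ring

theorem tendsto_err {u : (ι → ℝ) → ℝ} (hu : AnalyticAt ℝ u 0) (hu0 : u 0 ≠ 0) (i : ι) :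
    Tendsto (fun y : ι → ℝ => fderiv ℝ u y (Pi.single i 1) * y i / u y) (𝓝 0) (𝓝 0) := by
  have h1 : ContinuousAt (fun y : ι → ℝ => fderiv ℝ u y (Pi.single i 1) * y i / u y) 0 := by
    refine ContinuousAt.div (ContinuousAt.mul ?_ (continuous_apply i).continuousAt)
      hu.continuousAt hu0
    exact (hu.fderiv.continuousAt).clm_apply continuousAt_const
  have := h1.tendsto
  simpa using this

/-- Radial derivative of a normal crossing function vanishing at the origin. -/
theorem NC.radial {φ : (ι → ℝ) → ℝ} (h : NC φ) (h0 : φ 0 = 0) :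
    ∀ᶠ y in 𝓝 (0 : ι → ℝ), 0 < φ y → 0 < fderiv ℝ φ y y := by
  obtain ⟨α, u, hu, hu0, hf⟩ := h
  have hα : ∃ k, α k ≠ 0 := by
    by_contra hcon; push Not at hcon
    have h1 := hf.self_of_nhds
    rw [h0] at h1
    exact mul_ne_zero (mon_ne_zero α 0 fun k hk => absurd (hcon k) hk) hu0 h1.symm
  have hsum : 1 ≤ ∑ i, α i := by
    obtain ⟨k, hk⟩ := hα
    have := Finset.single_le_sum (f := α) (fun i _ => Nat.zero_le _) (Finset.mem_univ k)
    omega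
  have herr : Tendsto (fun y : ι → ℝ => ∑ i, fderiv ℝ u y (Pi.single i 1) * y i / u y)
      (𝓝 0) (𝓝 0) := by
    have := tendsto_finsetSum Finset.univ fun i (_ : i ∈ Finset.univ) => tendsto_err hu hu0 i
    simpa using this
  have hall := eventually_all.2 fun i => NC.partial hu hu0 hf i
  filter_upwards [hall, herr.eventually (lt_mem_nhds (show (-1 : ℝ) < 0 by norm_num))]
    with y hy hy2 hpos
  have : fderiv ℝ φ y y = ∑ i, fderiv ℝ φ y (Pi.single i 1) * y i := by
    have e : fderiv ℝ φ y (∑ i, y i • Pi.single i 1) = fderiv ℝ φ y y := by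
      rw [← pi_eq_sum_univ' y]
    rw [← e, map_sum]
    refine Finset.sum_congr rfl fun i _ => ?_
    rw [map_smul, smul_eq_mul, mul_comm]
  rw [this, Finset.sum_congr rfl fun i _ => (hy i).2, ← Finset.mul_sum, Finset.sum_add_distrib]
  refine mul_pos hpos ?_
  have h3 : (1 : ℝ) ≤ ∑ i, (α i : ℝ) := by exact_mod_cast hsum
  linarith

/-- Gradient inequality for normal crossing functions. -/
theorem NC.grad {φ : (ι → ℝ) → ℝ} (h : NC φ) (h0 : φ 0 = 0) :
    ∃ N : ℕ, 1 ≤ N ∧ ∃ c > 0, ∀ᶠ y in 𝓝 (0 : ι → ℝ),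
      φ y ≠ 0 → c * |φ y| ^ (1 - 1 / (N : ℝ)) ≤ ‖fderiv ℝ φ y‖ := by
  obtain ⟨α, u, hu, hu0, hf⟩ := h
  have hα : ∃ k, α k ≠ 0 := by
    by_contra hcon; push Not at hcon
    have h1 := hf.self_of_nhds
    rw [h0] at h1
    exact mul_ne_zero (mon_ne_zero α 0 fun k hk => absurd (hcon k) hk) hu0 h1.symm
  have hsum : 1 ≤ ∑ i, α i := by
    obtain ⟨k, hk⟩ := hα
    have := Finset.single_le_sum (f := α) (fun i _ => Nat.zero_le _) (Finset.mem_univ k)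
    omega
  set N := ∑ i, α i with hN
  have hall := eventually_all.2 fun i => NC.partial hu hu0 hf i
  have herr := eventually_all.2 fun i => (tendsto_err hu hu0 i).eventually
    (lt_mem_nhds (show (-(1/2) : ℝ) < 0 by norm_num))
  have hub : ∀ᶠ y in 𝓝 (0 : ι → ℝ), |u 0| / 2 < |u y| :=
    (hu.continuousAt.abs).eventually (lt_mem_nhds (by
      have : 0 < |u 0| := abs_pos.2 hu0
      linarith))
  have hNpos : (0 : ℝ) < N := by exact_mod_cast hsum
  have hu0' : 0 < |u 0| / 2 := by have : 0 < |u 0| := abs_pos.2 hu0; linarith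
  refine ⟨N, hsum, (1 / 2) * (|u 0| / 2) ^ (1 / (N : ℝ)), by positivity, ?_⟩
  filter_upwards [hall, herr, hub, hf] with y hy hy2 hy3 hy4 hφ0
  obtain ⟨i, hi, hmin⟩ := Finset.exists_min_image (Finset.univ.filter fun k => α k ≠ 0)
    (fun k => |y k|) (by obtain ⟨k, hk⟩ := hα; exact ⟨k, by simp [hk]⟩)
  have hiα : α i ≠ 0 := by simpa using hi
  have hφpos : 0 < |φ y| := abs_pos.2 hφ0
  have hyi : y i ≠ 0 := by
    intro h
    rw [hy4, mon_eq_zero α y hiα h, zero_mul] at hφ0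
    exact hφ0 rfl
  have hyi' : 0 < |y i| := abs_pos.2 hyi
  have hmon : |y i| ^ N ≤ |MLink.mon α y| := by
    rw [hN, ← Finset.prod_pow_eq_pow_sum, MLink.mon, Finset.abs_prod]
    refine Finset.prod_le_prod (fun _ _ => by positivity) fun k _ => ?_
    rw [abs_pow]
    by_cases hk : α k = 0
    · simp [hk]
    · exact pow_le_pow_left₀ (abs_nonneg _) (hmin k (by simp [hk])) _
  have hφle : |y i| ^ N * (|u 0| / 2) ≤ |φ y| := by
    rw [hy4, abs_mul]
    exact mul_le_mul hmon hy3.le hu0'.le (abs_nonneg _)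
  have hroot : |y i| * (|u 0| / 2) ^ (1 / (N : ℝ)) ≤ |φ y| ^ (1 / (N : ℝ)) := by
    have := Real.rpow_le_rpow (by positivity) hφle (z := 1 / (N : ℝ)) (by positivity)
    rw [Real.mul_rpow (by positivity) hu0'.le] at this
    rwa [one_div, Real.pow_rpow_inv_natCast (abs_nonneg _) (by omega), ← one_div] at this
  have hpart : (1 / 2) * |φ y| ≤ ‖fderiv ℝ φ y‖ * |y i| := by
    have h1 : |fderiv ℝ φ y (Pi.single i 1)| ≤ ‖fderiv ℝ φ y‖ := by
      have := (fderiv ℝ φ y).le_opNorm (Pi.single i 1)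
      rw [Real.norm_eq_abs] at this
      refine this.trans ?_
      rw [Pi.norm_single]; simp
    have h2 : (1 / 2 : ℝ) * |φ y| ≤ |fderiv ℝ φ y (Pi.single i 1) * y i| := by
      rw [(hy i).2, abs_mul, mul_comm]
      refine mul_le_mul_of_nonneg_left ?_ (abs_nonneg _)
      refine le_trans ?_ (le_abs_self _)
      have h3 : (1 : ℝ) ≤ α i := by exact_mod_cast Nat.one_le_iff_ne_zero.2 hiα
      have := hy2 i
      linarith
    rw [abs_mul] at h2
    exact h2.trans (mul_le_mul_of_nonneg_right h1 (abs_nonneg _))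
  have hsplit : |φ y| = |φ y| ^ (1 - 1 / (N : ℝ)) * |φ y| ^ (1 / (N : ℝ)) := by
    rw [← Real.rpow_add hφpos]; simp
  have hA : 0 ≤ |φ y| ^ (1 - 1 / (N : ℝ)) := by positivity
  refine le_of_mul_le_mul_right ?_ hyi'
  refine le_trans ?_ hpart
  nlinarith [mul_le_mul_of_nonneg_left hroot hA]

end Grad

end MLink

namespace MLink

section Taylor

theorem iter_aux {a : ℝ} {q f : ℝ → ℝ} (hq : AnalyticAt ℝ q 0)
    (hf : f =ᶠ[𝓝 0] fun t => a + t * q t) (k : ℕ) :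
    iteratedDeriv (k + 1) f =ᶠ[𝓝 0]
      fun t => (k + 1) * iteratedDeriv k q t + t * iteratedDeriv (k + 1) q t := by
  induction k with
  | zero =>
    filter_upwards [hf.eventually_nhds, hq.eventually_analyticAt] with t ht hqt
    have h1 : deriv f t = deriv (fun t => a + t * q t) t := EventuallyEq.deriv_eq ht
    have h2 : HasDerivAt (fun t => a + t * q t) (1 * q t + t * deriv q t) t :=
      ((hasDerivAt_id t).mul hqt.differentiableAt.hasDerivAt).const_add a
    simp only [zero_add, iteratedDeriv_one, iteratedDeriv_zero]
    rw [h1, h2.deriv]; simp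
  | succ k ih =>
    filter_upwards [ih.eventually_nhds, hq.eventually_analyticAt] with t ht hqt
    rw [iteratedDeriv_succ (n := k + 1), EventuallyEq.deriv_eq ht]
    have hA : ∀ j, AnalyticAt ℝ (iteratedDeriv j q) t := fun j => by
      rw [iteratedDeriv_eq_iterate]; exact hqt.iterated_deriv j
    have h2 : HasDerivAt (fun t => ((k : ℝ) + 1) * iteratedDeriv k q t
        + t * iteratedDeriv (k + 1) q t)
        (((k : ℝ) + 1) * iteratedDeriv (k + 1) q t +
        (1 * iteratedDeriv (k + 1) q t + t * iteratedDeriv (k + 2) q t)) t := by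
      refine HasDerivAt.add (HasDerivAt.const_mul _ ?_) (HasDerivAt.mul (hasDerivAt_id t) ?_)
      · have := (hA k).differentiableAt.hasDerivAt
        rwa [← iteratedDeriv_succ] at this
      · have := (hA (k + 1)).differentiableAt.hasDerivAt
        rwa [← iteratedDeriv_succ] at this
    rw [h2.deriv]; push_cast; ring

theorem taylor1 (d : ℕ) : ∀ (A : ℕ → ℝ) (u f : ℝ → ℝ), AnalyticAt ℝ u 0 →
    (f =ᶠ[𝓝 0] fun t => ∑ i ∈ Finset.range d, A i * t ^ i + t ^ d * u t) →
    (∀ k < d, iteratedDeriv k f 0 = k.factorial * A k) ∧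
      iteratedDeriv d f 0 = d.factorial * u 0 := by
  induction d with
  | zero =>
    intro A u f hu hf
    refine ⟨by simp, ?_⟩
    have := hf.self_of_nhds
    simp at this
    simp [this]
  | succ d ih =>
    intro A u f hu hf
    let q : ℝ → ℝ := fun t => ∑ i ∈ Finset.range d, A (i + 1) * t ^ i + t ^ d * u t
    have hq : AnalyticAt ℝ q 0 := by
      refine AnalyticAt.add (Finset.analyticAt_fun_sum _ fun i _ => ?_) ?_
      · exact analyticAt_const.mul (analyticAt_id.pow i)
      · exact (analyticAt_id.pow d).mul hu
    have hfq : f =ᶠ[𝓝 0] fun t => A 0 + t * q t := by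
      filter_upwards [hf] with t ht
      rw [ht, Finset.sum_range_succ']
      simp only [q, mul_add, Finset.mul_sum, pow_zero, mul_one, pow_succ]
      have : ∀ i ∈ Finset.range d, A (i + 1) * (t ^ i * t) = t * (A (i + 1) * t ^ i) :=
        fun i _ => by ring
      rw [Finset.sum_congr rfl this]; ring
    obtain ⟨h1, h2⟩ := ih (fun i => A (i + 1)) u q hu EventuallyEq.rfl
    have h3 : ∀ k, iteratedDeriv (k + 1) f 0 = (k + 1) * iteratedDeriv k q 0 := by
      intro k
      have := (iter_aux hq hfq k).self_of_nhds
      simpa using this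
    constructor
    · intro k hk
      cases k with
      | zero =>
        have := hfq.self_of_nhds
        simp at this
        simp [this]
      | succ k =>
        rw [h3, h1 k (by omega), Nat.factorial_succ]; push_cast; ring
    · rw [h3, h2, Nat.factorial_succ]; push_cast; ring

variable {E : Type*} [NormedAddCommGroup E] [NormedSpace ℝ E]

/-- iterated derivative in the last variable -/
def Dk (k : ℕ) (f : E × ℝ → ℝ) (p : E × ℝ) : ℝ := iteratedDeriv k (fun t => f (p.1, t)) p.2

theorem slice_analyticAt {f : E × ℝ → ℝ} {p : E × ℝ} (hf : AnalyticAt ℝ f p) :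
    AnalyticAt ℝ (fun t => f (p.1, t)) p.2 :=
  AnalyticAt.comp (g := f) (f := fun t : ℝ => (p.1, t)) hf (AnalyticAt.prod analyticAt_const analyticAt_id)

theorem Dk_succ_eq {k : ℕ} {f : E × ℝ → ℝ} {p : E × ℝ} (hf : AnalyticAt ℝ (Dk k f) p) :
    Dk (k + 1) f p = fderiv ℝ (Dk k f) p (0, 1) := by
  have h1 : Dk (k + 1) f p = deriv (fun t => Dk k f (p.1, t)) p.2 := by
    simp only [Dk, iteratedDeriv_succ]
  rw [h1]
  have h2 : HasDerivAt (fun t : ℝ => (p.1, t)) ((0 : E), (1 : ℝ)) p.2 :=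
    (hasDerivAt_const p.2 p.1).prodMk (hasDerivAt_id p.2)
  exact (HasFDerivAt.comp_hasDerivAt (f := fun t : ℝ => (p.1, t)) p.2
    hf.differentiableAt.hasFDerivAt h2).deriv

theorem Dk_analyticAt {f : E × ℝ → ℝ} {p : E × ℝ} (hf : AnalyticAt ℝ f p) (k : ℕ) :
    AnalyticAt ℝ (Dk k f) p := by
  induction k with
  | zero => 
    have : (Dk 0 f) = f := by ext p; simp [Dk]
    rwa [this]
  | succ k ih =>
    have h1 : AnalyticAt ℝ (fun p => fderiv ℝ (Dk k f) p ((0 : E), (1 : ℝ))) p :=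
      ((ContinuousLinearMap.apply ℝ ℝ ((0 : E), (1 : ℝ))).analyticAt _).comp ih.fderiv
    refine h1.congr ?_
    filter_upwards [ih.eventually_analyticAt] with q hq using (Dk_succ_eq hq).symm

theorem snd_div {f : E × ℝ → ℝ} (hf : AnalyticAt ℝ f 0) :
    ∃ q : E × ℝ → ℝ, AnalyticAt ℝ q 0 ∧
      ∀ᶠ p in 𝓝 (0 : E × ℝ), f p = f (p.1, 0) + p.2 * q p := by
  obtain ⟨q, hq, h⟩ := exists_div hf (ContinuousLinearMap.snd ℝ E ℝ) ((0 : E), (1 : ℝ)) (by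
      intro s hs x
      simp only [ContinuousLinearMap.coe_snd', Prod.smul_mk, smul_zero, smul_eq_mul, mul_one]
      rw [Prod.norm_def, Prod.norm_def]
      refine max_le_max ?_ ?_
      · simp
      · simp only [Prod.snd_sub]
        have : x.2 - (1 - s) * x.2 = s * x.2 := by ring
        rw [this, norm_mul, Real.norm_of_nonneg hs.1]
        exact mul_le_of_le_one_left (norm_nonneg _) hs.2)
  refine ⟨q, hq, ?_⟩
  filter_upwards [h] with x hx
  rw [hx]
  congr 2
  simp
  ext <;> simp

theorem fst_analyticAt {f : E → ℝ} {p : E × ℝ} (hf : AnalyticAt ℝ f p.1) :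
    AnalyticAt ℝ (fun p : E × ℝ => f p.1) p :=
  AnalyticAt.comp (g := f) hf analyticAt_fst

theorem zero_sec_analyticAt {f : E × ℝ → ℝ} (hf : AnalyticAt ℝ f 0) :
    AnalyticAt ℝ (fun x : E => f (x, 0)) 0 :=
  AnalyticAt.comp (g := f) (f := fun x : E => (x, (0 : ℝ))) (x := 0) hf
    (AnalyticAt.prod analyticAt_id analyticAt_const)

/-- Taylor expansion in the last variable. -/
theorem taylor2 (d : ℕ) : ∀ f : E × ℝ → ℝ, AnalyticAt ℝ f 0 →
    ∃ (A : ℕ → E → ℝ) (u : E × ℝ → ℝ), (∀ i, AnalyticAt ℝ (A i) 0) ∧ AnalyticAt ℝ u 0 ∧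
      ∀ᶠ p in 𝓝 (0 : E × ℝ), f p = ∑ i ∈ Finset.range d, A i p.1 * p.2 ^ i + p.2 ^ d * u p := by
  induction d with
  | zero =>
    intro f hf
    exact ⟨fun _ _ => 0, f, fun _ => analyticAt_const, hf, Eventually.of_forall fun p => by simp⟩
  | succ d ih =>
    intro f hf
    obtain ⟨q, hq, hfq⟩ := snd_div hf
    obtain ⟨A, u, hA, hu, hq2⟩ := ih q hq
    refine ⟨fun i => if i = 0 then fun x => f (x, 0) else A (i - 1), u, ?_, hu, ?_⟩
    · intro i
      by_cases hi : i = 0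
      · simpa [hi] using zero_sec_analyticAt hf
      · simpa [hi] using hA _
    · filter_upwards [hfq, hq2] with p h1 h2
      rw [h1, h2, Finset.sum_range_succ']
      simp only [mul_add, Finset.mul_sum, pow_succ]
      simp
      have : ∀ i ∈ Finset.range d, p.2 * (A i p.1 * p.2 ^ i) = A i p.1 * (p.2 ^ i * p.2) :=
        fun i _ => by ring
      rw [Finset.sum_congr rfl this]; ring

theorem taylor2_coeff {d : ℕ} {f : E × ℝ → ℝ} {A : ℕ → E → ℝ} {u : E × ℝ → ℝ}
    (hu : AnalyticAt ℝ u 0)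
    (h : ∀ᶠ p in 𝓝 (0 : E × ℝ), f p = ∑ i ∈ Finset.range d, A i p.1 * p.2 ^ i + p.2 ^ d * u p) :
    ∀ᶠ x in 𝓝 (0 : E), (∀ k < d, Dk k f (x, 0) = k.factorial * A k x) ∧
      Dk d f (x, 0) = d.factorial * u (x, 0) := by
  have h' : ∀ᶠ x in 𝓝 (0 : E), ∀ᶠ t in 𝓝 (0 : ℝ),
      f (x, t) = ∑ i ∈ Finset.range d, A i x * t ^ i + t ^ d * u (x, t) :=
    Eventually.curry_nhds (p := fun p : E × ℝ =>
      f p = ∑ i ∈ Finset.range d, A i p.1 * p.2 ^ i + p.2 ^ d * u p) (x := (0 : E)) (y := (0 : ℝ)) h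
  have hu' : ∀ᶠ x in 𝓝 (0 : E), AnalyticAt ℝ u (x, 0) := by
    have : Tendsto (fun x : E => (x, (0 : ℝ))) (𝓝 0) (𝓝 0) :=
      (Continuous.prodMk_left (0 : ℝ)).tendsto (0 : E)
    exact this.eventually hu.eventually_analyticAt
  filter_upwards [h', hu'] with x hx hux
  exact taylor1 d (fun i => A i x) (fun t => u (x, t)) (fun t => f (x, t))
    (slice_analyticAt (p := (x, 0)) hux) hx

/-- order in the last variable -/
def Ord (f : E × ℝ → ℝ) (d : ℕ) : Prop := (∀ k < d, Dk k f 0 = 0) ∧ Dk d f 0 ≠ 0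

theorem exists_ord {f : E × ℝ → ℝ} {k : ℕ} (h : Dk k f 0 ≠ 0) : ∃ e ≤ k, Ord f e := by
  classical
  have hex : ∃ k, Dk k f 0 ≠ 0 := ⟨k, h⟩
  refine ⟨Nat.find hex, Nat.find_min' hex h, ?_, Nat.find_spec hex⟩
  intro j hj
  by_contra hc
  exact Nat.find_min hex hj hc

theorem exists_Dk_ne {f : E × ℝ → ℝ} (hf : AnalyticAt ℝ f 0)
    (h : ¬ ∀ᶠ t in 𝓝 (0 : ℝ), f (0, t) = 0) : ∃ k, Dk k f 0 ≠ 0 := by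
  have h1 : AnalyticAt ℝ (fun t => f ((0 : E), t)) 0 := slice_analyticAt (p := 0) hf
  obtain ⟨d, w, hw, hw0, hfw⟩ := h1.exists_eventuallyEq_pow_smul_nonzero_iff.2 h
  refine ⟨d, ?_⟩
  have := (taylor1 d (fun _ => 0) w (fun t => f ((0 : E), t)) hw (by
    filter_upwards [hfw] with t ht
    simpa using ht)).2
  change iteratedDeriv d (fun t => f ((0 : E), t)) 0 ≠ 0
  rw [this]
  exact mul_ne_zero (by exact_mod_cast Nat.factorial_ne_zero d) hw0

/-- Tschirnhausen: killing the subleading coefficient. -/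
theorem tschirnhausen [CompleteSpace E] {f : E × ℝ → ℝ} (hf : AnalyticAt ℝ f 0) {d : ℕ}
    (hd : Ord f (d + 1)) :
    ∃ φ : E → ℝ, AnalyticAt ℝ φ 0 ∧ φ 0 = 0 ∧
    ∃ (A : ℕ → E → ℝ) (u : E × ℝ → ℝ), (∀ i, AnalyticAt ℝ (A i) 0) ∧ AnalyticAt ℝ u 0 ∧
      u 0 ≠ 0 ∧ (∀ᶠ x in 𝓝 (0 : E), A d x = 0) ∧
      ∀ᶠ p in 𝓝 (0 : E × ℝ), f (p.1, p.2 + φ p.1) =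
        ∑ i ∈ Finset.range (d + 1), A i p.1 * p.2 ^ i + p.2 ^ (d + 1) * u p := by
  have hF := Dk_analyticAt hf d
  have hF0 : Dk d f 0 = 0 := hd.1 d (by omega)
  have hF1 : fderiv ℝ (Dk d f) 0 (0, 1) ≠ 0 := by
    rw [← Dk_succ_eq hF]; exact hd.2
  have cdf : ContDiffAt ℝ ⊤ (Dk d f) ((0 : E), (0 : ℝ)) := hF.contDiffAt
  have inv : (fderiv ℝ (Dk d f) ((0 : E), (0 : ℝ)) ∘L .inr ℝ E ℝ).IsInvertible := by
    set c := fderiv ℝ (Dk d f) 0 (0, 1) with hc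
    refine ⟨ContinuousLinearEquiv.smulLeft (M₁ := ℝ) (Units.mk0 c hF1), ?_⟩
    ext
    simp [hc]
    rfl
  let φ := cdf.implicitFunction (by simp) inv
  have hφ0 : φ 0 = 0 := cdf.implicitFunction_apply_self (by simp) inv
  have hφ : AnalyticAt ℝ φ 0 := (cdf.contDiffAt_implicitFunction (by simp) inv).analyticAt
  have hφ2 : ∀ᶠ x in 𝓝 (0 : E), Dk d f (x, φ x) = 0 := by
    filter_upwards [cdf.eventually_apply_implicitFunction (by simp) inv] with x hx
    exact hx.trans hF0
  refine ⟨φ, hφ, hφ0, ?_⟩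
  let f' : E × ℝ → ℝ := fun p => f (p.1, p.2 + φ p.1)
  have hf' : AnalyticAt ℝ f' 0 := by
    refine AnalyticAt.comp (g := f) (f := fun p : E × ℝ => (p.1, p.2 + φ p.1)) (x := 0) ?_ ?_
    · have : ((0 : E × ℝ).1, (0 : E × ℝ).2 + φ (0 : E × ℝ).1) = 0 := by simp [hφ0]
      rwa [this]
    · exact AnalyticAt.prod analyticAt_fst (analyticAt_snd.add (fst_analyticAt hφ))
  have hDk : ∀ k x, Dk k f' (x, 0) = Dk k f (x, φ x) := by
    intro k x
    simp only [Dk, f']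
    rw [iteratedDeriv_comp_add_const (f := fun t => f (x, t))]
    simp
  obtain ⟨A, u, hA, hu, h⟩ := taylor2 (d + 1) f' hf'
  have hco := taylor2_coeff hu h
  refine ⟨A, u, hA, hu, ?_, ?_, h⟩
  · have := hco.self_of_nhds.2
    rw [hDk, hφ0] at this
    intro h0
    apply hd.2
    change Dk (d + 1) f (0, 0) = 0
    rw [this]
    change _ * u 0 = 0
    rw [h0, mul_zero]
  · filter_upwards [hco, hφ2] with x hx hx2
    have := hx.1 d (by omega)
    rw [hDk, hx2] at this
    have h3 : (d.factorial : ℝ) ≠ 0 := by exact_mod_cast Nat.factorial_ne_zero d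
    exact (mul_eq_zero.1 this.symm).resolve_left h3

end Taylor

end MLink

namespace MLink

section GoodDef

variable {ι : Type*} [Fintype ι] [DecidableEq ι]

/-- Normal crossings on a product. -/
def NC' (f : (ι → ℝ) × ℝ → ℝ) : Prop :=
  ∃ (α : ι → ℕ) (β : ℕ) (u : (ι → ℝ) × ℝ → ℝ), AnalyticAt ℝ u 0 ∧ u 0 ≠ 0 ∧
    ∀ᶠ p in 𝓝 (0 : (ι → ℝ) × ℝ), f p = mon α p.1 * p.2 ^ β * u p

def Good (f : (ι → ℝ) × ℝ → ℝ) (U : Ultrafilter ((ι → ℝ) × ℝ)) : Prop :=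
  ∃ π : (ι → ℝ) × ℝ → (ι → ℝ) × ℝ, AnalyticAt ℝ π 0 ∧ π 0 = 0 ∧
    ∃ V : Ultrafilter ((ι → ℝ) × ℝ), V.toFilter ≤ 𝓝 0 ∧ V.map π = U ∧ NC' (f ∘ π)

/-- Local uniformization of functions on `ι → ℝ`. -/
def UN (ι : Type*) [Fintype ι] : Prop :=
  ∀ f : (ι → ℝ) → ℝ, AnalyticAt ℝ f 0 → NZ f → ∀ U : Ultrafilter (ι → ℝ),
    U.toFilter ≤ 𝓝 0 → ∃ π : (ι → ℝ) → (ι → ℝ), AnalyticAt ℝ π 0 ∧ π 0 = 0 ∧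
      ∃ V : Ultrafilter (ι → ℝ), V.toFilter ≤ 𝓝 0 ∧ V.map π = U ∧ NC (f ∘ π)

theorem NC'.congr {f g : (ι → ℝ) × ℝ → ℝ} (h : NC' f) (hfg : ∀ᶠ p in 𝓝 0, f p = g p) :
    NC' g := by
  obtain ⟨α, β, u, hu, hu0, hf⟩ := h
  refine ⟨α, β, u, hu, hu0, ?_⟩
  filter_upwards [hf, hfg] with x h1 h2
  rw [← h2, h1]

theorem tendsto_zero_of_analytic {E F : Type*} [NormedAddCommGroup E] [NormedSpace ℝ E]
    [NormedAddCommGroup F] [NormedSpace ℝ F] {π : E → F} (h : AnalyticAt ℝ π 0) (h0 : π 0 = 0) :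
    Tendsto π (𝓝 0) (𝓝 0) := by
  have := h.continuousAt.tendsto
  rwa [h0] at this

theorem analytic_comp {E F G : Type*} [NormedAddCommGroup E] [NormedSpace ℝ E]
    [NormedAddCommGroup F] [NormedSpace ℝ F] [NormedAddCommGroup G] [NormedSpace ℝ G]
    {f : F → G} {π : E → F} (hf : AnalyticAt ℝ f 0) (h : AnalyticAt ℝ π 0) (h0 : π 0 = 0) :
    AnalyticAt ℝ (fun x => f (π x)) 0 :=
  AnalyticAt.comp (g := f) (by rwa [h0]) h

theorem Good.congr {f g : (ι → ℝ) × ℝ → ℝ} {U : Ultrafilter ((ι → ℝ) × ℝ)} (h : Good f U)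
    (hfg : ∀ᶠ p in 𝓝 0, f p = g p) : Good g U := by
  obtain ⟨π, hπ, hπ0, V, hV, hVU, hNC⟩ := h
  refine ⟨π, hπ, hπ0, V, hV, hVU, hNC.congr ?_⟩
  exact (tendsto_zero_of_analytic hπ hπ0).eventually hfg

theorem Good.comp {f : (ι → ℝ) × ℝ → ℝ} {U V : Ultrafilter ((ι → ℝ) × ℝ)}
    {π : (ι → ℝ) × ℝ → (ι → ℝ) × ℝ} (hπ : AnalyticAt ℝ π 0) (hπ0 : π 0 = 0)
    (hVU : V.map π = U) (h : Good (f ∘ π) V) : Good f U := by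
  obtain ⟨π', hπ', hπ0', W, hW, hWV, hNC⟩ := h
  refine ⟨π ∘ π', analytic_comp (f := π) (π := π') hπ hπ' hπ0', by simp [hπ0', hπ0], W, hW, ?_, hNC⟩
  rw [← hVU, ← hWV, Ultrafilter.map_map]

theorem Good.of_section {f : (ι → ℝ) × ℝ → ℝ} {U : Ultrafilter ((ι → ℝ) × ℝ)}
    {π s : (ι → ℝ) × ℝ → (ι → ℝ) × ℝ} (hπ : AnalyticAt ℝ π 0) (hπ0 : π 0 = 0)
    (hs : Tendsto s U (𝓝 0)) (hsec : ∀ᶠ p in (U : Filter ((ι → ℝ) × ℝ)), π (s p) = p)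
    (h : ∀ V : Ultrafilter ((ι → ℝ) × ℝ), V.toFilter ≤ 𝓝 0 → Good (f ∘ π) V) : Good f U := by
  refine Good.comp (V := U.map s) hπ hπ0 ?_ (h _ hs)
  rw [Ultrafilter.map_map]
  apply Ultrafilter.coe_injective
  rw [Ultrafilter.coe_map]
  have : (π ∘ s) =ᶠ[U.toFilter] id := hsec
  rw [Filter.map_congr this, Filter.map_id]

/-- lifting an ultrafilter along `π × id` -/
theorem Good.lift {f : (ι → ℝ) × ℝ → ℝ} {U : Ultrafilter ((ι → ℝ) × ℝ)}
    (hU : U.toFilter ≤ 𝓝 0)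
    {π : (ι → ℝ) → (ι → ℝ)} (hπ : AnalyticAt ℝ π 0) (hπ0 : π 0 = 0)
    {V : Ultrafilter (ι → ℝ)} (hV : V.toFilter ≤ 𝓝 0) (hVU : V.map π = U.map Prod.fst)
    (h : ∀ W : Ultrafilter ((ι → ℝ) × ℝ), W.toFilter ≤ 𝓝 0 →
      Good (fun p => f (π p.1, p.2)) W) : Good f U := by
  let Q : (ι → ℝ) × ℝ → (ι → ℝ) × ℝ := fun p => (π p.1, p.2)
  have hQ : AnalyticAt ℝ Q 0 :=
    AnalyticAt.prod (AnalyticAt.comp (g := π) (f := Prod.fst) hπ analyticAt_fst) analyticAt_snd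
  have hQ0 : Q 0 = 0 := by simp [Q, hπ0]
  have hne : (comap Prod.fst (V : Filter (ι → ℝ)) ⊓ comap Q U.toFilter).NeBot := by
    rw [Filter.inf_neBot_iff]
    intro s hs s' hs'
    obtain ⟨a, ha, has⟩ := hs
    obtain ⟨b, hb, hbs⟩ := hs'
    have h1 : π '' a ∈ V.map π := Ultrafilter.mem_map.2 (V.mem_of_superset ha (subset_preimage_image _ _))
    rw [hVU] at h1
    have h2 : Prod.fst ⁻¹' (π '' a) ∈ U := h1
    obtain ⟨p, hp1, hp2⟩ := U.nonempty_of_mem (U.inter_mem h2 hb)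
    obtain ⟨y, hy, hyp⟩ := hp1
    refine ⟨(y, p.2), has hy, hbs ?_⟩
    have : Q (y, p.2) = p := by simp [Q, hyp]
    change Q (y, p.2) ∈ b
    rwa [this]
  let W := Ultrafilter.of (comap Prod.fst (V : Filter (ι → ℝ)) ⊓ comap Q U.toFilter)
  have hW : W.toFilter ≤ _ := Ultrafilter.of_le _
  have hW1 : Tendsto Prod.fst (W : Filter ((ι → ℝ) × ℝ)) (𝓝 0) :=
    (map_mono (hW.trans inf_le_left)).trans (map_comap_le.trans hV)
  have hW2 : map Q W.toFilter ≤ U := (map_mono (hW.trans inf_le_right)).trans map_comap_le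
  have hWU : W.map Q = U := by
    apply Ultrafilter.coe_le_coe.1
    rw [Ultrafilter.coe_map]
    exact hW2
  refine Good.comp hQ hQ0 hWU (h W ?_)
  have hW3 : Tendsto Prod.snd (W : Filter ((ι → ℝ) × ℝ)) (𝓝 0) := by
    have : Tendsto (Prod.snd ∘ Q) (W : Filter ((ι → ℝ) × ℝ)) (𝓝 (0 : (ι → ℝ) × ℝ).2) :=
      (continuous_snd.tendsto _).comp (hW2.trans hU)
    exact this
  have := hW1.prodMk_nhds hW3
  exact this

theorem uf_tendsto_or {α : Type*} (U : Ultrafilter α) (g : α → ℝ) {C : ℝ}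
    (h : ∀ᶠ x in (U : Filter α), |g x| ≤ C) : ∃ c, Tendsto g U (𝓝 c) := by
  have h1 : (U.map g : Filter ℝ) ≤ 𝓟 (Icc (-C) C) := by
    rw [le_principal_iff, Ultrafilter.coe_map, Filter.mem_map]
    filter_upwards [h] with x hx using abs_le.1 hx
  obtain ⟨c, -, hc⟩ := isCompact_Icc.ultrafilter_le_nhds (U.map g) h1
  exact ⟨c, hc⟩

/-- The power substitution. -/
theorem power_lift (V : Ultrafilter (ι → ℝ)) (hV : V.toFilter ≤ 𝓝 0) (m : ℕ) (hm : m ≠ 0) :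
    ∃ σ : ι → ℝ, (∀ k, σ k = 1 ∨ σ k = -1) ∧ ∃ V' : Ultrafilter (ι → ℝ), V'.toFilter ≤ 𝓝 0 ∧
      V'.map (fun y k => σ k * y k ^ m) = V := by
  have hex : ∀ k, ∃ s : ℝ, (s = 1 ∨ s = -1) ∧ ∀ᶠ x in (V : Filter (ι → ℝ)), 0 ≤ s * x k := by
    intro k
    rcases Ultrafilter.eventually_or.1 (Eventually.of_forall (f := (V : Filter (ι → ℝ)))
      fun x => le_total 0 (x k)) with h | h
    · exact ⟨1, Or.inl rfl, by simpa using h⟩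
    · exact ⟨-1, Or.inr rfl, by simpa using h⟩
  choose σ hσ1 hσ2 using hex
  refine ⟨σ, hσ1, V.map (fun x k => (σ k * x k) ^ (1 / (m : ℝ))), ?_, ?_⟩
  · rw [Ultrafilter.coe_map]
    have hc : Continuous fun (x : ι → ℝ) k => (σ k * x k) ^ (1 / (m : ℝ)) := by
      refine continuous_pi fun k => ?_
      exact (continuous_const.mul (continuous_apply k)).rpow_const fun _ => Or.inr (by positivity)
    have := hc.tendsto 0
    have h0 : (fun k => (σ k * (0 : ι → ℝ) k) ^ (1 / (m : ℝ))) = (0 : ι → ℝ) := by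
      ext k
      simp [Real.zero_rpow (inv_ne_zero (Nat.cast_ne_zero.2 hm))]
    rw [h0] at this
    exact this.comp hV
  · rw [Ultrafilter.map_map]
    apply Ultrafilter.coe_injective
    rw [Ultrafilter.coe_map]
    have : ((fun (y : ι → ℝ) k => σ k * y k ^ m) ∘ fun (x : ι → ℝ) k => (σ k * x k) ^ (1 / (m : ℝ)))
        =ᶠ[V.toFilter] id := by
      filter_upwards [eventually_all.2 hσ2] with x hx
      ext k
      simp only [Function.comp, id]
      rw [one_div, Real.rpow_inv_natCast_pow (hx k) hm, ← mul_assoc]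
      rcases hσ1 k with h | h <;> simp [h]
    rw [Filter.map_congr this, Filter.map_id]

end GoodDef

end MLink

namespace MLink

theorem poly_deriv (d : ℕ) (β : ℕ → ℝ) (u0 c : ℝ) (hβ : β d = 0) :
    iteratedDeriv d (fun y => ∑ i ∈ Finset.range (d + 1), β i * (y + c) ^ i
      + (y + c) ^ (d + 1) * u0) 0 = (d + 1).factorial * u0 * c := by
  have h1 := iteratedDeriv_comp_add_const (n := d) (s := c)
    (f := fun y => ∑ i ∈ Finset.range (d + 1), β i * y ^ i + y ^ (d + 1) * u0)
  have h2 := congrFun h1 0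
  rw [h2, zero_add, iteratedDeriv_fun_add (by fun_prop) (by fun_prop),
    iteratedDeriv_fun_sum (fun i _ => by fun_prop)]
  have h3 : ∀ i ∈ Finset.range (d + 1), iteratedDeriv d (fun y => β i * y ^ i) c = 0 := by
    intro i hi
    rw [iteratedDeriv_const_mul_field, iteratedDeriv_pow]
    rcases Nat.lt_or_ge i d with h | h
    · simp [Nat.descFactorial_eq_zero_iff_lt.2 h]
    · have : i = d := by have := Finset.mem_range.1 hi; omega
      subst this; simp [hβ]
  rw [Finset.sum_eq_zero h3]
  have h4 : (fun y : ℝ => y ^ (d + 1) * u0) = fun y => u0 * y ^ (d + 1) := by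
    ext y; ring
  rw [h4, iteratedDeriv_const_mul_field, iteratedDeriv_pow]
  have : (d + 1).descFactorial d = (d + 1).factorial := by
    have := Nat.factorial_mul_descFactorial (show d ≤ d + 1 by omega)
    simpa using this
  rw [this]
  simp; ring

section W

variable {ι : Type*} [Fintype ι] [DecidableEq ι]

def VN (ι : Type*) [Fintype ι] (d : ℕ) : Prop :=
  ∀ (h : (ι → ℝ) → ℝ) (f : (ι → ℝ) × ℝ → ℝ), AnalyticAt ℝ h 0 → NZ h → AnalyticAt ℝ f 0 →
    Ord f d → ∀ U : Ultrafilter ((ι → ℝ) × ℝ), U.toFilter ≤ 𝓝 0 →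
      Good (fun p => h p.1 * f p) U

theorem mon_update (α : ι → ℕ) (x : ι → ℝ) (k : ι) (t : ℝ) :
    mon α (Function.update x k (t * x k)) = t ^ α k * mon α x := by
  unfold mon
  rw [← Finset.mul_prod_erase _ _ (Finset.mem_univ k),
    ← Finset.mul_prod_erase Finset.univ (fun i => x i ^ α i) (Finset.mem_univ k)]
  simp only [Function.update_self]
  rw [mul_pow, mul_assoc]
  congr 2
  refine Finset.prod_congr rfl fun i hi => ?_
  rw [Function.update_of_ne (Finset.ne_of_mem_erase hi)]

theorem exists_pred (μ : ι → ℕ) {k : ι} (hk : μ k ≠ 0) :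
    ∃ μ' : ι → ℕ, ∑ i, μ i = ∑ i, μ' i + 1 ∧ ∀ x, mon μ x = x k * mon μ' x := by
  have hsp : μ = Pi.single k 1 + (μ - Pi.single k 1) := by
    ext i
    by_cases hi : i = k
    · subst hi; simp; omega
    · simp [hi]
  refine ⟨μ - Pi.single k 1, ?_, fun x => ?_⟩
  · conv_lhs => rw [hsp]
    simp [Finset.sum_add_distrib, add_comm]
  · conv_lhs => rw [hsp, mon_add, mon_single]

theorem fst_coord_analyticAt (k : ι) (p : (ι → ℝ) × ℝ) :
    AnalyticAt ℝ (fun p : (ι → ℝ) × ℝ => p.1 k) p :=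
  fst_analyticAt (analyticAt_coord k _)

theorem W_step {d : ℕ} (hV : ∀ e ≤ d, VN ι e) (N : ℕ) : ∀ (μ : ι → ℕ), ∑ i, μ i = N →
    ∀ (h : (ι → ℝ) → ℝ) (b : ℕ → (ι → ℝ) → ℝ) (u : (ι → ℝ) × ℝ → ℝ), AnalyticAt ℝ h 0 → NC h →
    (∀ i, AnalyticAt ℝ (b i) 0) → AnalyticAt ℝ u 0 → u 0 ≠ 0 → (∃ i ≤ d, b i 0 ≠ 0) →
    (∀ᶠ x in 𝓝 (0 : ι → ℝ), b d x = 0) →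
    ∀ U : Ultrafilter ((ι → ℝ) × ℝ), U.toFilter ≤ 𝓝 0 →
    Good (fun p => h p.1 * (∑ i ∈ Finset.range (d + 1), mon μ p.1 ^ (d + 1 - i) * b i p.1 * p.2 ^ i
      + p.2 ^ (d + 1) * u p)) U := by
  induction N with
  | zero =>
    intro μ hμ h b u ha hNC hb hu hu0 hi0 hbd U hU
    have hμ0 : μ = 0 := by
      ext i; simpa using Finset.sum_eq_zero_iff.1 hμ i (Finset.mem_univ i)
    obtain ⟨i0, hi0d, hi0⟩ := hi0
    let f : (ι → ℝ) × ℝ → ℝ := fun p => ∑ i ∈ Finset.range (d + 1), b i p.1 * p.2 ^ i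
      + p.2 ^ (d + 1) * u p
    have hf : AnalyticAt ℝ f 0 := by
      refine AnalyticAt.add (Finset.analyticAt_fun_sum _ fun i _ => ?_) ?_
      · exact (fst_analyticAt (hb i)).mul (analyticAt_snd.pow i)
      · exact (analyticAt_snd.pow (d + 1)).mul hu
    have h1 := (taylor2_coeff (f := f) (A := b) hu (Eventually.of_forall fun p => rfl)).self_of_nhds.1
      i0 (by omega)
    have h2 : Dk i0 f 0 ≠ 0 := by
      change Dk i0 f (0, 0) ≠ 0
      rw [h1]
      exact mul_ne_zero (by exact_mod_cast Nat.factorial_ne_zero _) hi0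
    obtain ⟨e, he, hord⟩ := exists_ord h2
    refine (hV e (by omega) h f ha hNC.nz hf hord U hU).congr (Eventually.of_forall fun p => ?_)
    simp [f, hμ0, mon_zero]
  | succ N ih =>
    intro μ hμ h b u ha hNC hb hu hu0 hi0 hbd U hU
    obtain ⟨k, hk⟩ : ∃ k, μ k ≠ 0 := by
      by_contra hcon; push Not at hcon
      simp [hcon] at hμ
    obtain ⟨μ', hμ', hmon⟩ := exists_pred μ hk
    have htx : Tendsto (fun p : (ι → ℝ) × ℝ => p.1) U (𝓝 0) :=
      (continuous_fst.tendsto (0 : (ι → ℝ) × ℝ)).comp hU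
    have htt : Tendsto (fun p : (ι → ℝ) × ℝ => p.2) U (𝓝 0) :=
      (continuous_snd.tendsto (0 : (ι → ℝ) × ℝ)).comp hU
    by_cases hC : ∃ C : ℝ, ∀ᶠ p in (U : Filter ((ι → ℝ) × ℝ)), |p.2| ≤ C * |p.1 k|
    · obtain ⟨C, hC⟩ := hC
      have hbound : ∀ᶠ p in (U : Filter ((ι → ℝ) × ℝ)), |p.2 / p.1 k| ≤ |C| := by
        filter_upwards [hC] with p hp
        rw [abs_div]
        refine div_le_of_le_mul₀ (abs_nonneg _) (abs_nonneg _) (hp.trans ?_)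
        exact mul_le_mul_of_nonneg_right (le_abs_self C) (abs_nonneg _)
      obtain ⟨c, hc⟩ := uf_tendsto_or U _ hbound
      let π : (ι → ℝ) × ℝ → (ι → ℝ) × ℝ := fun p => (p.1, p.1 k * (p.2 + c))
      let s : (ι → ℝ) × ℝ → (ι → ℝ) × ℝ := fun p => (p.1, p.2 / p.1 k - c)
      have hπ : AnalyticAt ℝ π 0 := AnalyticAt.prod analyticAt_fst
        ((fst_coord_analyticAt k 0).mul (analyticAt_snd.add analyticAt_const))
      have hπ0 : π 0 = 0 := by simp [π]
      have hs : Tendsto s U (𝓝 0) := by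
        have h1 : Tendsto (fun p : (ι → ℝ) × ℝ => p.2 / p.1 k - c) U (𝓝 0) := by
          simpa using hc.sub_const c
        exact htx.prodMk_nhds h1
      have hsec : ∀ᶠ p in (U : Filter ((ι → ℝ) × ℝ)), π (s p) = p := by
        filter_upwards [hC] with p hp
        simp only [π, s, sub_add_cancel]
        by_cases h0 : p.1 k = 0
        · have : p.2 = 0 := by simpa [h0] using hp
          ext <;> simp [h0, this]
        · ext
          · rfl
          · simp [mul_div_cancel₀ _ h0]
      refine Good.of_section hπ hπ0 hs hsec fun V hV0 => ?_
      let h' : (ι → ℝ) → ℝ := fun x => h x * x k ^ (d + 1)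
      have ha' : AnalyticAt ℝ h' 0 := ha.mul ((analyticAt_coord k 0).pow _)
      have hNC' : NC h' := by
        refine (hNC.mul (NC.mon ((d + 1) • Pi.single k 1))).congr (Eventually.of_forall fun x => ?_)
        simp only [h']
        rw [mon_smul, mon_single]
      let u' : (ι → ℝ) × ℝ → ℝ := fun p => u (π p)
      have hu' : AnalyticAt ℝ u' 0 := analytic_comp hu hπ hπ0
      have hu0' : u' 0 = u 0 := by simp [u', hπ0]
      let f1 : (ι → ℝ) × ℝ → ℝ := fun p =>
        ∑ i ∈ Finset.range (d + 1), mon μ' p.1 ^ (d + 1 - i) * b i p.1 * (p.2 + c) ^ i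
          + (p.2 + c) ^ (d + 1) * u' p
      have hcomp : ∀ p, h p.1 * (∑ i ∈ Finset.range (d + 1),
          mon μ p.1 ^ (d + 1 - i) * b i p.1 * (p.1 k * (p.2 + c)) ^ i
          + (p.1 k * (p.2 + c)) ^ (d + 1) * u (π p)) = h' p.1 * f1 p := by
        intro p
        simp only [h', f1, u']
        rw [mul_assoc]
        congr 1
        rw [mul_add (p.1 k ^ (d + 1)), Finset.mul_sum]
        congr 1
        · refine Finset.sum_congr rfl fun i hi => ?_
          have hid : i ≤ d := by have := Finset.mem_range.1 hi; omega
          have e1 : p.1 k ^ (d + 1) = p.1 k ^ (d + 1 - i) * p.1 k ^ i := by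
            rw [← pow_add]; congr 1; omega
          rw [hmon, mul_pow, mul_pow, e1]; ring
        · rw [mul_pow]; ring
      by_cases hc0 : c = 0
      · refine (ih μ' (by omega) h' b u' ha' hNC' hb hu' (by rwa [hu0']) hi0 hbd V hV0).congr
          (Eventually.of_forall fun p => ?_)
        have := hcomp p
        simp only [f1, hc0, add_zero] at this
        simp only [Function.comp, π, hc0, add_zero]
        rw [← this]
        simp [π, hc0]
      · have hf1 : AnalyticAt ℝ f1 0 := by
          refine AnalyticAt.add (Finset.analyticAt_fun_sum _ fun i _ => ?_) ?_
          · exact ((fst_analyticAt ((mon_analyticAt μ' _).pow _)).mul (fst_analyticAt (hb i))).mul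
              ((analyticAt_snd.add analyticAt_const).pow i)
          · exact ((analyticAt_snd.add analyticAt_const).pow (d + 1)).mul hu'
        have hDk : Dk d f1 0 ≠ 0 := by
          have h1 : (fun t => f1 (0, t)) = fun y => ∑ i ∈ Finset.range (d + 1),
              (mon μ' 0 ^ (d + 1 - i) * b i 0) * (y + c) ^ i + (y + c) ^ (d + 1) * u 0 := by
            ext y
            have : π (0, y) = 0 := by simp [π]
            simp [f1, u', this]
          change iteratedDeriv d (fun t => f1 (0, t)) 0 ≠ 0
          rw [h1, poly_deriv d (fun i => mon μ' 0 ^ (d + 1 - i) * b i 0) (u 0) c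
            (by simp [hbd.self_of_nhds])]
          exact mul_ne_zero (mul_ne_zero (by exact_mod_cast Nat.factorial_ne_zero _) hu0) hc0
        obtain ⟨e, he, hord⟩ := exists_ord hDk
        refine (hV e he h' f1 ha' hNC'.nz hf1 hord V hV0).congr (Eventually.of_forall fun p => ?_)
        exact (hcomp p).symm
    · push Not at hC
      have hC' : ∀ C : ℝ, ∀ᶠ p in (U : Filter ((ι → ℝ) × ℝ)), C * |p.1 k| < |p.2| := by
        intro C
        exact hC C
      let π : (ι → ℝ) × ℝ → (ι → ℝ) × ℝ := fun p => (Function.update p.1 k (p.2 * p.1 k), p.2)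
      let s : (ι → ℝ) × ℝ → (ι → ℝ) × ℝ := fun p => (Function.update p.1 k (p.1 k / p.2), p.2)
      have hπ : AnalyticAt ℝ π 0 := by
        refine AnalyticAt.prod (AnalyticAt.pi fun i => ?_) analyticAt_snd
        by_cases hi : i = k
        · subst hi
          simp only [Function.update_self]
          exact analyticAt_snd.mul (fst_coord_analyticAt i 0)
        · simpa [hi] using fst_coord_analyticAt i 0
      have hπ0 : π 0 = 0 := by
        simp [π]
      have hs : Tendsto s U (𝓝 0) := by
        refine Tendsto.prodMk_nhds (x := (0 : ι → ℝ)) (y := (0 : ℝ)) ?_ htt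
        rw [tendsto_pi_nhds]
        intro i
        by_cases hi : i = k
        · subst hi
          simp only [Function.update_self, Pi.zero_apply]
          rw [Metric.tendsto_nhds]
          intro ε hε
          filter_upwards [hC' ε⁻¹] with p hp
          rw [dist_zero_right, Real.norm_eq_abs, abs_div]
          have hp2 : 0 < |p.2| := lt_of_le_of_lt (by positivity) hp
          rw [div_lt_iff₀ hp2]
          rwa [inv_mul_lt_iff₀ hε] at hp
        · simp only [Function.update_of_ne hi]
          exact (tendsto_pi_nhds.1 htx) i
      have hsec : ∀ᶠ p in (U : Filter ((ι → ℝ) × ℝ)), π (s p) = p := by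
        filter_upwards [hC' 0] with p hp
        have hp2 : p.2 ≠ 0 := by
          rw [zero_mul] at hp; exact abs_pos.1 hp
        simp only [π, s, Function.update_self, Function.update_idem]
        rw [mul_div_cancel₀ _ hp2, Function.update_eq_self]
      refine Good.of_section hπ hπ0 hs hsec fun V hV0 => ?_
      refine ⟨id, analyticAt_id, rfl, V, hV0, Ultrafilter.map_id V, ?_⟩
      obtain ⟨α, v, hv, hv0, hh⟩ := hNC
      have hπ1 : AnalyticAt ℝ (fun p => (π p).1) 0 := analyticAt_fst.fun_comp hπ
      have hπ10 : (π 0).1 = 0 := by rw [hπ0]; rfl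
      let w : (ι → ℝ) × ℝ → ℝ := fun p => v (π p).1 *
        (∑ i ∈ Finset.range (d + 1), p.2 ^ ((μ k - 1) * (d + 1 - i)) * mon μ p.1 ^ (d + 1 - i)
          * b i (π p).1 + u (π p))
      have hw : AnalyticAt ℝ w 0 := by
        refine AnalyticAt.mul (analytic_comp hv hπ1 hπ10) (AnalyticAt.add
          (Finset.analyticAt_fun_sum _ fun i _ => ?_) (analytic_comp hu hπ hπ0))
        exact ((analyticAt_snd.pow _).mul (fst_analyticAt ((mon_analyticAt μ _).pow _))).mul
          (analytic_comp (hb i) hπ1 hπ10)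
      have hw0 : w 0 ≠ 0 := by
        have : ∑ i ∈ Finset.range (d + 1), (0 : (ι → ℝ) × ℝ).2 ^ ((μ k - 1) * (d + 1 - i)) *
            mon μ (0 : (ι → ℝ) × ℝ).1 ^ (d + 1 - i) * b i (π 0).1 = 0 := by
          refine Finset.sum_eq_zero fun i hi => ?_
          have hid : d + 1 - i ≠ 0 := by have := Finset.mem_range.1 hi; omega
          rw [mon_eq_zero μ _ hk (by simp), zero_pow hid]; simp
        simp only [w]
        rw [this, zero_add, hπ10, hπ0]
        exact mul_ne_zero hv0 hu0
      refine ⟨α, α k + (d + 1), w, hw, hw0, ?_⟩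
      have ht := tendsto_zero_of_analytic hπ1 hπ10
      filter_upwards [ht.eventually hh] with p hp
      simp only [Function.comp, id]
      rw [hp]
      have e1 : mon α (π p).1 = p.2 ^ α k * mon α p.1 := mon_update α p.1 k p.2
      have e2 : mon μ (π p).1 = p.2 ^ μ k * mon μ p.1 := mon_update μ p.1 k p.2
      have e3 : (π p).2 = p.2 := rfl
      rw [e1, e2, e3]
      have e4 : ∑ i ∈ Finset.range (d + 1), (p.2 ^ μ k * mon μ p.1) ^ (d + 1 - i) * b i (π p).1 *
          p.2 ^ i = p.2 ^ (d + 1) * ∑ i ∈ Finset.range (d + 1),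
            p.2 ^ ((μ k - 1) * (d + 1 - i)) * mon μ p.1 ^ (d + 1 - i) * b i (π p).1 := by
        rw [Finset.mul_sum]
        refine Finset.sum_congr rfl fun i hi => ?_
        have hid : i ≤ d := by have := Finset.mem_range.1 hi; omega
        obtain ⟨m, hm⟩ : ∃ m, μ k = m + 1 := ⟨μ k - 1, by omega⟩
        have e5 : p.2 ^ (d + 1) = p.2 ^ (d + 1 - i) * p.2 ^ i := by
          rw [← pow_add]; congr 1; omega
        rw [hm, e5, mul_pow, ← pow_mul, Nat.add_mul, pow_add]
        simp only [Nat.add_sub_cancel, one_mul]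
        ring
      rw [e4]
      simp only [w]
      rw [pow_add]
      ring

end W

end MLink

namespace MLink

section V

variable {ι : Type*} [Fintype ι] [DecidableEq ι]

theorem good_unit (hUN : UN ι) {h : (ι → ℝ) → ℝ} {v : (ι → ℝ) × ℝ → ℝ} (hh : AnalyticAt ℝ h 0)
    (hnz : NZ h) (hv : AnalyticAt ℝ v 0) (hv0 : v 0 ≠ 0) (β : ℕ)
    (U : Ultrafilter ((ι → ℝ) × ℝ)) (hU : U.toFilter ≤ 𝓝 0) :
    Good (fun p => h p.1 * (p.2 ^ β * v p)) U := by
  have hU1 : (U.map Prod.fst).toFilter ≤ 𝓝 0 :=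
    (continuous_fst.tendsto (0 : (ι → ℝ) × ℝ)).comp hU
  obtain ⟨π, hπ, hπ0, V, hV, hVU, α, w, hw, hw0, hNC⟩ := hUN h hh hnz _ hU1
  refine Good.lift hU hπ hπ0 hV hVU fun W hW => ?_
  refine ⟨id, analyticAt_id, rfl, W, hW, Ultrafilter.map_id W, ?_⟩
  have hQ : AnalyticAt ℝ (fun p : (ι → ℝ) × ℝ => (π p.1, p.2)) 0 :=
    AnalyticAt.prod (AnalyticAt.comp (g := π) (f := Prod.fst) hπ analyticAt_fst) analyticAt_snd
  have hQ0 : (π (0 : (ι → ℝ) × ℝ).1, (0 : (ι → ℝ) × ℝ).2) = 0 := by simp [hπ0]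
  refine ⟨α, β, fun p => w p.1 * v (π p.1, p.2), (fst_analyticAt hw).mul
    (analytic_comp hv hQ hQ0), ?_, ?_⟩
  · simp only [hQ0]
    exact mul_ne_zero hw0 hv0
  · have : Tendsto (fun p : (ι → ℝ) × ℝ => p.1) (𝓝 0) (𝓝 0) := continuous_fst.tendsto _
    filter_upwards [this.eventually hNC] with p hp
    simp only [Function.comp, id] at hp ⊢
    rw [hp]; ring

def pw (σ : ι → ℝ) (m : ℕ) (y : ι → ℝ) : ι → ℝ := fun k => σ k * y k ^ m

theorem pw_analyticAt (σ : ι → ℝ) (m : ℕ) (a : ι → ℝ) : AnalyticAt ℝ (pw σ m) a :=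
  AnalyticAt.pi fun k => analyticAt_const.mul ((analyticAt_coord k a).pow m)

theorem pw_zero (σ : ι → ℝ) {m : ℕ} (hm : m ≠ 0) : pw σ m 0 = 0 := by
  ext k; simp [pw, hm]

theorem mon_pw (α : ι → ℕ) (σ : ι → ℝ) (m : ℕ) (y : ι → ℝ) :
    mon α (pw σ m y) = mon α σ * mon (m • α) y := by
  simp only [mon, pw, mul_pow, Finset.prod_mul_distrib]
  congr 1
  refine Finset.prod_congr rfl fun k _ => ?_
  rw [← pow_mul]; rfl

theorem mon_sign_ne (α : ι → ℕ) {σ : ι → ℝ} (hσ : ∀ k, σ k = 1 ∨ σ k = -1) : mon α σ ≠ 0 :=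
  mon_ne_zero _ _ fun k _ => by rcases hσ k with h | h <;> simp [h]

theorem NC.pw {f : (ι → ℝ) → ℝ} (h : NC f) {σ : ι → ℝ} (hσ : ∀ k, σ k = 1 ∨ σ k = -1) {m : ℕ}
    (hm : m ≠ 0) : NC (fun y => f (MLink.pw σ m y)) := by
  obtain ⟨α, u, hu, hu0, hf⟩ := h
  refine ⟨m • α, fun y => MLink.mon α σ * u (MLink.pw σ m y),
    analyticAt_const.mul (analytic_comp hu (pw_analyticAt σ m 0) (pw_zero σ hm)), ?_, ?_⟩
  · show MLink.mon α σ * u (MLink.pw σ m 0) ≠ 0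
    rw [pw_zero σ hm]; exact mul_ne_zero (mon_sign_ne α hσ) hu0
  · filter_upwards [(tendsto_zero_of_analytic (pw_analyticAt σ m 0) (pw_zero σ hm)).eventually hf]
      with y hy
    rw [hy, mon_pw]; ring

theorem V_step (hUN : UN ι) {d : ℕ} (hV : ∀ e ≤ d, VN ι e) {h : (ι → ℝ) → ℝ}
    {A : ℕ → (ι → ℝ) → ℝ} {u : (ι → ℝ) × ℝ → ℝ} (hh : AnalyticAt ℝ h 0) (hnz : NZ h)
    (hA : ∀ i, AnalyticAt ℝ (A i) 0) (hu : AnalyticAt ℝ u 0) (hu0 : u 0 ≠ 0)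
    (hAd : ∀ᶠ x in 𝓝 (0 : ι → ℝ), A d x = 0)
    (U : Ultrafilter ((ι → ℝ) × ℝ)) (hU : U.toFilter ≤ 𝓝 0) :
    Good (fun p => h p.1 * (∑ i ∈ Finset.range (d + 1), A i p.1 * p.2 ^ i
      + p.2 ^ (d + 1) * u p)) U := by
  classical
  let I : Finset ℕ := (Finset.range (d + 1)).filter fun i => NZ (A i)
  have hI : ∀ i, i ∈ I ↔ i < d + 1 ∧ NZ (A i) := by intro i; simp [I]
  by_cases hIe : I = ∅
  · refine (good_unit hUN hh hnz hu hu0 (d + 1) U hU).congr ?_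
    have h1 : ∀ᶠ x in 𝓝 (0 : ι → ℝ), ∀ i ∈ Finset.range (d + 1), A i x = 0 := by
      rw [Filter.eventually_all_finset]
      intro i hi
      by_contra hc
      have : i ∈ I := (hI i).2 ⟨Finset.mem_range.1 hi, hc⟩
      simp [hIe] at this
    have ht : Tendsto (fun p : (ι → ℝ) × ℝ => p.1) (𝓝 0) (𝓝 0) := continuous_fst.tendsto _
    filter_upwards [ht.eventually h1] with p hp
    rw [Finset.sum_eq_zero fun i hi => by rw [hp i hi, zero_mul], zero_add]
  have hIne : I.Nonempty := Finset.nonempty_iff_ne_empty.2 hIe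
  let e : ℕ → ℕ := fun i => (d + 1).factorial / (d + 1 - i)
  have he : ∀ i < d + 1, e i * (d + 1 - i) = (d + 1).factorial := fun i hi =>
    Nat.div_mul_cancel (Nat.dvd_factorial (by omega) (by omega))
  let diff : ℕ × ℕ → (ι → ℝ) → ℝ := fun ij x => A ij.1 x ^ e ij.1 - A ij.2 x ^ e ij.2
  have hdiff : ∀ ij, AnalyticAt ℝ (diff ij) 0 := fun ij => ((hA _).pow _).sub ((hA _).pow _)
  let J : Finset (ℕ × ℕ) := (I ×ˢ I).filter fun ij => NZ (diff ij)
  let P1 : (ι → ℝ) → ℝ := fun x => ∏ i ∈ I, A i x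
  let P2 : (ι → ℝ) → ℝ := fun x => ∏ ij ∈ J, diff ij x
  have hP1 : AnalyticAt ℝ P1 0 := Finset.analyticAt_fun_prod _ fun i _ => hA i
  have hP2 : AnalyticAt ℝ P2 0 := Finset.analyticAt_fun_prod _ fun i _ => hdiff i
  have nP1 : NZ P1 := NZ.prod _ _ (fun i _ => hA i) fun i hi => ((hI i).1 hi).2
  have nP2 : NZ P2 := NZ.prod _ _ (fun i _ => hdiff i) fun i hi => by
    simp only [J, Finset.mem_filter] at hi; exact hi.2
  have hU1 : (U.map Prod.fst).toFilter ≤ 𝓝 0 :=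
    (continuous_fst.tendsto (0 : (ι → ℝ) × ℝ)).comp hU
  obtain ⟨π, hπ, hπ0, V, hVn, hVU, hNC⟩ := hUN (fun x => h x * (P1 x * P2 x))
    (hh.mul (hP1.mul hP2)) (NZ.mul hh (hP1.mul hP2) hnz (NZ.mul hP1 hP2 nP1 nP2)) _ hU1
  have hπt := tendsto_zero_of_analytic hπ hπ0
  have ahπ : AnalyticAt ℝ (fun x => h (π x)) 0 := analytic_comp hh hπ hπ0
  have aP1 : AnalyticAt ℝ (fun x => P1 (π x)) 0 := analytic_comp hP1 hπ hπ0
  have aP2 : AnalyticAt ℝ (fun x => P2 (π x)) 0 := analytic_comp hP2 hπ hπ0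
  have hNC1 : NC (fun x => h (π x)) := NC.factor ahπ (aP1.mul aP2) hNC
  have hNC2 : NC (fun x => P1 (π x) * P2 (π x)) :=
    NC.factor' (f1 := fun x => h (π x)) (f2 := fun x => P1 (π x) * P2 (π x)) ahπ (aP1.mul aP2) hNC
  have hNCA : ∀ i ∈ I, NC (fun x => A i (π x)) := fun i hi =>
    NC.of_prod I (fun i x => A i (π x)) (fun i _ => analytic_comp (hA i) hπ hπ0)
      (NC.factor aP1 aP2 hNC2) i hi
  have hNCd : ∀ ij ∈ J, NC (fun x => diff ij (π x)) := fun i hi =>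
    NC.of_prod J (fun i x => diff i (π x)) (fun i _ => analytic_comp (hdiff i) hπ hπ0)
      (NC.factor' aP1 aP2 hNC2) i hi
  have hex : ∀ i, ∃ (α : ι → ℕ) (v : (ι → ℝ) → ℝ), i ∈ I → AnalyticAt ℝ v 0 ∧ v 0 ≠ 0 ∧
      ∀ᶠ x in 𝓝 (0 : ι → ℝ), A i (π x) = mon α x * v x := by
    intro i
    by_cases hi : i ∈ I
    · obtain ⟨α, v, h1⟩ := hNCA i hi
      exact ⟨α, v, fun _ => h1⟩
    · exact ⟨0, 0, fun h => absurd h hi⟩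
  choose α v hαv using hex
  have hcmp : ∀ i ∈ I, ∀ j ∈ I, e i • α i ≤ e j • α j ∨ e j • α j ≤ e i • α i := by
    intro i hi j hj
    obtain ⟨h1, h2, h3⟩ := hαv i hi
    obtain ⟨h4, h5, h6⟩ := hαv j hj
    refine comparable (u := fun x => v i x ^ e i) (v := fun x => v j x ^ e j) (h1.pow _)
      (pow_ne_zero _ h2) (h4.pow _) (pow_ne_zero _ h5) ?_
    have heq : ∀ᶠ x in 𝓝 (0 : ι → ℝ), diff (i, j) (π x) =
        mon (e i • α i) x * v i x ^ e i - mon (e j • α j) x * v j x ^ e j := by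
      filter_upwards [h3, h6] with x hx1 hx2
      simp only [diff]
      rw [hx1, hx2, mon_smul, mon_smul, mul_pow, mul_pow]
    by_cases hn : NZ (diff (i, j))
    · right
      have hmem : (i, j) ∈ J := by
        simp only [J, Finset.mem_filter, Finset.mem_product]
        exact ⟨⟨hi, hj⟩, hn⟩
      exact (hNCd (i, j) hmem).congr heq
    · left
      intro hc
      apply hc
      filter_upwards [heq, hπt.eventually (not_not.1 hn)] with x hx1 hx2
      rw [← hx1, hx2]; rfl
  obtain ⟨i0, hi0, hmin⟩ := Finset.exists_min_image I (fun i => ∑ k, (e i • α i) k) hIne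
  have hle : ∀ i ∈ I, e i0 • α i0 ≤ e i • α i := by
    intro i hi
    rcases hcmp i0 hi0 i hi with h | h
    · exact h
    · intro k
      by_contra hk
      push Not at hk
      have : ∑ k, (e i • α i) k < ∑ k, (e i0 • α i0) k :=
        Finset.sum_lt_sum (fun k _ => h k) ⟨k, Finset.mem_univ k, hk⟩
      exact absurd (hmin i hi) (not_le.2 this)
  have hi0d : i0 < d + 1 := ((hI i0).1 hi0).1
  have hle2 : ∀ i ∈ I, ∀ k, (d + 1 - i) * α i0 k ≤ (d + 1 - i0) * α i k := by
    intro i hi k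
    have h1 := hle i hi k
    simp only [Pi.smul_apply, smul_eq_mul] at h1
    have h2 := he i0 hi0d
    have h3 := he i ((hI i).1 hi).1
    have hfp : 0 < (d + 1).factorial := Nat.factorial_pos _
    refine Nat.le_of_mul_le_mul_left ?_ hfp
    calc (d + 1).factorial * ((d + 1 - i) * α i0 k)
        = (d + 1 - i) * (d + 1 - i0) * (e i0 * α i0 k) := by rw [← h2]; ring
      _ ≤ (d + 1 - i) * (d + 1 - i0) * (e i * α i k) := Nat.mul_le_mul_left _ h1
      _ = (d + 1).factorial * ((d + 1 - i0) * α i k) := by rw [← h3]; ring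
  obtain ⟨m, hm⟩ : ∃ m, m = d + 1 - i0 := ⟨_, rfl⟩
  have hm0 : m ≠ 0 := by omega
  rw [← hm] at hle2
  obtain ⟨σ, hσ, V2, hV2, hV2V⟩ := power_lift V hVn m hm0
  have hpw := pw_analyticAt σ m 0
  have hpw0 := pw_zero σ hm0
  have hpwt := tendsto_zero_of_analytic hpw hpw0
  have hπ2 : AnalyticAt ℝ (fun y => π (pw σ m y)) 0 := analytic_comp hπ hpw hpw0
  have hπ20 : π (pw σ m 0) = 0 := by rw [hpw0, hπ0]
  refine Good.lift (π := fun y => π (pw σ m y)) hU hπ2 hπ20 hV2 ?_ fun W hW => ?_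
  · rw [← hVU, ← hV2V, Ultrafilter.map_map]; rfl
  let μ := α i0
  let b : ℕ → (ι → ℝ) → ℝ := fun i => if i ∈ I then
    fun y => mon (α i) σ * mon (m • α i - (d + 1 - i) • μ) y * v i (pw σ m y) else fun _ => 0
  have hb : ∀ i, AnalyticAt ℝ (b i) 0 := by
    intro i
    by_cases hi : i ∈ I
    · simp only [b, if_pos hi]
      exact (analyticAt_const.mul (mon_analyticAt _ 0)).mul
        (analytic_comp (hαv i hi).1 hpw hpw0)
    · simp only [b, if_neg hi]
      exact analyticAt_const
  have hbA : ∀ᶠ y in 𝓝 (0 : ι → ℝ), ∀ i ∈ Finset.range (d + 1),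
      A i (π (pw σ m y)) = mon μ y ^ (d + 1 - i) * b i y := by
    rw [Filter.eventually_all_finset]
    intro i hi
    by_cases hiI : i ∈ I
    · filter_upwards [hpwt.eventually (hαv i hiI).2.2] with y hy
      simp only [b, if_pos hiI]
      rw [hy, mon_pw]
      have : m • α i = (d + 1 - i) • μ + (m • α i - (d + 1 - i) • μ) := by
        ext k
        have := hle2 i hiI k
        simp only [Pi.add_apply, Pi.smul_apply, Pi.sub_apply, smul_eq_mul, μ]
        omega
      rw [this, mon_add, mon_smul, ← this]; ring
    · have : ¬ NZ (A i) := fun hn => hiI ((hI i).2 ⟨Finset.mem_range.1 hi, hn⟩)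
      filter_upwards [hpwt.eventually (hπt.eventually (not_not.1 this))] with y hy
      simp only [b, if_neg hiI, mul_zero]
      exact hy
  have hQ : AnalyticAt ℝ (fun p : (ι → ℝ) × ℝ => (π (pw σ m p.1), p.2)) 0 :=
    AnalyticAt.prod (AnalyticAt.comp (g := fun y => π (pw σ m y)) (f := Prod.fst) hπ2
      analyticAt_fst) analyticAt_snd
  have hQ0 : (π (pw σ m (0 : (ι → ℝ) × ℝ).1), (0 : (ι → ℝ) × ℝ).2) = 0 := by
    simp [hπ20]
  have := W_step hV _ μ rfl (fun y => h (π (pw σ m y))) b (fun p => u (π (pw σ m p.1), p.2))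
    (analytic_comp hh hπ2 hπ20) (hNC1.pw hσ hm0) hb (analytic_comp hu hQ hQ0)
    (by simp only [hQ0]; exact hu0) ⟨i0, by omega, ?_⟩ ?_ W hW
  · refine this.congr ?_
    have ht : Tendsto (fun p : (ι → ℝ) × ℝ => p.1) (𝓝 0) (𝓝 0) := continuous_fst.tendsto _
    filter_upwards [ht.eventually hbA] with p hp
    rw [Finset.sum_congr rfl fun i hi => by rw [← hp i hi]]
  · simp only [b, if_pos hi0]
    have : m • α i0 - (d + 1 - i0) • μ = 0 := by
      rw [← hm]; simp [μ]
    rw [this, mon_zero, hpw0]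
    exact mul_ne_zero (mul_ne_zero (mon_sign_ne _ hσ) one_ne_zero) (hαv i0 hi0).2.1
  · have : d ∉ I := fun hd => ((hI d).1 hd).2 hAd
    simp [b, this]

theorem V_all (hUN : UN ι) (d : ℕ) : VN ι d := by
  induction d using Nat.strong_induction_on with
  | _ d ih =>
    intro h f hh hnz hf hord U hU
    cases d with
    | zero =>
      have h0 : f 0 ≠ 0 := by
        have := hord.2
        simp [Dk] at this
        exact this
      refine (good_unit hUN hh hnz hf h0 0 U hU).congr (Eventually.of_forall fun p => by simp)
    | succ d =>
      obtain ⟨φ, hφ, hφ0, A, u, hA, hu, hu0, hAd, hfA⟩ := tschirnhausen hf hord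
      let π : (ι → ℝ) × ℝ → (ι → ℝ) × ℝ := fun p => (p.1, p.2 + φ p.1)
      let s : (ι → ℝ) × ℝ → (ι → ℝ) × ℝ := fun p => (p.1, p.2 - φ p.1)
      have hπ : AnalyticAt ℝ π 0 :=
        AnalyticAt.prod analyticAt_fst (analyticAt_snd.add (fst_analyticAt hφ))
      have hπ0 : π 0 = 0 := by simp [π, hφ0]
      have hs : AnalyticAt ℝ s 0 :=
        AnalyticAt.prod analyticAt_fst (analyticAt_snd.sub (fst_analyticAt hφ))
      have hs0 : s 0 = 0 := by simp [s, hφ0]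
      refine Good.of_section hπ hπ0 ((tendsto_zero_of_analytic hs hs0).mono_left hU)
        (Eventually.of_forall fun p => by simp [π, s]) fun V hVn => ?_
      refine (V_step hUN (fun e he => ih e (by omega)) hh hnz hA hu hu0 hAd V hVn).congr ?_
      filter_upwards [hfA] with p hp
      simp only [Function.comp, π]
      rw [hp]

end V

end MLink

namespace MLink

/-- Nonzero germ and analytic: a direction along which it does not vanish. -/
theorem exists_dir {E : Type*} [NormedAddCommGroup E] [NormedSpace ℝ E] {f : E → ℝ}
    (hf : AnalyticAt ℝ f 0) (hnz : NZ f) (h0 : f 0 = 0) :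
    ∃ v : E, v ≠ 0 ∧ ¬ ∀ᶠ t in 𝓝 (0 : ℝ), f (t • v) = 0 := by
  obtain ⟨r, hr, hball⟩ := Metric.eventually_nhds_iff_ball.1 hf.eventually_analyticAt
  have : ∃ v ∈ ball (0 : E) r, f v ≠ 0 := by
    by_contra hc
    push Not at hc
    exact hnz (Metric.eventually_nhds_iff_ball.2 ⟨r, hr, hc⟩)
  obtain ⟨v, hv, hfv⟩ := this
  refine ⟨v, fun h => hfv (h ▸ h0), fun hev => hfv ?_⟩
  have han : AnalyticOnNhd ℝ (fun t : ℝ => f (t • v)) (Icc 0 1) := by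
    intro t ht
    have h1 : AnalyticAt ℝ f (t • v) := by
      apply hball
      rw [mem_ball_zero_iff] at hv ⊢
      rw [norm_smul, Real.norm_of_nonneg ht.1]
      nlinarith [norm_nonneg v, ht.2]
    exact AnalyticAt.comp (g := f) (f := fun t : ℝ => t • v) h1
      (analyticAt_id.smul analyticAt_const)
  have := han.eqOn_zero_of_preconnected_of_eventuallyEq_zero isPreconnected_Icc
    (left_mem_Icc.2 zero_le_one) hev (right_mem_Icc.2 zero_le_one)
  simpa using this

def snocE (n : ℕ) : (Fin (n + 1) → ℝ) → (Fin n → ℝ) × ℝ := fun x => (fun i => x i.castSucc, x (Fin.last n))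

theorem snocE_analyticAt (n : ℕ) (a : Fin (n + 1) → ℝ) : AnalyticAt ℝ (snocE n) a :=
  AnalyticAt.prod (AnalyticAt.pi fun i => analyticAt_coord _ a) (analyticAt_coord _ a)

theorem mon_snoc {n : ℕ} (α : Fin n → ℕ) (β : ℕ) (x : Fin (n + 1) → ℝ) :
    mon (Fin.snoc α β : Fin (n + 1) → ℕ) x = mon α (snocE n x).1 * (snocE n x).2 ^ β := by
  unfold mon
  rw [Fin.prod_univ_castSucc]
  simp [snocE]

theorem NC'.snoc {n : ℕ} {f : (Fin n → ℝ) × ℝ → ℝ} (h : NC' f) : NC (fun x => f (snocE n x)) := by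
  obtain ⟨α, β, u, hu, hu0, hf⟩ := h
  have h0 : snocE n 0 = 0 := rfl
  refine ⟨Fin.snoc α β, fun x => u (snocE n x), analytic_comp hu (snocE_analyticAt n 0) h0, hu0, ?_⟩
  filter_upwards [(tendsto_zero_of_analytic (snocE_analyticAt n 0) h0).eventually hf] with x hx
  rw [hx, mon_snoc]

/-- Local uniformization of `f` at `0` along `U` on any space. -/
def LU {E : Type*} [NormedAddCommGroup E] [NormedSpace ℝ E] (n : ℕ) (f : E → ℝ) (a : E)
    (U : Ultrafilter E) : Prop :=
  ∃ π : (Fin n → ℝ) → E, AnalyticAt ℝ π 0 ∧ π 0 = a ∧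
      ∃ V : Ultrafilter (Fin n → ℝ), V.toFilter ≤ 𝓝 0 ∧ V.map π = U ∧ NC (f ∘ π)

theorem LU.equiv {E G : Type*} [NormedAddCommGroup E] [NormedSpace ℝ E] [NormedAddCommGroup G]
    [NormedSpace ℝ G] {n : ℕ} {f : E → ℝ} {U : Ultrafilter E} (L : G ≃L[ℝ] E) (a : E)
    (h : LU n (fun x => f (L x + a)) 0 (U.map fun x => L.symm (x - a))) : LU n f a U := by
  obtain ⟨π, hπ, hπ0, V, hV, hVU, hNC⟩ := h
  refine ⟨fun x => L (π x) + a, ?_, by simp [hπ0], V, hV, ?_, hNC⟩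
  · exact (AnalyticAt.comp (g := L) (L.analyticAt _) hπ).add analyticAt_const
  · have : (fun x => L (π x) + a) = (fun x => L x + a) ∘ π := rfl
    rw [this, ← Ultrafilter.map_map, hVU, Ultrafilter.map_map]
    convert Ultrafilter.map_id U using 2
    ext x; simp

theorem UN_fin (n : ℕ) : UN (Fin n) := by
  induction n with
  | zero =>
    intro f hf hnz U hU
    refine ⟨id, analyticAt_id, rfl, U, hU, Ultrafilter.map_id U, NC.of_unit hf ?_⟩
    intro h0
    apply hnz
    filter_upwards with x
    rw [Subsingleton.elim x 0]; exact h0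
  | succ n ih =>
    intro f hf hnz U hU
    have L0 : ((Fin n → ℝ) × ℝ) ≃L[ℝ] (Fin (n + 1) → ℝ) :=
      ContinuousLinearEquiv.ofFinrankEq (by simp)
    have hL : ∃ L : ((Fin n → ℝ) × ℝ) ≃L[ℝ] (Fin (n + 1) → ℝ),
        ¬ ∀ᶠ t in 𝓝 (0 : ℝ), f (L (0, t)) = 0 := by
      by_cases h0 : f 0 = 0
      · obtain ⟨v, hv, hvt⟩ := exists_dir hf hnz h0
        have h1 : L0 (0, 1) ≠ 0 := by
          intro hc
          have := (map_eq_zero_iff L0 L0.injective).1 hc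
          simp at this
        obtain ⟨M, hM⟩ := SeparatingDual.exists_continuousLinearEquiv_apply_eq (R := ℝ) h1 hv
        refine ⟨L0.trans M, fun hc => hvt ?_⟩
        filter_upwards [hc] with t ht
        have : ((0 : Fin n → ℝ), t) = t • ((0 : Fin n → ℝ), (1 : ℝ)) := by simp
        rw [this, map_smul, ContinuousLinearEquiv.trans_apply, hM] at ht
        exact ht
      · refine ⟨L0, fun hc => h0 ?_⟩
        have := hc.self_of_nhds
        have h2 : ((0 : Fin n → ℝ), (0 : ℝ)) = 0 := rfl
        rwa [h2, map_zero] at this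
    obtain ⟨L, hLt⟩ := hL
    have hfL : AnalyticAt ℝ (fun x => f (L x)) 0 := analytic_comp hf (L.analyticAt _) (map_zero L)
    obtain ⟨k, hk⟩ := exists_Dk_ne hfL hLt
    obtain ⟨d, -, hd⟩ := exists_ord hk
    have hUL : (U.map L.symm).toFilter ≤ 𝓝 0 := by
      have := L.symm.continuous.tendsto 0
      rw [map_zero] at this
      exact this.comp hU
    obtain ⟨π, hπ, hπ0, V, hV, hVU, hNC⟩ := V_all ih d (fun _ => 1) _ analyticAt_const
      (NZ.of_ne one_ne_zero) hfL hd _ hUL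
    let s : (Fin n → ℝ) × ℝ → (Fin (n + 1) → ℝ) := fun p => Fin.snoc (α := fun _ => ℝ) p.1 p.2
    have hs : Continuous s := by
      refine continuous_pi fun i => ?_
      refine Fin.lastCases ?_ (fun i => ?_) i
      · simp only [s, Fin.snoc_last]; exact continuous_snd
      · simp only [s, Fin.snoc_castSucc]; exact (continuous_apply i).comp continuous_fst
    have hs0 : s 0 = 0 := by
      ext i
      refine Fin.lastCases ?_ (fun i => ?_) i <;> simp [s]
    have hss : ∀ p, snocE n (s p) = p := by intro p; simp [snocE, s]
    refine ⟨fun x => L (π (snocE n x)), ?_, ?_, V.map s, ?_, ?_, ?_⟩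
    · exact analytic_comp (f := fun p => L (π p)) (analytic_comp (L.analyticAt _) hπ hπ0)
        (snocE_analyticAt n 0) rfl
    · show L (π 0) = 0
      rw [hπ0, map_zero]
    · have := hs.tendsto 0
      rw [hs0] at this
      exact this.comp hV
    · rw [Ultrafilter.map_map]
      have : (fun x => L (π (snocE n x))) ∘ s = L ∘ π := by ext1 p; simp [hss]
      rw [this, ← Ultrafilter.map_map, hVU, Ultrafilter.map_map]
      convert Ultrafilter.map_id U using 2
      ext1 x; simp
    · have := hNC.snoc
      simp only [Function.comp, one_mul] at this
      exact this

theorem local_unif {E : Type*} [NormedAddCommGroup E] [NormedSpace ℝ E] [FiniteDimensional ℝ E]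
    {f : E → ℝ} {a : E} (hf : AnalyticAt ℝ f a) (hnz : ¬ ∀ᶠ x in 𝓝 a, f x = 0)
    (U : Ultrafilter E) (hU : U.toFilter ≤ 𝓝 a) : LU (Module.finrank ℝ E) f a U := by
  have L : (Fin (Module.finrank ℝ E) → ℝ) ≃L[ℝ] E := ContinuousLinearEquiv.ofFinrankEq (by simp)
  refine LU.equiv L a ?_
  refine UN_fin _ _ ?_ ?_ _ ?_
  · refine AnalyticAt.comp (g := f) (f := fun x => L x + a) (by simpa using hf)
      ((L.analyticAt _).add analyticAt_const)
  · intro hc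
    apply hnz
    have : Tendsto (fun x => L.symm (x - a)) (𝓝 a) (𝓝 0) := by
      have : Continuous (fun x => L.symm (x - a)) := by fun_prop
      have := this.tendsto a
      simpa using this
    filter_upwards [this.eventually hc] with x hx
    simpa using hx
  · have : Tendsto (fun x => L.symm (x - a)) (𝓝 a) (𝓝 0) := by
      have : Continuous (fun x => L.symm (x - a)) := by fun_prop
      have := this.tendsto a
      simpa using this
    exact this.comp hU

end MLink

namespace MLink

section D1

variable {E : Type*} [NormedAddCommGroup E] [NormedSpace ℝ E] [FiniteDimensional ℝ E]

/-- Milnor's curve-selection type statement. -/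
theorem pos_dir {f q : E → ℝ} (hf : AnalyticAt ℝ f 0) (hq : AnalyticAt ℝ q 0) (hf0 : f 0 = 0)
    (hq0 : q 0 = 0) : ∀ᶠ z in 𝓝 (0 : E), 0 < f z → 0 < q z →
      ∃ v, 0 < fderiv ℝ f z v ∧ 0 < fderiv ℝ q z v := by
  by_contra hc
  have hne := Filter.frequently_iff_neBot.1 (Filter.not_eventually.1 hc)
  obtain ⟨U, hU⟩ := Ultrafilter.exists_le (𝓝 (0 : E) ⊓ 𝓟 {x | ¬(0 < f x → 0 < q x →
    ∃ v, 0 < fderiv ℝ f x v ∧ 0 < fderiv ℝ q x v)})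
  have hU0 : U.toFilter ≤ 𝓝 0 := hU.trans inf_le_left
  have hUb := hU.trans inf_le_right
  rw [le_principal_iff] at hUb
  have hnz : ¬ ∀ᶠ x in 𝓝 (0 : E), (fun x => f x * q x) x = 0 := by
    intro h
    obtain ⟨x, hx1, hx2⟩ := ((Ultrafilter.neBot U).nonempty_of_mem
      (Filter.inter_mem hUb (hU0 h)))
    simp only [Set.mem_ofPred_eq] at hx1 hx2
    push Not at hx1
    exact absurd hx2 (mul_pos hx1.1 hx1.2.1).ne'
  obtain ⟨π, hπ, hπ0, V, hV, hVU, hNC⟩ := local_unif (f := fun x => f x * q x) (hf.mul hq) hnz U hU0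
  have a1 : AnalyticAt ℝ (fun y => f (π y)) 0 := analytic_comp hf hπ hπ0
  have a2 : AnalyticAt ℝ (fun y => q (π y)) 0 := analytic_comp hq hπ hπ0
  have n1 : NC (fun y => f (π y)) := NC.factor a1 a2 hNC
  have n2 : NC (fun y => q (π y)) := NC.factor' a1 a2 hNC
  have r1 := n1.radial (by simp only [hπ0, hf0])
  have r2 := n2.radial (by simp only [hπ0, hq0])
  have hb : ∀ᶠ y in V.toFilter, ¬ (0 < f (π y) → 0 < q (π y) →
      ∃ v, 0 < fderiv ℝ f (π y) v ∧ 0 < fderiv ℝ q (π y) v) := by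
    rw [← hVU] at hUb
    exact hUb
  have hπt := tendsto_zero_of_analytic hπ hπ0
  have df := hπt.eventually hf.eventually_analyticAt
  have dq := hπt.eventually hq.eventually_analyticAt
  have dπ := hπ.eventually_analyticAt
  have hall := (r1.and r2).and (df.and (dq.and dπ))
  obtain ⟨y, hy1, ⟨hy2, hy3⟩, hy4, hy5, hy6⟩ := (hb.and (hall.filter_mono hV)).exists
  apply hy1
  intro hp1 hp2
  refine ⟨fderiv ℝ π y y, ?_, ?_⟩
  · have := hy2 hp1
    have h2 : fderiv ℝ (fun y => f (π y)) y = (fderiv ℝ f (π y)).comp (fderiv ℝ π y) :=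
      fderiv_comp (g := f) (f := π) y hy4.differentiableAt hy6.differentiableAt
    rw [h2] at this; exact this
  · have := hy3 hp2
    have h2 : fderiv ℝ (fun y => q (π y)) y = (fderiv ℝ q (π y)).comp (fderiv ℝ π y) :=
      fderiv_comp (g := q) (f := π) y hy5.differentiableAt hy6.differentiableAt
    rw [h2] at this; exact this

/-- Lojasiewicz gradient inequality near the zero set, on a compact set. -/
theorem lojasiewicz {F : E → ℝ} {S : Set E} (hS : IsCompact S) (hF : ∀ z ∈ S, AnalyticAt ℝ F z) :
    ∃ θ C η : ℝ, 0 < θ ∧ θ < 1 ∧ 0 < C ∧ 0 < η ∧ ∀ z ∈ S, 0 < F z → F z ≤ η →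
      C * F z ^ θ ≤ ‖fderiv ℝ F z‖ := by
  by_contra hc
  push Not at hc
  have hk : ∀ k : ℕ, ∃ z ∈ S, 0 < F z ∧ F z ≤ 1 / ((k : ℝ) + 2) ∧
      ‖fderiv ℝ F z‖ < 1 / ((k : ℝ) + 2) * F z ^ (1 - 1 / ((k : ℝ) + 2)) := by
    intro k
    have hp : 0 < 1 / ((k : ℝ) + 2) := by positivity
    refine hc _ _ _ ?_ (by linarith) hp hp
    have : 1 / ((k : ℝ) + 2) < 1 := by
      rw [div_lt_one (by positivity)]; linarith [(Nat.cast_nonneg k : (0 : ℝ) ≤ k)]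
    linarith
  choose z hzS hz0 hzk hzd using hk
  have hlim : Tendsto (fun k : ℕ => 1 / ((k : ℝ) + 2)) atTop (𝓝 0) := by
    have := (tendsto_one_div_add_atTop_nhds_zero_nat (𝕜 := ℝ)).comp (tendsto_add_atTop_nat 1)
    refine this.congr fun k => ?_
    simp only [Function.comp]; push_cast; ring
  let H : Ultrafilter ℕ := hyperfilter ℕ
  have hH : H.toFilter ≤ atTop := by
    rw [← Nat.cofinite_eq_atTop]; exact hyperfilter_le_cofinite
  let U : Ultrafilter E := H.map z
  obtain ⟨p, hpS, hUp⟩ := hS.ultrafilter_le_nhds U (by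
    rw [le_principal_iff]
    exact Filter.Eventually.of_forall (f := H.toFilter) hzS)
  have hUp' : Tendsto z H.toFilter (𝓝 p) := hUp
  have hFp : F p = 0 := by
    have h1 : Tendsto (fun k => F (z k)) H.toFilter (𝓝 (F p)) :=
      (hF p hpS).continuousAt.tendsto.comp hUp'
    have h2 : Tendsto (fun k => F (z k)) H.toFilter (𝓝 0) :=
      (squeeze_zero (fun k => (hz0 k).le) hzk hlim).mono_left hH
    exact tendsto_nhds_unique h1 h2
  have hnz : ¬ ∀ᶠ x in 𝓝 p, F x = 0 := by
    intro h
    obtain ⟨k, hk⟩ := (hUp'.eventually h).exists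
    exact (hz0 k).ne' hk
  obtain ⟨π, hπ, hπ0, V, hV, hVU, hNC⟩ := local_unif (hF p hpS) hnz U hUp
  obtain ⟨N, hN, c, hc0, hgr⟩ := hNC.grad (by simp [hπ0, hFp])
  have hπt : Tendsto π (𝓝 0) (𝓝 p) := by rw [← hπ0]; exact hπ.continuousAt
  let M := ‖fderiv ℝ π 0‖ + 1
  have hM : ∀ᶠ y in 𝓝 0, ‖fderiv ℝ π y‖ < M := by
    have : ContinuousAt (fun y => ‖fderiv ℝ π y‖) 0 := hπ.fderiv.continuousAt.norm
    exact this.eventually (gt_mem_nhds (by simp [M]))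
  have hM0 : 0 < M := by positivity
  have hU1 : ∀ᶠ x in U.toFilter, F x ≠ 0 → c * |F x| ^ (1 - 1 / (N : ℝ)) ≤ ‖fderiv ℝ F x‖ * M := by
    rw [← hVU]
    show ∀ᶠ y in V.toFilter, F (π y) ≠ 0 → c * |F (π y)| ^ (1 - 1 / (N : ℝ)) ≤
      ‖fderiv ℝ F (π y)‖ * M
    filter_upwards [hV hgr, hV hM, hV (hπt.eventually (hF p hpS).eventually_analyticAt),
      hV hπ.eventually_analyticAt] with y h1 h2 h3 h4 h5
    have h6 : fderiv ℝ (F ∘ π) y = (fderiv ℝ F (π y)).comp (fderiv ℝ π y) :=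
      fderiv_comp (g := F) (f := π) y h3.differentiableAt h4.differentiableAt
    refine (h1 h5).trans ?_
    rw [h6]
    exact (ContinuousLinearMap.opNorm_comp_le _ _).trans (by gcongr)
  have hU2 : ∀ᶠ k in H.toFilter, c * |F (z k)| ^ (1 - 1 / (N : ℝ)) ≤ ‖fderiv ℝ F (z k)‖ * M := by
    have : ∀ᶠ k in H.toFilter, _ := hU1
    filter_upwards [this] with k hk
    exact hk (hz0 k).ne'
  have hsm : ∀ᶠ k : ℕ in H.toFilter, 1 / ((k : ℝ) + 2) < c / M :=
    (hlim.mono_left hH).eventually (gt_mem_nhds (by positivity))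
  have hlg : ∀ᶠ k : ℕ in H.toFilter, N ≤ k := hH (eventually_ge_atTop N)
  obtain ⟨k, ⟨h1, h2⟩, h3⟩ := ((hU2.and hsm).and hlg).exists
  have hFk := hz0 k
  have hN' : (1 : ℝ) ≤ N := by exact_mod_cast hN
  have h3' : (N : ℝ) ≤ k := by exact_mod_cast h3
  have hF1 : F (z k) ≤ 1 := (hzk k).trans (by
    rw [div_le_one (by positivity)]; linarith)
  rw [abs_of_pos hFk] at h1
  have h4 : F (z k) ^ (1 - 1 / ((k : ℝ) + 2)) ≤ F (z k) ^ (1 - 1 / (N : ℝ)) := by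
    apply Real.rpow_le_rpow_of_exponent_ge hFk hF1
    have : 1 / ((k : ℝ) + 2) ≤ 1 / N := one_div_le_one_div_of_le (by linarith) (by linarith)
    linarith
  have h5 : 0 < F (z k) ^ (1 - 1 / (N : ℝ)) := Real.rpow_pos_of_pos hFk _
  have h6 := hzd k
  have h7 : ‖fderiv ℝ F (z k)‖ * M < c * F (z k) ^ (1 - 1 / (N : ℝ)) := by
    have h8 : 1 / ((k : ℝ) + 2) * M < c := by rwa [lt_div_iff₀ hM0] at h2
    calc ‖fderiv ℝ F (z k)‖ * M < (1 / ((k : ℝ) + 2) * F (z k) ^ (1 - 1 / ((k : ℝ) + 2))) * M := by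
          gcongr
      _ ≤ (1 / ((k : ℝ) + 2) * F (z k) ^ (1 - 1 / (N : ℝ))) * M := by gcongr
      _ = (1 / ((k : ℝ) + 2) * M) * F (z k) ^ (1 - 1 / (N : ℝ)) := by ring
      _ < c * F (z k) ^ (1 - 1 / (N : ℝ)) := by gcongr
  linarith

end D1

end MLink

namespace MLink

section E1

variable {H : Type*} [NormedAddCommGroup H] [InnerProductSpace ℝ H] [FiniteDimensional ℝ H]

/-- The standing hypothesis on `F`. -/
structure Adm (F : H → ℝ) : Prop where
  an : ∀ z, z ≠ 0 → AnalyticAt ℝ F z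
  hom : ∀ z, ∀ c : ℝ, 0 < c → F (c • z) = F z
  nonneg : ∀ z, 0 ≤ F z

/-- radial projection to the sphere of radius `ε` -/
def rho (ε : ℝ) (w : H) : H := (ε / ‖w‖) • w

theorem rho_mem {ε : ℝ} (hε : 0 < ε) {w : H} (hw : w ≠ 0) : rho ε w ∈ sphere (0 : H) ε := by
  rw [mem_sphere_zero_iff_norm, rho, norm_smul, norm_div, norm_norm, Real.norm_of_nonneg hε.le]
  field_simp [norm_ne_zero_iff.2 hw]

theorem rho_of_mem {ε : ℝ} (hε : 0 < ε) {w : H} (hw : w ∈ sphere (0 : H) ε) : rho ε w = w := by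
  rw [mem_sphere_zero_iff_norm] at hw
  rw [rho, hw, div_self hε.ne', one_smul]

theorem Adm.rho {F : H → ℝ} (h : Adm F) {ε : ℝ} (hε : 0 < ε) {w : H} (hw : w ≠ 0) :
    F (rho ε w) = F w := h.hom _ _ (div_pos hε (norm_pos_iff.2 hw))

theorem rho_sub_le {ε : ℝ} (hε : 0 < ε) {w z : H} (hw : w ≠ 0) (hz : z ∈ sphere (0 : H) ε) :
    ‖rho ε w - z‖ ≤ 2 * ‖w - z‖ := by
  rw [mem_sphere_zero_iff_norm] at hz
  have hwp := norm_pos_iff.2 hw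
  have h1 : ‖rho ε w - w‖ ≤ ‖w - z‖ := by
    have : rho ε w - w = ((ε - ‖w‖) / ‖w‖) • w := by
      rw [rho, sub_div, div_self hwp.ne', sub_smul, one_smul]
    rw [this, norm_smul, norm_div, norm_norm, div_mul_cancel₀ _ hwp.ne', ← hz, Real.norm_eq_abs,
      abs_sub_comm]
    exact abs_norm_sub_norm_le w z
  calc ‖rho ε w - z‖ = ‖(rho ε w - w) + (w - z)‖ := by congr 1; abel
    _ ≤ ‖rho ε w - w‖ + ‖w - z‖ := norm_add_le _ _
    _ ≤ 2 * ‖w - z‖ := by linarith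

theorem rho_continuousAt {ε : ℝ} {w : H} (hw : w ≠ 0) : ContinuousAt (rho ε) w := by
  unfold rho
  have : ‖w‖ ≠ 0 := norm_ne_zero_iff.2 hw
  fun_prop (disch := assumption)

theorem ne_zero_of_near {ε : ℝ} (hε : 0 < ε) {z v : H} (hz : z ∈ sphere (0 : H) ε)
    (hv : ‖v‖ ≤ ε / 2) : z + v ≠ 0 := by
  intro h
  have : z = -v := eq_neg_of_add_eq_zero_left h
  rw [mem_sphere_zero_iff_norm, this, norm_neg] at hz
  linarith

theorem quad_bound {F : H → ℝ} (h : Adm F) {ε : ℝ} (hε : 0 < ε) : ∃ M > 0,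
    (∀ z ∈ sphere (0 : H) ε, ‖fderiv ℝ F z‖ ≤ M) ∧
    ∀ z ∈ sphere (0 : H) ε, ∀ v : H, ‖v‖ ≤ ε / 2 → |F (z + v) - F z - fderiv ℝ F z v| ≤ M * ‖v‖ ^ 2 := by
  let A : Set H := closedBall 0 (3 * ε / 2) \ ball 0 (ε / 2)
  have hA : IsCompact A := (isCompact_closedBall _ _).diff isOpen_ball
  have hA0 : ∀ z ∈ A, z ≠ 0 := by
    rintro z hz rfl
    exact hz.2 (by simp [hε])
  have hc1 : ContinuousOn (fun z => fderiv ℝ F z) A := fun z hz =>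
    ((h.an z (hA0 z hz)).fderiv.continuousAt).continuousWithinAt
  have hc2 : ContinuousOn (fun z => fderiv ℝ (fderiv ℝ F) z) A := fun z hz =>
    ((h.an z (hA0 z hz)).fderiv.fderiv.continuousAt).continuousWithinAt
  obtain ⟨M1, hM1⟩ := hA.exists_bound_of_continuousOn hc1
  obtain ⟨M2, hM2⟩ := IsCompact.exists_bound_of_continuousOn (E := H →L[ℝ] H →L[ℝ] ℝ) hA hc2
  let M := max (max M1 M2) 1
  have hball : ∀ z ∈ sphere (0 : H) ε, ∀ w ∈ closedBall z (ε / 2), w ∈ A := by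
    intro z hz w hw
    rw [mem_sphere_zero_iff_norm] at hz
    rw [mem_closedBall, dist_eq_norm] at hw
    have h1 := norm_sub_norm_le z w
    have h2 := norm_sub_norm_le w z
    rw [norm_sub_rev z w] at h1
    refine ⟨?_, ?_⟩
    · rw [mem_closedBall_zero_iff]; linarith
    · rw [mem_ball_zero_iff]; linarith
  refine ⟨M, by positivity, ?_, ?_⟩
  · intro z hz
    have : z ∈ A := hball z hz z (by simp; positivity)
    exact (hM1 z this).trans ((le_max_left _ _).trans (le_max_left _ _))
  · intro z hz v hv
    have hMM : ∀ w ∈ A, ‖fderiv ℝ (fderiv ℝ F) w‖ ≤ M := fun w hw =>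
      (hM2 w hw).trans ((le_max_right _ _).trans (le_max_left _ _))
    have hsub : ∀ w ∈ closedBall z ‖v‖, w ∈ A := fun w hw =>
      hball z hz w (closedBall_subset_closedBall hv hw)
    have hlip : ∀ w ∈ closedBall z ‖v‖, ‖fderiv ℝ F w - fderiv ℝ F z‖ ≤ M * ‖v‖ := by
      intro w hw
      have := (convex_closedBall z ‖v‖).norm_image_sub_le_of_norm_fderiv_le (𝕜 := ℝ)
        (f := fderiv ℝ F) (C := M)
        (fun x hx => (h.an x (hA0 x (hsub x hx))).fderiv.differentiableAt)
        (fun x hx => hMM x (hsub x hx)) (mem_closedBall_self (norm_nonneg v)) hw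
      refine this.trans ?_
      gcongr
      rwa [mem_closedBall, dist_eq_norm] at hw
    have hz' : ∀ x ∈ closedBall z ‖v‖, HasFDerivWithinAt F (fderiv ℝ F x) (closedBall z ‖v‖) x :=
      fun x hx => (h.an x (hA0 x (hsub x hx))).differentiableAt.hasFDerivAt.hasFDerivWithinAt
    have := (convex_closedBall z ‖v‖).norm_image_sub_le_of_norm_hasFDerivWithin_le' (𝕜 := ℝ)
        (f := F) (φ := fderiv ℝ F z) (C := M * ‖v‖) hz' hlip (mem_closedBall_self (norm_nonneg v))
        (show z + v ∈ closedBall z ‖v‖ by simp)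
    rw [add_sub_cancel_left, Real.norm_eq_abs] at this
    linarith [this, (by ring : M * ‖v‖ * ‖v‖ = M * ‖v‖ ^ 2)]

theorem Adm.fderiv_zero {F : H → ℝ} (h : Adm F) {z : H} (hz : F z = 0) : fderiv ℝ F z = 0 :=
  IsLocalMin.fderiv_eq_zero (Eventually.of_forall fun w => by rw [hz]; exact h.nonneg w)

theorem concave_ineq {a b θ : ℝ} (ha : 0 < a) (hb : 0 ≤ b) (h0 : 0 < θ) (h1 : θ < 1) :
    (1 - θ) * (a - b) ≤ a ^ θ * (a ^ (1 - θ) - b ^ (1 - θ)) := by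
  -- weighted AM-GM
  have h2 := Real.geom_mean_le_arith_mean2_weighted (w₁ := θ) (w₂ := 1 - θ) (p₁ := a) (p₂ := b)
    h0.le (by linarith) ha.le hb (by ring)
  have h3 : a ^ θ * a ^ (1 - θ) = a := by
    rw [← Real.rpow_add ha]; simp
  rw [mul_sub (a ^ θ), h3]
  nlinarith

/-- Retraction of a neighbourhood of the zero set of `F` in the sphere. -/
theorem retract {F : H → ℝ} (h : Adm F) {ε : ℝ} (hε : 0 < ε) :
    ∃ η > 0, ∃ r : H → H, ContinuousOn r (sphere (0 : H) ε ∩ {z | F z ≤ η}) ∧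
      ∀ z ∈ sphere (0 : H) ε, F z ≤ η → r z ∈ sphere (0 : H) ε ∧ F (r z) = 0 ∧
        (F z = 0 → r z = z) := by
  obtain ⟨M, hM, hM1, hM2⟩ := quad_bound h hε
  have hS0 : ∀ z ∈ sphere (0 : H) ε, z ≠ 0 := fun z hz => ne_zero_of_mem_sphere hε.ne' ⟨z, hz⟩
  obtain ⟨θ, C, η, hθ0, hθ1, hC, hη, hL⟩ := lojasiewicz (isCompact_sphere (0 : H) ε)
    (fun z hz => h.an z (hS0 z hz))
  refine ⟨η, hη, ?_⟩
  let S := sphere (0 : H) ε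
  let s : ℝ := min (1 / (2 * M)) (ε / (2 * M))
  have hs : 0 < s := by positivity
  have hs1 : s * M ≤ 1 / 2 := by
    calc s * M ≤ 1 / (2 * M) * M := by gcongr; exact min_le_left _ _
      _ = 1 / 2 := by field_simp
  have hs2 : s * M ≤ ε / 2 := by
    calc s * M ≤ ε / (2 * M) * M := by gcongr; exact min_le_right _ _
      _ = ε / 2 := by field_simp
  let G : H → H := fun z => (InnerProductSpace.toDual ℝ H).symm (fderiv ℝ F z)
  have hGn : ∀ z, ‖G z‖ = ‖fderiv ℝ F z‖ := fun z => LinearIsometryEquiv.norm_map _ _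
  have hGd : ∀ z, fderiv ℝ F z (G z) = ‖G z‖ ^ 2 := by
    intro z
    rw [← real_inner_self_eq_norm_sq]
    conv_lhs => rw [← (InnerProductSpace.toDual ℝ H).apply_symm_apply (fderiv ℝ F z)]
    rfl
  have hstep : ∀ z ∈ S, ‖-(s • G z)‖ ≤ ε / 2 := by
    intro z hz
    rw [norm_neg, norm_smul, Real.norm_of_nonneg hs.le, hGn]
    exact (mul_le_mul_of_nonneg_left (hM1 z hz) hs.le).trans hs2
  have hne : ∀ z ∈ S, z + -(s • G z) ≠ 0 := fun z hz => ne_zero_of_near hε hz (hstep z hz)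
  let T : H → H := fun z => rho ε (z + -(s • G z))
  have hTS : ∀ z ∈ S, T z ∈ S := fun z hz => rho_mem hε (hne z hz)
  have hTF : ∀ z ∈ S, F (T z) ≤ F z - s / 2 * ‖G z‖ ^ 2 := by
    intro z hz
    have h1 := abs_le.1 (hM2 z hz _ (hstep z hz))
    have h2 : F (T z) = F (z + -(s • G z)) := h.rho hε (hne z hz)
    have h3 : fderiv ℝ F z (-(s • G z)) = - (s * ‖G z‖ ^ 2) := by
      rw [map_neg, map_smul, hGd]; rfl
    have h4 : ‖-(s • G z)‖ ^ 2 = s ^ 2 * ‖G z‖ ^ 2 := by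
      rw [norm_neg, norm_smul, Real.norm_of_nonneg hs.le, mul_pow]
    rw [h3, h4] at h1
    rw [h2]
    have h5 : M * (s ^ 2 * ‖G z‖ ^ 2) ≤ s / 2 * ‖G z‖ ^ 2 := by
      have : M * (s ^ 2 * ‖G z‖ ^ 2) = (s * M) * (s * ‖G z‖ ^ 2) := by ring
      rw [this]
      have : (s * M) * (s * ‖G z‖ ^ 2) ≤ 1 / 2 * (s * ‖G z‖ ^ 2) := by gcongr
      linarith
    linarith [h1.2]
  have hTF' : ∀ z ∈ S, F (T z) ≤ F z := fun z hz => (hTF z hz).trans (by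
    have : 0 ≤ s / 2 * ‖G z‖ ^ 2 := by positivity
    linarith)
  have hTd : ∀ z ∈ S, ‖T z - z‖ ≤ 2 * (s * ‖G z‖) := by
    intro z hz
    have := rho_sub_le hε (hne z hz) hz
    rwa [add_sub_cancel_left, norm_neg, norm_smul, Real.norm_of_nonneg hs.le] at this
  have hT0 : ∀ z ∈ S, F z = 0 → T z = z := by
    intro z hz h0
    have : G z = 0 := by simp only [G, h.fderiv_zero h0, map_zero]
    simp only [T, this, smul_zero, neg_zero, add_zero]
    exact rho_of_mem hε hz
  let B := 4 / (C * (1 - θ))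
  have hθ' : 0 < 1 - θ := by linarith
  have hB : 0 < B := by positivity
  have hTB : ∀ z ∈ S, F z ≤ η → ‖T z - z‖ ≤ B * (F z ^ (1 - θ) - F (T z) ^ (1 - θ)) := by
    intro z hz hzη
    rcases (h.nonneg z).eq_or_lt with h0 | h0
    · rw [hT0 z hz h0.symm]; simp
    have h1 := hL z hz h0 hzη
    rw [← hGn] at h1
    have hFθ : 0 < F z ^ θ := Real.rpow_pos_of_pos h0 _
    have hG : 0 < ‖G z‖ := lt_of_lt_of_le (by positivity) h1
    have h2 := concave_ineq h0 (h.nonneg (T z)) hθ0 hθ1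
    have h3 := hTF z hz
    have hX : 0 ≤ F z ^ (1 - θ) - F (T z) ^ (1 - θ) :=
      sub_nonneg.2 (Real.rpow_le_rpow (h.nonneg _) (hTF' z hz) hθ'.le)
    refine (hTd z hz).trans ?_
    set X := F z ^ (1 - θ) - F (T z) ^ (1 - θ)
    have h4 : (1 - θ) * (s / 2 * ‖G z‖ ^ 2) ≤ F z ^ θ * X :=
      (mul_le_mul_of_nonneg_left (by linarith) hθ'.le).trans h2
    have h5 : C * (F z ^ θ * X) ≤ ‖G z‖ * X := by
      rw [← mul_assoc]; gcongr
    have h6 : C * ((1 - θ) * (s / 2 * ‖G z‖)) ≤ X := by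
      have h7 : ‖G z‖ * (C * ((1 - θ) * (s / 2 * ‖G z‖))) ≤ ‖G z‖ * X := by
        nlinarith
      exact le_of_mul_le_mul_left h7 hG
    calc 2 * (s * ‖G z‖) = B * (C * ((1 - θ) * (s / 2 * ‖G z‖))) := by
          simp only [B]; field_simp; ring
      _ ≤ B * X := by gcongr
  let K := S ∩ {z | F z ≤ η}
  have hTK : ∀ z ∈ K, T z ∈ K := fun z hz => ⟨hTS z hz.1, (hTF' z hz.1).trans hz.2⟩
  have hcG : ContinuousOn G S := fun z hz =>
    (((InnerProductSpace.toDual ℝ H).symm.continuous.continuousAt).comp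
      (h.an z (hS0 z hz)).fderiv.continuousAt).continuousWithinAt
  have hcT : ContinuousOn T S := by
    intro z hz
    have h1 : ContinuousWithinAt (fun z => z + -(s • G z)) S z :=
      continuousWithinAt_id.add ((hcG z hz).const_smul s).neg
    exact ContinuousAt.comp_continuousWithinAt (f := fun z => z + -(s • G z)) (g := rho ε)
      (rho_continuousAt (hne z hz)) h1
  have hit : ∀ k, ∀ z ∈ K, T^[k] z ∈ K := by
    intro k
    induction k with
    | zero => intro z hz; exact hz
    | succ k ih => intro z hz; rw [Function.iterate_succ_apply]; exact ih _ (hTK z hz)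
  have hcit : ∀ k, ContinuousOn (T^[k]) K := by
    intro k
    induction k with
    | zero => exact continuousOn_id
    | succ k ih =>
      rw [Function.iterate_succ]
      exact ih.comp (hcT.mono inter_subset_left) hTK
  have hcF : ContinuousOn F S := fun z hz => (h.an z (hS0 z hz)).continuousAt.continuousWithinAt
  -- distance estimates
  have hdist : ∀ z ∈ K, ∀ k, ‖T^[k] z - z‖ ≤ B * (F z ^ (1 - θ) - F (T^[k] z) ^ (1 - θ)) := by
    intro z hz k
    induction k with
    | zero => simp
    | succ k ih =>
      rw [Function.iterate_succ_apply']
      have h1 := hTB _ (hit k z hz).1 (hit k z hz).2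
      calc ‖T (T^[k] z) - z‖ = ‖(T (T^[k] z) - T^[k] z) + (T^[k] z - z)‖ := by congr 1; abel
        _ ≤ _ := norm_add_le _ _
        _ ≤ _ := add_le_add h1 ih
        _ = _ := by ring
  have hdist2 : ∀ z ∈ K, ∀ k l, k ≤ l → ‖T^[l] z - T^[k] z‖ ≤ B * F (T^[k] z) ^ (1 - θ) := by
    intro z hz k l hkl
    obtain ⟨m, rfl⟩ := Nat.exists_eq_add_of_le hkl
    rw [add_comm k m, Function.iterate_add_apply]
    refine (hdist _ (hit k z hz) m).trans ?_
    have := Real.rpow_nonneg (h.nonneg (T^[m] (T^[k] z))) (1 - θ)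
    gcongr
    linarith
  have hFlim : ∀ z ∈ K, Tendsto (fun k => F (T^[k] z)) atTop (𝓝 0) := by
    intro z hz
    have hanti : Antitone (fun k => F (T^[k] z)) := antitone_nat_of_succ_le fun k => by
      rw [Function.iterate_succ_apply']; exact hTF' _ (hit k z hz).1
    have hbd : BddBelow (range fun k => F (T^[k] z)) := ⟨0, by rintro _ ⟨k, rfl⟩; exact h.nonneg _⟩
    have hlim := tendsto_atTop_ciInf hanti hbd
    set L := ⨅ k, F (T^[k] z)
    have hL0 : 0 ≤ L := le_ciInf fun k => h.nonneg _
    rcases hL0.eq_or_lt with hL0 | hL0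
    · rwa [← hL0] at hlim
    exfalso
    have hdec : ∀ k, F (T^[k + 1] z) ≤ F (T^[k] z) - s / 2 * (C * L ^ θ) ^ 2 := by
      intro k
      have hk : L ≤ F (T^[k] z) := ciInf_le hbd k
      rw [Function.iterate_succ_apply']
      refine (hTF _ (hit k z hz).1).trans ?_
      have h1 := hL _ (hit k z hz).1 (hL0.trans_le hk) (hit k z hz).2
      rw [← hGn] at h1
      have h2 : C * L ^ θ ≤ ‖G (T^[k] z)‖ := le_trans (by gcongr) h1
      have h3 : 0 ≤ C * L ^ θ := by positivity
      gcongr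
    have h1 := le_of_tendsto_of_tendsto' ((tendsto_add_atTop_iff_nat 1).2 hlim)
      (hlim.sub_const (s / 2 * (C * L ^ θ) ^ 2)) hdec
    have : 0 < s / 2 * (C * L ^ θ) ^ 2 := by positivity
    linarith
  have hBlim : ∀ z ∈ K, Tendsto (fun k => B * F (T^[k] z) ^ (1 - θ)) atTop (𝓝 0) := by
    intro z hz
    have := ((hFlim z hz).rpow_const (p := 1 - θ) (Or.inr hθ'.le)).const_mul B
    rwa [Real.zero_rpow hθ'.ne', mul_zero] at this
  have hconv : ∀ z ∈ K, ∃ y, Tendsto (fun k => T^[k] z) atTop (𝓝 y) := by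
    intro z hz
    refine cauchySeq_tendsto_of_complete ?_
    refine cauchySeq_of_le_tendsto_0' (fun k => B * F (T^[k] z) ^ (1 - θ)) ?_ (hBlim z hz)
    intro k l hkl
    rw [dist_comm, dist_eq_norm]; exact hdist2 z hz k l hkl
  classical
  let r : H → H := fun z => if hz : z ∈ K then (hconv z hz).choose else z
  have hr : ∀ z ∈ K, Tendsto (fun k => T^[k] z) atTop (𝓝 (r z)) := by
    intro z hz
    simp only [r, dif_pos hz]
    exact (hconv z hz).choose_spec
  have hrd : ∀ z ∈ K, ∀ k, ‖r z - T^[k] z‖ ≤ B * F (T^[k] z) ^ (1 - θ) := by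
    intro z hz k
    refine le_of_tendsto ((hr z hz).sub_const _).norm ?_
    filter_upwards [eventually_ge_atTop k] with l hl
    exact hdist2 z hz k l hl
  refine ⟨r, ?_, ?_⟩
  · intro z0 hz0
    rw [Metric.continuousWithinAt_iff']
    intro δ hδ
    obtain ⟨k, hk⟩ := ((hBlim z0 hz0).eventually (gt_mem_nhds (show (0 : ℝ) < δ / 3 by positivity))).exists
    have hc1 : ContinuousWithinAt (fun z => B * F (T^[k] z) ^ (1 - θ)) K z0 := by
      have : ContinuousOn (fun z => F (T^[k] z)) K := hcF.comp (hcit k) fun z hz => (hit k z hz).1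
      exact ((this z0 hz0).rpow_const (Or.inr hθ'.le)).const_mul B
    have hc2 : ContinuousWithinAt (T^[k]) K z0 := hcit k z0 hz0
    filter_upwards [hc1.eventually (gt_mem_nhds hk), Metric.continuousWithinAt_iff'.1 hc2 (δ / 3)
      (by positivity), self_mem_nhdsWithin] with z hz1 hz2 hz3
    have e1 := hrd z hz3 k
    have e2 := hrd z0 hz0 k
    rw [dist_eq_norm] at hz2 ⊢
    calc ‖r z - r z0‖ = ‖(r z - T^[k] z) + (T^[k] z - T^[k] z0) - (r z0 - T^[k] z0)‖ := by
          congr 1; abel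
      _ ≤ ‖r z - T^[k] z‖ + ‖T^[k] z - T^[k] z0‖ + ‖r z0 - T^[k] z0‖ :=
          (norm_sub_le _ _).trans (by gcongr; exact norm_add_le _ _)
      _ < δ := by linarith
  · intro z hzS hzη
    have hzK : z ∈ K := ⟨hzS, hzη⟩
    have h1 : r z ∈ S := isClosed_sphere.mem_of_tendsto (hr z hzK)
      (Eventually.of_forall fun k => (hit k z hzK).1)
    refine ⟨h1, ?_, ?_⟩
    · have : Tendsto (fun k => F (T^[k] z)) atTop (𝓝 (F (r z))) :=
        (h.an _ (hS0 _ h1)).continuousAt.tendsto.comp (hr z hzK)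
      exact tendsto_nhds_unique this (hFlim z hzK)
    · intro h0
      have : ∀ k, T^[k] z = z := fun k => Function.iterate_fixed (hT0 z hzS h0) k
      have h2 := hr z hzK
      simp only [this] at h2
      exact tendsto_nhds_unique h2 tendsto_const_nhds

end E1

end MLink

namespace MLink

/-- Maps to `ℝⁿ` can be approximated by nonvanishing ones. -/
def NV (n : ℕ) (D : Type*) [TopologicalSpace D] : Prop :=
  ∀ u : D → EuclideanSpace ℝ (Fin n), Continuous u → ∀ ζ > 0,
    ∃ w : D → EuclideanSpace ℝ (Fin n), Continuous w ∧ ∀ t, w t ≠ 0 ∧ ‖w t - u t‖ ≤ ζ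

theorem second_order {h h' h'' : ℝ → ℝ} {τ c : ℝ} (h1 : ∀ t ∈ Icc 0 τ, HasDerivAt h (h' t) t)
    (h2 : ∀ t ∈ Icc 0 τ, HasDerivAt h' (h'' t) t) (h3 : ∀ t ∈ Icc 0 τ, h'' t ≤ - (2 * c))
    {a : ℝ} (ha : a ∈ Icc 0 τ) : h a ≤ h 0 + h' 0 * a - c * a ^ 2 := by
  have h0 : (0 : ℝ) ∈ Icc 0 τ := ⟨le_rfl, ha.1.trans ha.2⟩
  have d2 : ∀ t ∈ Icc 0 τ, HasDerivAt (fun t => h' t - h' 0 + 2 * c * t) (h'' t + 2 * c) t := by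
    intro t ht
    have := ((h2 t ht).sub_const (h' 0)).add ((hasDerivAt_id t).const_mul (2 * c))
    exact this.congr_deriv (by simp)
  have m2 : AntitoneOn (fun t => h' t - h' 0 + 2 * c * t) (Icc 0 τ) := by
    refine antitoneOn_of_hasDerivWithinAt_nonpos (convex_Icc _ _)
      (fun t ht => (d2 t ht).continuousAt.continuousWithinAt)
      (fun t ht => (d2 t (interior_subset ht)).hasDerivWithinAt) fun t ht => ?_
    linarith [h3 t (interior_subset ht)]
  have d1 : ∀ t ∈ Icc 0 τ, HasDerivAt (fun t => h t - h' 0 * t + c * t ^ 2)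
      (h' t - h' 0 + 2 * c * t) t := by
    intro t ht
    have := ((h1 t ht).sub ((hasDerivAt_id t).const_mul (h' 0))).add
      ((hasDerivAt_pow 2 t).const_mul c)
    refine this.congr_deriv ?_
    simp; ring
  have m1 : AntitoneOn (fun t => h t - h' 0 * t + c * t ^ 2) (Icc 0 τ) := by
    refine antitoneOn_of_hasDerivWithinAt_nonpos (convex_Icc _ _)
      (fun t ht => (d1 t ht).continuousAt.continuousWithinAt)
      (fun t ht => (d1 t (interior_subset ht)).hasDerivWithinAt) fun t ht => ?_
    have := m2 h0 (interior_subset ht) (interior_subset ht).1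
    simpa using this
  have := m1 h0 ha ha.1
  simp at this
  linarith

section E2

variable {H : Type*} [NormedAddCommGroup H] [InnerProductSpace ℝ H] [FiniteDimensional ℝ H]

def Morse (n : ℕ) (F : H → ℝ) (p : H) : Prop :=
  fderiv ℝ F p ≠ 0 ∨ ∃ ι : EuclideanSpace ℝ (Fin n) →L[ℝ] H, ∃ κ > 0,
    ∀ v, fderiv ℝ (fderiv ℝ F) p (ι v) (ι v) ≤ - κ * ‖v‖ ^ 2

def Dir (D : Type*) [TopologicalSpace D] (F : H → ℝ) (ε : ℝ) (p : H) : Prop :=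
  ∃ r τ c L : ℝ, 0 < r ∧ 0 < τ ∧ 0 < c ∧ 0 < L ∧ τ ≤ 1 ∧ τ * L ≤ ε / 2 ∧
    ∀ Φ : D → H, Continuous Φ → (∀ t, Φ t ∈ sphere (0 : H) ε) → ∀ ζ > 0,
      ∃ ν : D → H, Continuous ν ∧ (∀ t, ‖ν t‖ ≤ L) ∧ ∀ t, ‖Φ t - p‖ < r → ∀ a ∈ Icc 0 τ,
        F (Φ t + a • ν t) ≤ F (Φ t) - c * a ^ 2 + ζ

theorem dir_of_grad (D : Type*) [TopologicalSpace D] {F : H → ℝ} (h : Adm F) {ε : ℝ} (hε : 0 < ε)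
    {p : H} (hp : p ∈ sphere (0 : H) ε) (hd : fderiv ℝ F p ≠ 0) : Dir D F ε p := by
  obtain ⟨M, hM, hM1, hM2⟩ := quad_bound h hε
  have hp0 : p ≠ 0 := ne_zero_of_mem_sphere hε.ne' ⟨p, hp⟩
  obtain ⟨e, he⟩ : ∃ e, 0 < fderiv ℝ F p e := by
    by_contra hc
    push Not at hc
    apply hd
    ext e
    have h1 := hc e
    have h2 := hc (-e)
    rw [map_neg] at h2
    simp; linarith
  set δ := fderiv ℝ F p e
  have hcont : ContinuousAt (fun z => fderiv ℝ F z e) p :=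
    (h.an p hp0).fderiv.continuousAt.clm_apply continuousAt_const
  obtain ⟨r, hr, hball⟩ := Metric.eventually_nhds_iff_ball.1
    (hcont.eventually (lt_mem_nhds (show δ / 2 < δ by linarith)))
  let L := ‖e‖ + 1
  have hL : 0 < L := by positivity
  have heL : ‖e‖ ≤ L := by simp [L]
  let τ := min (min 1 (ε / (2 * L))) (δ / (4 * M * L ^ 2))
  have hτ : 0 < τ := by positivity
  have hτL : τ * L ≤ ε / 2 := by
    calc τ * L ≤ ε / (2 * L) * L := by
          gcongr; exact (min_le_left _ _).trans (min_le_right _ _)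
      _ = ε / 2 := by field_simp
  have hτM : M * L ^ 2 * τ ≤ δ / 4 := by
    calc M * L ^ 2 * τ ≤ M * L ^ 2 * (δ / (4 * M * L ^ 2)) := by gcongr; exact min_le_right _ _
      _ = δ / 4 := by field_simp
  have hτ1 : τ ≤ 1 := (min_le_left _ _).trans (min_le_left _ _)
  refine ⟨r, τ, δ / 4, L, hr, hτ, by positivity, hL, hτ1, hτL, ?_⟩
  intro Φ hΦ hΦS ζ hζ
  refine ⟨fun _ => -e, continuous_const, fun t => by rw [norm_neg]; exact heL, ?_⟩
  intro t ht a ha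
  have hn : ‖a • -e‖ ≤ a * L := by
    rw [norm_smul, norm_neg, Real.norm_of_nonneg ha.1]; exact mul_le_mul_of_nonneg_left heL ha.1
  have h1 := (abs_le.1 (hM2 (Φ t) (hΦS t) (a • -e)
    (hn.trans ((mul_le_mul_of_nonneg_right ha.2 hL.le).trans hτL)))).2
  have h2 := hball (Φ t) (by rwa [mem_ball, dist_eq_norm])
  have h3 : fderiv ℝ F (Φ t) (a • -e) = - (a * fderiv ℝ F (Φ t) e) := by
    rw [smul_neg, map_neg, map_smul]; rfl
  rw [h3] at h1
  have h4 : M * ‖a • -e‖ ^ 2 ≤ a * (δ / 4) := by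
    calc M * ‖a • -e‖ ^ 2 ≤ M * (a * L) ^ 2 := by gcongr
      _ = a * (M * L ^ 2 * a) := by ring
      _ ≤ a * (M * L ^ 2 * τ) := by
          have := ha.1
          have := ha.2
          gcongr
      _ ≤ a * (δ / 4) := mul_le_mul_of_nonneg_left hτM ha.1
  have h5 : a * (δ / 2) ≤ a * fderiv ℝ F (Φ t) e := mul_le_mul_of_nonneg_left h2.le ha.1
  have h6 : a ^ 2 ≤ a := by nlinarith [ha.1, ha.2]
  nlinarith

theorem dir_of_neg (D : Type*) [TopologicalSpace D] {n : ℕ} (hNV : NV n D) {F : H → ℝ} (h : Adm F)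
    {ε : ℝ} (hε : 0 < ε)
    {p : H} (hp : p ∈ sphere (0 : H) ε) {ι : EuclideanSpace ℝ (Fin n) →L[ℝ] H} {κ : ℝ} (hκ : 0 < κ)
    (hι : ∀ v, fderiv ℝ (fderiv ℝ F) p (ι v) (ι v) ≤ - κ * ‖v‖ ^ 2) : Dir D F ε p := by
  have hp0 : p ≠ 0 := ne_zero_of_mem_sphere hε.ne' ⟨p, hp⟩
  let L := ‖ι‖ + 1
  have hL : 0 < L := by positivity
  have hιL : ∀ v, ‖v‖ = 1 → ‖ι v‖ ≤ L := by
    intro v hv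
    have := ι.le_opNorm v
    rw [hv, mul_one] at this
    exact this.trans (by simp [L])
  have hcont : ContinuousAt (fun z => fderiv ℝ (fderiv ℝ F) z) p :=
    (h.an p hp0).fderiv.fderiv.continuousAt
  have hcn : ContinuousAt (fun z => ‖fderiv ℝ (fderiv ℝ F) z - fderiv ℝ (fderiv ℝ F) p‖) p :=
    ContinuousAt.comp (f := fun z => fderiv ℝ (fderiv ℝ F) z - fderiv ℝ (fderiv ℝ F) p)
      (g := fun A : H →L[ℝ] H →L[ℝ] ℝ => ‖A‖) 
        (@continuous_norm (H →L[ℝ] H →L[ℝ] ℝ) _).continuousAt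
      (hcont.sub continuousAt_const)
  obtain ⟨r1, hr1, hball⟩ := Metric.eventually_nhds_iff_ball.1
    (hcn.eventually (gt_mem_nhds (show _ < κ / (2 * L ^ 2) by
      beta_reduce
      rw [sub_self, @norm_zero (H →L[ℝ] H →L[ℝ] ℝ) _]; positivity)))
  let r0 := min r1 (ε / 2)
  have hr0 : 0 < r0 := by positivity
  have hq0 : ∀ q, ‖q - p‖ < r0 → q ≠ 0 := by
    intro q hq
    have := ne_zero_of_near (v := q - p) hε hp (hq.le.trans (min_le_right _ _))
    simpa using this
  have hq2 : ∀ q, ‖q - p‖ < r0 → ∀ v, ‖v‖ = 1 →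
      fderiv ℝ (fderiv ℝ F) q (ι v) (ι v) ≤ -(2 * (κ / 4)) := by
    intro q hq v hv
    have h1 := hball q (by rw [mem_ball, dist_eq_norm]; exact hq.trans_le (min_le_left _ _))
    have h2 := hι v
    rw [hv, one_pow, mul_one] at h2
    have h3 : (fderiv ℝ (fderiv ℝ F) q - fderiv ℝ (fderiv ℝ F) p) (ι v) (ι v) ≤ κ / 2 := by
      refine (le_abs_self _).trans ?_
      rw [← Real.norm_eq_abs]
      refine (ContinuousLinearMap.le_opNorm₂ _ _ _).trans ?_
      calc _ ≤ κ / (2 * L ^ 2) * L * L := by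
            gcongr
            · exact hιL v hv
            · exact hιL v hv
        _ = κ / 2 := by field_simp
    simp only [sub_apply] at h3
    linarith
  let τ := min (min 1 (ε / (2 * L))) (r0 / (2 * L))
  have hτ : 0 < τ := by positivity
  have hτL : τ * L ≤ ε / 2 := by
    calc τ * L ≤ ε / (2 * L) * L := by
          gcongr; exact (min_le_left _ _).trans (min_le_right _ _)
      _ = ε / 2 := by field_simp
  have hτr : τ * L ≤ r0 / 2 := by
    calc τ * L ≤ r0 / (2 * L) * L := by
          gcongr; exact min_le_right _ _
      _ = r0 / 2 := by field_simp
  have hτ1 : τ ≤ 1 := (min_le_left _ _).trans (min_le_left _ _)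
  refine ⟨r0 / 2, τ, κ / 4, L, by positivity, hτ, by positivity, hL, hτ1, hτL, ?_⟩
  intro Φ hΦ hΦS ζ hζ
  have hΦ0 : ∀ t, Φ t ≠ 0 := fun t => ne_zero_of_mem_sphere hε.ne' ⟨_, hΦS t⟩
  let u : D → EuclideanSpace ℝ (Fin n) := fun t =>
    (InnerProductSpace.toDual ℝ _).symm ((fderiv ℝ F (Φ t)).comp ι)
  have hu : Continuous u := by
    refine (InnerProductSpace.toDual ℝ _).symm.continuous.comp ?_
    have : Continuous fun t => fderiv ℝ F (Φ t) := continuous_iff_continuousAt.2 fun t =>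
      ContinuousAt.comp (f := Φ) (g := fderiv ℝ F) (h.an _ (hΦ0 t)).fderiv.continuousAt
        hΦ.continuousAt
    exact this.clm_comp continuous_const
  have huv : ∀ t v, inner ℝ (u t) v = fderiv ℝ F (Φ t) (ι v) := by
    intro t v
    simp only [u]
    rw [InnerProductSpace.toDual_symm_apply]; rfl
  obtain ⟨w, hw, hwu⟩ := hNV u hu ζ hζ
  have hwn : ∀ t, 0 < ‖w t‖ := fun t => norm_pos_iff.2 (hwu t).1
  let e : D → EuclideanSpace ℝ (Fin n) := fun t => (-‖w t‖⁻¹) • w t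
  have hen : ∀ t, ‖e t‖ = 1 := by
    intro t
    simp only [e]
    rw [norm_smul, norm_neg, norm_inv, norm_norm, inv_mul_cancel₀ (hwn t).ne']
  have hec : Continuous e := ((hw.norm.inv₀ fun t => (hwn t).ne').neg).smul hw
  refine ⟨fun t => ι (e t), ι.continuous.comp hec, fun t => hιL _ (hen t), ?_⟩
  intro t ht a ha
  have hq : ∀ s ∈ Icc 0 τ, ‖Φ t + s • ι (e t) - p‖ < r0 := by
    intro s hs
    calc ‖Φ t + s • ι (e t) - p‖ = ‖(Φ t - p) + s • ι (e t)‖ := by congr 1; abel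
      _ ≤ ‖Φ t - p‖ + ‖s • ι (e t)‖ := norm_add_le _ _
      _ < r0 / 2 + r0 / 2 := by
          refine add_lt_add_of_lt_of_le ht ?_
          rw [norm_smul, Real.norm_of_nonneg hs.1]
          exact (mul_le_mul hs.2 (hιL _ (hen t)) (norm_nonneg _) hτ.le).trans hτr
      _ = r0 := by ring
  have hlin : ∀ s, HasDerivAt (fun s : ℝ => Φ t + s • ι (e t)) (ι (e t)) s := by
    intro s
    have := ((hasDerivAt_id s).smul_const (ι (e t))).const_add (Φ t)
    rw [one_smul] at this
    exact this
  have hd1 : ∀ s ∈ Icc 0 τ, HasDerivAt (fun s => F (Φ t + s • ι (e t)))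
      (fderiv ℝ F (Φ t + s • ι (e t)) (ι (e t))) s := fun s hs =>
    (h.an _ (hq0 _ (hq s hs))).differentiableAt.hasFDerivAt.comp_hasDerivAt s (hlin s)
  have hd2 : ∀ s ∈ Icc 0 τ, HasDerivAt (fun s => fderiv ℝ F (Φ t + s • ι (e t)) (ι (e t)))
      (fderiv ℝ (fderiv ℝ F) (Φ t + s • ι (e t)) (ι (e t)) (ι (e t))) s := by
    intro s hs
    have h1 := (h.an _ (hq0 _ (hq s hs))).fderiv.differentiableAt.hasFDerivAt.comp_hasDerivAt s
      (hlin s)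
    have := h1.clm_apply (hasDerivAt_const s (ι (e t)))
    simpa using this
  have key := second_order hd1 hd2 (fun s hs => hq2 _ (hq s hs) _ (hen t)) ha
  simp only [zero_smul, add_zero] at key
  have hζ' : fderiv ℝ F (Φ t) (ι (e t)) ≤ ζ := by
    rw [← huv]
    simp only [e]
    rw [inner_smul_right]
    have h1 : inner ℝ (u t) (w t) = ‖w t‖ ^ 2 - inner ℝ (w t - u t) (w t) := by
      rw [inner_sub_left, real_inner_self_eq_norm_sq]; ring
    have h2 : inner ℝ (w t - u t) (w t) ≤ ζ * ‖w t‖ :=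
      (real_inner_le_norm _ _).trans (mul_le_mul_of_nonneg_right (hwu t).2 (norm_nonneg _))
    rw [h1]
    calc -‖w t‖⁻¹ * (‖w t‖ ^ 2 - inner ℝ (w t - u t) (w t))
        = ‖w t‖⁻¹ * (inner ℝ (w t - u t) (w t) - ‖w t‖ ^ 2) := by ring
      _ ≤ ‖w t‖⁻¹ * (ζ * ‖w t‖) := by
          gcongr
          have := sq_nonneg ‖w t‖
          linarith
      _ = ζ := by field_simp [(hwn t).ne']
  have : fderiv ℝ F (Φ t) (ι (e t)) * a ≤ ζ := by
    have h1 := mul_le_mul_of_nonneg_right hζ' ha.1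
    have h2 : ζ * a ≤ ζ * 1 := mul_le_mul_of_nonneg_left (ha.2.trans hτ1) hζ.le
    linarith
  linarith

end E2

end MLink

namespace MLink

section E3

variable {H : Type*} [NormedAddCommGroup H] [InnerProductSpace ℝ H] [FiniteDimensional ℝ H]
variable (D : Type*) [TopologicalSpace D]

def LP (F : H → ℝ) (ε : ℝ) (p : H) (r κ : ℝ) : Prop :=
  ∀ Φ : D → H, Continuous Φ → (∀ t, Φ t ∈ sphere (0 : H) ε) → ∀ ζ > 0,
    ∃ Φ' : D → H, Continuous Φ' ∧ (∀ t, Φ' t ∈ sphere (0 : H) ε) ∧ (∀ t, F (Φ t) = 0 → Φ' t = Φ t) ∧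
      (∀ t, κ * ‖Φ' t - Φ t‖ ^ 2 ≤ F (Φ t) - F (Φ' t) + ζ) ∧
      ∀ t, ‖Φ t - p‖ ≤ r / 2 → F (Φ' t) ≤ F (Φ t) - κ + ζ

theorem local_push {F : H → ℝ} (h : Adm F) {ε : ℝ} (hε : 0 < ε) {p : H}
    (hp : p ∈ sphere (0 : H) ε) (hFp : 0 < F p) (hd : Dir D F ε p) :
    ∃ r > 0, ∃ κ > 0, LP D F ε p r κ := by
  obtain ⟨r1, τ, c, L, hr1, hτ, hc, hL, hτ1, hτL, hν⟩ := hd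
  have hp0 : p ≠ 0 := ne_zero_of_mem_sphere hε.ne' ⟨p, hp⟩
  obtain ⟨r2, hr2, hball⟩ := Metric.eventually_nhds_iff_ball.1
    ((h.an p hp0).continuousAt.eventually (lt_mem_nhds hFp))
  let r := min r1 r2
  have hr : 0 < r := by positivity
  let κ := min (c / (4 * L ^ 2)) (c * τ ^ 2)
  have hκ : 0 < κ := by positivity
  refine ⟨r, hr, κ, hκ, ?_⟩
  intro Φ hΦ hΦS ζ hζ
  obtain ⟨ν, hνc, hνL, hνF⟩ := hν Φ hΦ hΦS ζ hζ
  let χ : D → ℝ := fun t => max 0 (min 1 (2 - 2 * ‖Φ t - p‖ / r))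
  have hχc : Continuous χ := by fun_prop
  have hχ0 : ∀ t, 0 ≤ χ t := fun t => le_max_left _ _
  have hχ1 : ∀ t, χ t ≤ 1 := fun t => max_le zero_le_one (min_le_left _ _)
  have hχr : ∀ t, r ≤ ‖Φ t - p‖ → χ t = 0 := by
    intro t ht
    apply max_eq_left
    refine (min_le_right _ _).trans ?_
    have : 2 ≤ 2 * ‖Φ t - p‖ / r := by rw [le_div_iff₀ hr]; linarith
    linarith
  have hχi : ∀ t, ‖Φ t - p‖ ≤ r / 2 → χ t = 1 := by
    intro t ht
    have : 2 * ‖Φ t - p‖ / r ≤ 1 := by rw [div_le_iff₀ hr]; linarith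
    simp only [χ]
    rw [min_eq_left (by linarith), max_eq_right zero_le_one]
  have ha : ∀ t, τ * χ t ∈ Icc 0 τ := fun t => ⟨mul_nonneg hτ.le (hχ0 t), by
    have := mul_le_mul_of_nonneg_left (hχ1 t) hτ.le
    linarith⟩
  have hnorm : ∀ t, ‖(τ * χ t) • ν t‖ ≤ τ * χ t * L := by
    intro t
    rw [norm_smul, Real.norm_of_nonneg (ha t).1]
    exact mul_le_mul_of_nonneg_left (hνL t) (ha t).1
  have hne : ∀ t, Φ t + (τ * χ t) • ν t ≠ 0 := fun t => ne_zero_of_near hε (hΦS t)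
    ((hnorm t).trans ((mul_le_mul_of_nonneg_right (ha t).2 hL.le).trans hτL))
  have hF' : ∀ t, F (rho ε (Φ t + (τ * χ t) • ν t)) ≤ F (Φ t) - c * (τ * χ t) ^ 2 + ζ := by
    intro t
    rw [h.rho hε (hne t)]
    by_cases hrt : ‖Φ t - p‖ < r
    · exact hνF t (hrt.trans_le (min_le_left _ _)) _ (ha t)
    · rw [hχr t (not_lt.1 hrt)]
      simp [hζ.le]
  refine ⟨fun t => rho ε (Φ t + (τ * χ t) • ν t), ?_, fun t => rho_mem hε (hne t), ?_, ?_, ?_⟩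
  · refine continuous_iff_continuousAt.2 fun t => ?_
    refine ContinuousAt.comp (f := fun t => Φ t + (τ * χ t) • ν t) (g := rho ε)
      (rho_continuousAt (hne t)) ?_
    exact (hΦ.add ((continuous_const.mul hχc).smul hνc)).continuousAt
  · intro t h0
    have : r ≤ ‖Φ t - p‖ := by
      by_contra hc
      push Not at hc
      have := hball (Φ t) (by rw [mem_ball, dist_eq_norm]; exact hc.trans_le (min_le_right _ _))
      linarith
    simp only [hχr t this, mul_zero, zero_smul, add_zero]
    exact rho_of_mem hε (hΦS t)
  · intro t
    have h1 := rho_sub_le hε (hne t) (hΦS t)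
    rw [add_sub_cancel_left] at h1
    have h2 : ‖rho ε (Φ t + (τ * χ t) • ν t) - Φ t‖ ≤ 2 * (τ * χ t * L) :=
      h1.trans (mul_le_mul_of_nonneg_left (hnorm t) zero_le_two)
    have h3 := hF' t
    have h4 : κ * ‖rho ε (Φ t + (τ * χ t) • ν t) - Φ t‖ ^ 2 ≤ c * (τ * χ t) ^ 2 := by
      calc _ ≤ (c / (4 * L ^ 2)) * (2 * (τ * χ t * L)) ^ 2 := by
            gcongr; exact min_le_left _ _
        _ = c * (τ * χ t) ^ 2 := by field_simp; ring
    linarith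
  · intro t ht
    have h3 := hF' t
    rw [hχi t ht] at h3
    have : κ ≤ c * τ ^ 2 := min_le_right _ _
    rw [mul_one] at h3
    simp only [hχi t ht, mul_one]
    linarith

theorem claim {F : H → ℝ} {ε : ℝ} (r : H → ℝ) (κ : H → ℝ) (l : List H)
    (hl : ∀ p ∈ l, 0 < r p ∧ 0 < κ p ∧ LP D F ε p (r p) (κ p)) :
    ∀ ξ > 0, ∃ ω > 0, ∀ Φ : D → H, Continuous Φ → (∀ t, Φ t ∈ sphere (0 : H) ε) →
      ∃ Φ' : D → H, Continuous Φ' ∧ (∀ t, Φ' t ∈ sphere (0 : H) ε) ∧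
        (∀ t, F (Φ t) = 0 → Φ' t = Φ t) ∧ ∀ t, F (Φ' t) ≤ F (Φ t) + ξ ∧
          (F (Φ t) - ω < F (Φ' t) → ‖Φ' t - Φ t‖ ≤ ξ ∧ ∀ p ∈ l, r p / 4 < ‖Φ t - p‖) := by
  induction l with
  | nil =>
    intro ξ hξ
    refine ⟨1, one_pos, fun Φ hΦ hΦS => ⟨Φ, hΦ, hΦS, fun _ _ => rfl, fun t => ⟨by linarith, ?_⟩⟩⟩
    intro _
    simp [hξ.le]
  | cons p l ih =>
    intro ξ hξ
    obtain ⟨hr, hκ, hLP⟩ := hl p (by simp)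
    set r0 := r p with hr0
    set κ0 := κ p
    let ξ1 := min (min (ξ / 2) (κ0 * ξ ^ 2 / 12)) (min (κ0 / 3) (r0 / 4))
    have hξ1 : 0 < ξ1 := by positivity
    have e1 : ξ1 ≤ ξ / 2 := (min_le_left _ _).trans (min_le_left _ _)
    have e2 : ξ1 ≤ κ0 * ξ ^ 2 / 12 := (min_le_left _ _).trans (min_le_right _ _)
    have e3 : ξ1 ≤ κ0 / 3 := (min_le_right _ _).trans (min_le_left _ _)
    have e4 : ξ1 ≤ r0 / 4 := (min_le_right _ _).trans (min_le_right _ _)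
    obtain ⟨ω1, hω1, hih⟩ := ih (fun q hq => hl q (List.mem_cons_of_mem _ hq)) ξ1 hξ1
    let m := min (min (ξ / 2) (κ0 * ξ ^ 2 / 12)) (min (κ0 / 3) (ω1 / 2))
    have hm : 0 < m := by positivity
    have f1 : m ≤ ξ / 2 := (min_le_left _ _).trans (min_le_left _ _)
    have f2 : m ≤ κ0 * ξ ^ 2 / 12 := (min_le_left _ _).trans (min_le_right _ _)
    have f3 : m ≤ κ0 / 3 := (min_le_right _ _).trans (min_le_left _ _)
    have f4 : m ≤ ω1 / 2 := (min_le_right _ _).trans (min_le_right _ _)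
    refine ⟨m, hm, fun Φ hΦ hΦS => ?_⟩
    obtain ⟨Φ1, hΦ1, hΦ1S, hΦ10, hΦ1F⟩ := hih Φ hΦ hΦS
    obtain ⟨Φ2, hΦ2, hΦ2S, hΦ20, hΦ2d, hΦ2F⟩ := hLP Φ1 hΦ1 hΦ1S m hm
    refine ⟨Φ2, hΦ2, hΦ2S, ?_, ?_⟩
    · intro t h0
      have h1 := hΦ10 t h0
      rw [hΦ20 t (by rw [h1, h0]), h1]
    intro t
    have g1 := hΦ1F t
    have g2 := hΦ2d t
    have g3 : 0 ≤ κ0 * ‖Φ2 t - Φ1 t‖ ^ 2 := by positivity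
    refine ⟨by linarith [g1.1], fun hlt => ?_⟩
    obtain ⟨g4, g5⟩ := g1.2 (by linarith)
    have g6 : κ0 * ‖Φ2 t - Φ1 t‖ ^ 2 ≤ κ0 * (ξ / 2) ^ 2 := by
      have : κ0 * (ξ / 2) ^ 2 = 3 * (κ0 * ξ ^ 2 / 12) := by ring
      linarith [g1.1]
    have g7 : ‖Φ2 t - Φ1 t‖ ≤ ξ / 2 := by
      have := le_of_mul_le_mul_left g6 hκ
      exact le_of_sq_le_sq this (by positivity)
    refine ⟨?_, ?_⟩
    · calc ‖Φ2 t - Φ t‖ = ‖(Φ2 t - Φ1 t) + (Φ1 t - Φ t)‖ := by congr 1; abel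
        _ ≤ _ := norm_add_le _ _
        _ ≤ ξ := by linarith
    · intro q hq
      rcases List.mem_cons.1 hq with rfl | hq
      · by_contra hc
        push Not at hc
        have h1 : ‖Φ1 t - q‖ ≤ r0 / 2 := by
          calc ‖Φ1 t - q‖ = ‖(Φ1 t - Φ t) + (Φ t - q)‖ := by congr 1; abel
            _ ≤ _ := norm_add_le _ _
            _ ≤ r0 / 2 := by linarith
        have h2 := hΦ2F t h1
        linarith [g1.1]
      · exact g5 q hq

theorem push {n : ℕ} (hNV : NV n D) {F : H → ℝ} (h : Adm F) {ε : ℝ} (hε : 0 < ε)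
    (hM : ∀ p ∈ sphere (0 : H) ε, 0 < F p → Morse n F p) {η : ℝ} (hη : 0 < η)
    (Φ : D → H) (hΦ : Continuous Φ) (hΦS : ∀ t, Φ t ∈ sphere (0 : H) ε) :
    ∃ Φ' : D → H, Continuous Φ' ∧ (∀ t, Φ' t ∈ sphere (0 : H) ε) ∧
        (∀ t, F (Φ t) = 0 → Φ' t = Φ t) ∧ ∀ t, F (Φ' t) ≤ η := by
  have hS0 : ∀ z ∈ sphere (0 : H) ε, z ≠ 0 := fun z hz => ne_zero_of_mem_sphere hε.ne' ⟨z, hz⟩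
  have hcF : ContinuousOn F (sphere (0 : H) ε) :=
    fun z hz => (h.an z (hS0 z hz)).continuousAt.continuousWithinAt
  have hex : ∀ p, ∃ r κ : ℝ, p ∈ sphere (0 : H) ε → 0 < F p → 0 < r ∧ 0 < κ ∧ LP D F ε p r κ := by
    intro p
    by_cases hp : p ∈ sphere (0 : H) ε ∧ 0 < F p
    · have hd : Dir D F ε p := by
        rcases hM p hp.1 hp.2 with h1 | ⟨ι, κ, hκ, hι⟩
        · exact dir_of_grad D h hε hp.1 h1
        · exact dir_of_neg D hNV h hε hp.1 hκ hι
      obtain ⟨r, hr, κ, hκ, hLP⟩ := local_push D h hε hp.1 hp.2 hd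
      exact ⟨r, κ, fun _ _ => ⟨hr, hκ, hLP⟩⟩
    · exact ⟨0, 0, fun h1 h2 => absurd ⟨h1, h2⟩ hp⟩
  choose r κ hrκ using hex
  let A : Set H := sphere (0 : H) ε ∩ F ⁻¹' (Ici (η / 2))
  have hA : IsCompact A := (isCompact_sphere (0 : H) ε).of_isClosed_subset
    (hcF.preimage_isClosed_of_isClosed isClosed_sphere isClosed_Ici) inter_subset_left
  have hAp : ∀ p ∈ A, 0 < F p := fun p hp => lt_of_lt_of_le (by positivity) hp.2
  obtain ⟨s, hsA, hs⟩ := hA.elim_nhds_subcover (fun p => ball p (r p / 4)) fun p hp =>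
    ball_mem_nhds p (by have := (hrκ p hp.1 (hAp p hp)).1; positivity)
  obtain ⟨ω, hω, hcl⟩ := claim D r κ s.toList (F := F) (ε := ε) (fun p hp => by
    have := hsA p (Finset.mem_toList.1 hp)
    exact hrκ p this.1 (hAp p this)) (η / 2) (by positivity)
  obtain ⟨B, hB⟩ := (isCompact_sphere (0 : H) ε).exists_bound_of_continuousOn hcF
  have hit : ∀ k : ℕ, ∃ Φ' : D → H, Continuous Φ' ∧ (∀ t, Φ' t ∈ sphere (0 : H) ε) ∧
        (∀ t, F (Φ t) = 0 → Φ' t = Φ t) ∧ ∀ t, F (Φ' t) ≤ max η (B - k * ω) := by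
    intro k
    induction k with
    | zero =>
      refine ⟨Φ, hΦ, hΦS, fun _ _ => rfl, fun t => le_max_of_le_right ?_⟩
      simpa using (le_abs_self _).trans (hB _ (hΦS t))
    | succ k ih =>
      obtain ⟨Φ1, h1, h1S, h10, h1F⟩ := ih
      obtain ⟨Φ2, h2, h2S, h20, h2F⟩ := hcl Φ1 h1 h1S
      refine ⟨Φ2, h2, h2S, ?_, ?_⟩
      · intro t h0
        have e := h10 t h0
        rw [h20 t (by rw [e, h0]), e]
      · intro t
        obtain ⟨g1, g2⟩ := h2F t
        by_cases hA' : Φ1 t ∈ A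
        · obtain ⟨p, hp, hpt⟩ := mem_iUnion₂.1 (hs hA')
          have g3 : F (Φ2 t) ≤ F (Φ1 t) - ω := by
            by_contra hc
            push Not at hc
            have := (g2 hc).2 p (Finset.mem_toList.2 hp)
            rw [mem_ball, dist_eq_norm] at hpt
            linarith
          rcases le_max_iff.1 (h1F t) with h5 | h5
          · exact le_max_of_le_left (by linarith)
          · refine le_max_of_le_right ?_
            push_cast
            linarith
        · have : F (Φ1 t) < η / 2 := by
            by_contra hc
            exact hA' ⟨h1S t, not_lt.1 hc⟩
          exact le_max_of_le_left (by linarith)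
  obtain ⟨k, hk⟩ := exists_nat_ge ((B - η) / ω)
  obtain ⟨Φ', a, b, c, d⟩ := hit k
  refine ⟨Φ', a, b, c, fun t => (d t).trans (max_le le_rfl ?_)⟩
  rw [div_le_iff₀ hω] at hk
  linarith

/-- Deformation into the zero set. -/
theorem push_zero {n : ℕ} (hNV : NV n D) {F : H → ℝ} (h : Adm F) {ε : ℝ} (hε : 0 < ε)
    (hM : ∀ p ∈ sphere (0 : H) ε, 0 < F p → Morse n F p)
    (Φ : D → H) (hΦ : Continuous Φ) (hΦS : ∀ t, Φ t ∈ sphere (0 : H) ε) :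
    ∃ Φ' : D → H, Continuous Φ' ∧ (∀ t, Φ' t ∈ sphere (0 : H) ε) ∧
        (∀ t, F (Φ t) = 0 → Φ' t = Φ t) ∧ ∀ t, F (Φ' t) = 0 := by
  obtain ⟨η, hη, r, hr, hr2⟩ := retract h hε
  obtain ⟨Φ', a, b, c, d⟩ := push D hNV h hε hM hη Φ hΦ hΦS
  refine ⟨fun t => r (Φ' t), hr.comp_continuous a fun t => ⟨b t, d t⟩, fun t => (hr2 _ (b t) (d t)).1,
    ?_, fun t => (hr2 _ (b t) (d t)).2.1⟩
  intro t h0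
  have e := c t h0
  have := (hr2 _ (b t) (d t)).2.2 (by rw [e, h0])
  exact this.trans e

end E3

end MLink

namespace MLink

theorem nv_gen {D V W : Type*} [UniformSpace D] [CompactSpace D] [NormedAddCommGroup V]
    [NormedSpace ℝ V] [FiniteDimensional ℝ V] [NormedAddCommGroup W] [NormedSpace ℝ W]
    [FiniteDimensional ℝ W] (i : D → V) (hi : Continuous i) (c : V → D) (hc : UniformContinuous c)
    (hci : ∀ t, c (i t) = t) (hd : Module.finrank ℝ V < Module.finrank ℝ W)
    (u : D → W) (hu : Continuous u) (ζ : ℝ) (hζ : 0 < ζ) :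
    ∃ w : D → W, Continuous w ∧ ∀ t, w t ≠ 0 ∧ ‖w t - u t‖ ≤ ζ := by
  have huc : UniformContinuous (u ∘ c) :=
    (CompactSpace.uniformContinuous_of_continuous hu).comp hc
  obtain ⟨g, hg, hga⟩ := huc.exists_contDiff_dist_le (half_pos hζ)
  have hd' := ContDiff.dense_compl_range_of_finrank_lt_finrank (hg.of_le (by norm_cast)) hd
  obtain ⟨y, hy, hyd⟩ := hd'.exists_dist_lt 0 (half_pos hζ)
  refine ⟨fun t => g (i t) - y, (hg.continuous.comp hi).sub continuous_const, fun t => ⟨?_, ?_⟩⟩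
  · intro h0
    exact hy ⟨i t, sub_eq_zero.1 h0⟩
  · have h1 := hga (i t)
    simp only [Function.comp, hci, dist_eq_norm] at h1
    rw [dist_eq_norm, zero_sub, norm_neg] at hyd
    calc ‖g (i t) - y - u t‖ = ‖(g (i t) - u t) - y‖ := by congr 1; abel
      _ ≤ ‖g (i t) - u t‖ + ‖y‖ := norm_sub_le _ _
      _ ≤ ζ := by linarith

/-- The parameter space. -/
abbrev Par (j : ℕ) : Type := unitInterval × (Fin j → unitInterval)

theorem nv_par {W : Type*} [NormedAddCommGroup W] [NormedSpace ℝ W]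
    [FiniteDimensional ℝ W] {j : ℕ} (hd : j + 1 < Module.finrank ℝ W)
    (u : Par j → W) (hu : Continuous u) (ζ : ℝ) (hζ : 0 < ζ) :
    ∃ w : Par j → W, Continuous w ∧ ∀ t, w t ≠ 0 ∧ ‖w t - u t‖ ≤ ζ := by
  have hp : UniformContinuous (projIcc (0 : ℝ) 1 zero_le_one) :=
    (LipschitzWith.projIcc zero_le_one).uniformContinuous
  refine nv_gen (V := ℝ × (Fin j → ℝ)) (fun t => ((t.1 : ℝ), fun k => (t.2 k : ℝ))) (by fun_prop)
    (fun v => (projIcc 0 1 zero_le_one v.1, fun k => projIcc 0 1 zero_le_one (v.2 k))) ?_ ?_ ?_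
    u hu ζ hζ
  · refine (hp.comp uniformContinuous_fst).prodMk ?_
    refine uniformContinuous_pi.2 fun k => ?_
    exact hp.comp ((Pi.uniformContinuous_proj (fun _ : Fin j => ℝ) k).comp uniformContinuous_snd)
  · intro t
    simp
  · simp
    omega

theorem NV_par {n j : ℕ} (h : j + 1 < n) : NV n (Par j) := fun u hu ζ hζ =>
  nv_par (by simpa using h) u hu ζ hζ

end MLink

namespace MLink

section F1

variable {H : Type*} [NormedAddCommGroup H] [InnerProductSpace ℝ H] [FiniteDimensional ℝ H]

/-- Any continuous family in `H` is deformed into the link, keeping what is already there. -/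
theorem key_par {n j : ℕ} (hj : j + 1 < n) (hdim : n ≤ Module.finrank ℝ H) {F : H → ℝ}
    (h : Adm F) {ε : ℝ} (hε : 0 < ε)
    (hM : ∀ p ∈ sphere (0 : H) ε, 0 < F p → Morse n F p) {K : Set H}
    (hK : ∀ z, z ∈ K ↔ z ∈ sphere (0 : H) ε ∧ F z = 0) (Ψ : Par j → H) (hΨ : Continuous Ψ) :
    ∃ Φ : Par j → H, Continuous Φ ∧ (∀ t, Φ t ∈ K) ∧ ∀ t, Ψ t ∈ K → Φ t = Ψ t := by
  obtain ⟨w, hw, hw2⟩ := nv_par (lt_of_lt_of_le hj hdim) Ψ hΨ (ε / 4) (by positivity)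
  let χ : Par j → ℝ := fun t => min 1 (max 0 (2 - 2 * ‖Ψ t‖ / ε))
  have hχ : Continuous χ := by
    have := hΨ.norm
    fun_prop
  have hχ0 : ∀ t, 0 ≤ χ t := fun t => le_min zero_le_one (le_max_left _ _)
  have hχ1 : ∀ t, χ t ≤ 1 := fun t => min_le_left _ _
  let Ψ1 : Par j → H := fun t => Ψ t + χ t • (w t - Ψ t)
  have hΨ1 : Continuous Ψ1 := hΨ.add (hχ.smul (hw.sub hΨ))
  have hne : ∀ t, Ψ1 t ≠ 0 := by
    intro t h0
    rcases le_or_gt ‖Ψ t‖ (ε / 2) with hl | hl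
    · have : χ t = 1 := by
        have : 1 ≤ 2 - 2 * ‖Ψ t‖ / ε := by
          have : 2 * ‖Ψ t‖ / ε ≤ 1 := by rw [div_le_one hε]; linarith
          linarith
        exact min_eq_left (this.trans (le_max_right _ _))
      simp only [Ψ1, this, one_smul, add_sub_cancel] at h0
      exact (hw2 t).1 h0
    · have h1 : Ψ t = - (χ t • (w t - Ψ t)) := eq_neg_of_add_eq_zero_left h0
      have h2 : ‖Ψ t‖ ≤ ε / 4 := by
        rw [h1, norm_neg, norm_smul, Real.norm_of_nonneg (hχ0 t)]
        calc χ t * ‖w t - Ψ t‖ ≤ 1 * (ε / 4) :=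
              mul_le_mul (hχ1 t) (hw2 t).2 (norm_nonneg _) zero_le_one
          _ = _ := one_mul _
      linarith
  have hS : Continuous fun t => rho ε (Ψ1 t) := continuous_iff_continuousAt.2 fun t =>
    ContinuousAt.comp (g := rho ε) (rho_continuousAt (hne t)) hΨ1.continuousAt
  obtain ⟨Φ, a, b, c, d⟩ := push_zero (Par j) (NV_par hj) h hε hM _ hS
    fun t => rho_mem hε (hne t)
  refine ⟨Φ, a, fun t => (hK _).2 ⟨b t, d t⟩, fun t ht => ?_⟩
  obtain ⟨h1, h2⟩ := (hK _).1 ht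
  have h3 : Ψ1 t = Ψ t := by
    have : χ t = 0 := by
      have h4 := mem_sphere_zero_iff_norm.1 h1
      simp only [χ, h4]
      rw [mul_div_assoc, div_self hε.ne']
      norm_num
    simp [Ψ1, this]
  have h4 : rho ε (Ψ1 t) = Ψ t := by rw [h3, rho_of_mem hε h1]
  rw [c t (by rw [h4, h2]), h4]

theorem conn_abs {n : ℕ} (hn : 2 ≤ n) (hdim : n ≤ Module.finrank ℝ H) {F : H → ℝ}
    (h : Adm F) {ε : ℝ} (hε : 0 < ε)
    (hM : ∀ p ∈ sphere (0 : H) ε, 0 < F p → Morse n F p) {K : Set H}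
    (hK : ∀ z, z ∈ K ↔ z ∈ sphere (0 : H) ε ∧ F z = 0) :
    IsPathConnected K ∧ ∀ x, ∀ hx : x ∈ K, ∀ j : ℕ, 1 ≤ j → j ≤ n - 2 →
      Subsingleton (HomotopyGroup (Fin j) K ⟨x, hx⟩) := by
  refine ⟨isPathConnected_iff.2 ⟨?_, ?_⟩, ?_⟩
  · obtain ⟨Φ, -, b, -⟩ := key_par (j := 0) (by omega) hdim h hε hM hK (fun _ => 0)
      continuous_const
    exact ⟨_, b (0, fun _ => 0)⟩
  · intro x hx y hy
    obtain ⟨Φ, a, b, c⟩ := key_par (j := 0) (by omega) hdim h hε hM hK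
      (fun t => (1 - (t.1 : ℝ)) • x + (t.1 : ℝ) • y) (by fun_prop)
    refine ⟨⟨⟨fun s => Φ (s, fun _ => 0), by fun_prop⟩, ?_, ?_⟩, fun s => b _⟩
    · show Φ (0, fun _ => 0) = x
      rw [c] <;> simp [hx]
    · show Φ (1, fun _ => 0) = y
      rw [c] <;> simp [hy]
  · intro x hx j hj hj2
    have main : ∀ γ : GenLoop (Fin j) K ⟨x, hx⟩, GenLoop.Homotopic γ GenLoop.const := by
      intro γ
      have hγ : Continuous fun t : Fin j → unitInterval => ((γ t : K) : H) :=
        continuous_subtype_val.comp γ.1.continuous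
      obtain ⟨Φ, a, b, c⟩ := key_par (j := j) (by omega) hdim h hε hM hK
        (fun t => (1 - (t.1 : ℝ)) • ((γ t.2 : K) : H) + (t.1 : ℝ) • x) (by
          have := hγ.comp (continuous_snd (X := unitInterval))
          simp only [Function.comp_def] at this
          fun_prop)
      refine ⟨⟨⟨⟨fun t => ⟨Φ t, b t⟩, by fun_prop⟩, ?_, ?_⟩, ?_⟩⟩
      · intro t
        apply Subtype.ext
        show Φ (0, t) = _
        have : Φ (0, t) = ((γ t : K) : H) := by
          rw [c] <;> simp
        exact this
      · intro t
        apply Subtype.ext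
        show Φ (1, t) = x
        rw [c] <;> simp [hx]
      · intro s t ht
        apply Subtype.ext
        show Φ (s, t) = ((γ t : K) : H)
        have h1 : γ t = ⟨x, hx⟩ := γ.2 t ht
        have h2 : (1 - (s : ℝ)) • x + (s : ℝ) • x = x := by rw [← add_smul]; simp
        rw [c]
        · simp only [h1, h2]
        · simp only [h1, h2]; exact hx
    refine ⟨fun p q => ?_⟩
    induction p using Quotient.inductionOn with | _ p => ?_
    induction q using Quotient.inductionOn with | _ q => ?_
    exact Quotient.sound ((main p).trans (main q).symm)

end F1

end MLink

namespace MLink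

section G2

variable {W : Type*} [AddCommGroup W] [Module ℝ W] [FiniteDimensional ℝ W]

theorem neg_vectors (B : W →ₗ[ℝ] W →ₗ[ℝ] ℝ) (hB : ∀ x y, B x y = B y x) (J : W →ₗ[ℝ] W)
    (hJ : ∀ x, x ≠ 0 → B x x + B (J x) (J x) < 0) {n : ℕ} (hn : 2 * n ≤ Module.finrank ℝ W) :
    ∀ k ≤ n, ∃ e : Fin k → W, ∀ i j, B (e i) (e j) = if i = j then -1 else 0 := by
  intro k
  induction k with
  | zero => exact fun _ => ⟨fun i => i.elim0, fun i => i.elim0⟩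
  | succ k ih =>
    intro hk
    obtain ⟨e, he⟩ := ih (by omega)
    let L : W →ₗ[ℝ] (Fin k → ℝ) × (Fin k → ℝ) :=
      (LinearMap.pi fun i => B (e i)).prod ((LinearMap.pi fun i => B (e i)) ∘ₗ J)
    have hker : LinearMap.ker L ≠ ⊥ := by
      apply LinearMap.ker_ne_bot_of_finrank_lt
      simp
      omega
    obtain ⟨x, hx, hx0⟩ := (Submodule.ne_bot_iff _).1 hker
    have hx1 : ∀ i, B (e i) x = 0 := fun i => congrFun (congrArg Prod.fst hx) i
    have hx2 : ∀ i, B (e i) (J x) = 0 := fun i => congrFun (congrArg Prod.snd hx) i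
    have hy : ∃ y, (∀ i, B (e i) y = 0) ∧ B y y < 0 := by
      rcases lt_or_ge (B x x) 0 with h | h
      · exact ⟨x, hx1, h⟩
      · exact ⟨J x, hx2, by linarith [hJ x hx0]⟩
    obtain ⟨y, hy1, hy2⟩ := hy
    have hs : 0 < Real.sqrt (- B y y) := Real.sqrt_pos.2 (by linarith)
    have hs2 : Real.sqrt (- B y y) * Real.sqrt (- B y y) = - B y y :=
      Real.mul_self_sqrt (by linarith)
    have hz : B ((Real.sqrt (- B y y))⁻¹ • y) ((Real.sqrt (- B y y))⁻¹ • y) = -1 := by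
      simp only [map_smul, LinearMap.smul_apply, smul_eq_mul]
      have : B y y = - (Real.sqrt (- B y y) * Real.sqrt (- B y y)) := by rw [hs2]; ring
      generalize Real.sqrt (- B y y) = s at *
      rw [this]
      field_simp
    have hz1 : ∀ i, B (e i) ((Real.sqrt (- B y y))⁻¹ • y) = 0 := fun i => by
      rw [map_smul, hy1, smul_zero]
    refine ⟨Fin.snoc (α := fun _ => W) e ((Real.sqrt (- B y y))⁻¹ • y), fun i j => ?_⟩
    induction i using Fin.lastCases with
    | last =>
      induction j using Fin.lastCases with
      | last => simpa using hz
      | cast j =>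
        rw [Fin.snoc_last, Fin.snoc_castSucc, hB, hz1, if_neg]
        exact (Fin.castSucc_lt_last j).ne'
    | cast i =>
      induction j using Fin.lastCases with
      | last =>
        rw [Fin.snoc_last, Fin.snoc_castSucc, hz1, if_neg]
        exact (Fin.castSucc_lt_last i).ne
      | cast j =>
        rw [Fin.snoc_castSucc, Fin.snoc_castSucc, he]
        simp

theorem neg_map (B : W →ₗ[ℝ] W →ₗ[ℝ] ℝ) (hB : ∀ x y, B x y = B y x) (J : W →ₗ[ℝ] W)
    (hJ : ∀ x, x ≠ 0 → B x x + B (J x) (J x) < 0) {n : ℕ} (hn : 2 * n ≤ Module.finrank ℝ W) :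
    ∃ ι : EuclideanSpace ℝ (Fin n) →ₗ[ℝ] W, ∀ v, B (ι v) (ι v) = - ‖v‖ ^ 2 := by
  obtain ⟨e, he⟩ := neg_vectors B hB J hJ hn n le_rfl
  refine ⟨(Fintype.linearCombination ℝ e) ∘ₗ
    (WithLp.linearEquiv 2 ℝ (Fin n → ℝ)).toLinearMap, fun v => ?_⟩
  rw [EuclideanSpace.norm_sq_eq]
  simp only [LinearMap.comp_apply, Fintype.linearCombination_apply, map_sum, map_smul,
    LinearMap.sum_apply, LinearMap.smul_apply, he]
  simp [← Finset.sum_neg_distrib, sq]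

end G2

end MLink

namespace MLink

section G1

attribute [local instance] InnerProductSpace.complexToReal

theorem deriv_a {ε b : ℝ} (hε : 0 < ε) (hb : 0 ≤ b) (t : ℝ) :
    HasDerivAt (fun t : ℝ => ε / Real.sqrt (ε ^ 2 + b * t ^ 2))
      (t * (- (ε * b) / Real.sqrt (ε ^ 2 + b * t ^ 2) ^ 3)) t := by
  have hpos : 0 < ε ^ 2 + b * t ^ 2 := by positivity
  have h1 : HasDerivAt (fun t : ℝ => ε ^ 2 + b * t ^ 2) (b * (2 * t)) t := by
    have := ((hasDerivAt_pow 2 t).const_mul b).const_add (ε ^ 2)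
    exact this.congr_deriv (by simp)
  have h2 := h1.sqrt hpos.ne'
  have hs := Real.sqrt_pos.2 hpos
  have h3 := (hasDerivAt_const t ε).fun_div h2 hs.ne'
  refine h3.congr_deriv ?_
  field_simp
  ring

theorem deriv_a' {ε b : ℝ} (hε : 0 < ε) (hb : 0 ≤ b) :
    HasDerivAt (fun t : ℝ => t * (- (ε * b) / Real.sqrt (ε ^ 2 + b * t ^ 2) ^ 3))
      (- (b / ε ^ 2)) 0 := by
  have hpos : 0 < ε ^ 2 + b * (0 : ℝ) ^ 2 := by positivity
  have hs := Real.sqrt_pos.2 hpos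
  have h1 : DifferentiableAt ℝ (fun t : ℝ => ε ^ 2 + b * t ^ 2) 0 := by fun_prop
  have h2 : DifferentiableAt ℝ (fun t : ℝ => - (ε * b) / Real.sqrt (ε ^ 2 + b * t ^ 2) ^ 3) 0 :=
    (differentiableAt_const _).fun_div ((h1.sqrt hpos.ne').fun_pow 3) (pow_pos hs 3).ne'
  have h3 := (hasDerivAt_id (0 : ℝ)).fun_mul h2.hasDerivAt
  refine h3.congr_deriv ?_
  simp [Real.sqrt_sq hε.le]
  field_simp

variable {E : Type*} [NormedAddCommGroup E] [InnerProductSpace ℂ E] [FiniteDimensional ℂ E]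

/-- The homogeneous extension of `|g|²` from the sphere. -/
def FF (g : E → ℂ) (ε : ℝ) (z : E) : ℝ := ‖g (rho ε z)‖ ^ 2

theorem second_FF {g : E → ℂ} {ε : ℝ} (hε : 0 < ε)
    (hg : ∀ z ∈ sphere (0 : E) ε, AnalyticAt ℂ g z) (h : Adm (FF g ε)) {p u : E}
    (hp : p ∈ sphere (0 : E) ε) (hu : inner ℝ p u = 0) :
    fderiv ℝ (FF g ε) p u = 2 * inner ℝ (g p) (fderiv ℂ g p u) ∧
    fderiv ℝ (fderiv ℝ (FF g ε)) p u u = 2 * (‖fderiv ℂ g p u‖ ^ 2 +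
      inner ℝ (g p) (fderiv ℂ (fderiv ℂ g) p u u - ((‖u‖ ^ 2 / ε ^ 2 : ℝ) : ℂ) *
        fderiv ℂ g p p)) := by
  have hpn := mem_sphere_zero_iff_norm.1 hp
  set b := ‖u‖ ^ 2 with hb
  have hb0 : 0 ≤ b := by positivity
  have hnorm : ∀ t : ℝ, ‖p + t • u‖ = Real.sqrt (ε ^ 2 + b * t ^ 2) := by
    intro t
    rw [eq_comm, Real.sqrt_eq_iff_mul_self_eq (by positivity) (norm_nonneg _), ← sq,
      norm_add_sq_real, inner_smul_right, hu, norm_smul, hpn, mul_pow, hb, Real.norm_eq_abs, sq_abs]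
    ring
  have hnz : ∀ t : ℝ, p + t • u ≠ 0 := by
    intro t
    rw [← norm_pos_iff, hnorm]
    positivity
  let a : ℝ → ℝ := fun t => ε / Real.sqrt (ε ^ 2 + b * t ^ 2)
  let a' : ℝ → ℝ := fun t => t * (- (ε * b) / Real.sqrt (ε ^ 2 + b * t ^ 2) ^ 3)
  let c : ℝ → E := fun t => a t • (p + t • u)
  let c' : ℝ → E := fun t => a t • u + a' t • (p + t • u)
  have ha0 : a 0 = 1 := by simp [a, Real.sqrt_sq hε.le, hε.ne']
  have ha'0 : a' 0 = 0 := by simp [a']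
  have hc0 : c 0 = p := by simp [c, ha0]
  have hc'0 : c' 0 = u := by simp [c', ha0, ha'0]
  have hline : ∀ t : ℝ, HasDerivAt (fun t : ℝ => p + t • u) u t := by
    intro t
    have := ((hasDerivAt_id t).smul_const u).const_add p
    exact this.congr_deriv (one_smul _ _)
  have hcd : ∀ t, HasDerivAt c (c' t) t := fun t => (deriv_a hε hb0 t).fun_smul (hline t)
  have hc'd : HasDerivAt c' (- (b / ε ^ 2) • p) 0 := by
    have := ((deriv_a hε hb0 0).smul_const u).add ((deriv_a' hε hb0).fun_smul (hline 0))
    refine this.congr_deriv ?_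
    simp
  have hcr : ∀ t, rho ε (p + t • u) = c t := fun t => by simp only [rho, hnorm, c, a]
  have hcS : ∀ t, c t ∈ sphere (0 : E) ε := fun t => by
    rw [← hcr]; exact rho_mem hε (hnz t)
  let G : ℝ → ℂ := fun t => g (c t)
  let G' : ℝ → ℂ := fun t => fderiv ℂ g (c t) (c' t)
  have hG : ∀ t, HasDerivAt G (G' t) t := fun t =>
    (((hg _ (hcS t)).differentiableAt.hasFDerivAt).restrictScalars ℝ).comp_hasDerivAt t (hcd t)
  have hG' : HasDerivAt G' (fderiv ℂ (fderiv ℂ g) p u u - ((b / ε ^ 2 : ℝ) : ℂ) *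
        fderiv ℂ g p p) 0 := by
    have h1 : HasDerivAt (fun t => fderiv ℂ g (c t)) (fderiv ℂ (fderiv ℂ g) (c 0) (c' 0)) 0 :=
      (((hg _ (hcS 0)).fderiv.differentiableAt.hasFDerivAt).restrictScalars ℝ).comp_hasDerivAt 0
        (hcd 0)
    have h2 := ((isBoundedBilinearMap_apply (𝕜 := ℂ) (E := E) (F := ℂ)).hasFDerivAt
      (fderiv ℂ g (c 0), c' 0)).restrictScalars ℝ
    have h3 := h2.comp_hasDerivAt (0 : ℝ) (h1.prodMk hc'd)
    refine h3.congr_deriv ?_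
    rw [hc0, hc'0]
    simp [IsBoundedBilinearMap.deriv]
    ring
  have hF : ∀ t : ℝ, FF g ε (p + t • u) = ‖G t‖ ^ 2 := fun t => by simp only [FF, hcr, G]
  have hder1 : ∀ t : ℝ, HasDerivAt (fun t : ℝ => FF g ε (p + t • u))
      (fderiv ℝ (FF g ε) (p + t • u) u) t := fun t => by
    have h1 : HasFDerivAt (FF g ε) (fderiv ℝ (FF g ε) (p + t • u)) (p + t • u) :=
      (h.an _ (hnz t)).differentiableAt.hasFDerivAt
    exact h1.comp_hasDerivAt t (hline t)
  have hder2 : ∀ t : ℝ, HasDerivAt (fun t : ℝ => FF g ε (p + t • u))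
      (2 * inner ℝ (G t) (G' t)) t := fun t => by
    have := (hG t).norm_sq
    simp only [hF]
    exact this
  have heq : ∀ t : ℝ, fderiv ℝ (FF g ε) (p + t • u) u = 2 * inner ℝ (G t) (G' t) := fun t =>
    (hder1 t).unique (hder2 t)
  have hG0 : G 0 = g p := by simp only [G, hc0]
  have hG'0 : G' 0 = fderiv ℂ g p u := by simp only [G', hc0, hc'0]
  constructor
  · have := heq 0
    rwa [zero_smul, add_zero, hG0, hG'0] at this
  · have e1 : HasDerivAt (fun t : ℝ => fderiv ℝ (FF g ε) (p + t • u) u)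
        (fderiv ℝ (fderiv ℝ (FF g ε)) p u u) 0 := by
      have h1 := (h.an _ (hnz 0)).fderiv.differentiableAt.hasFDerivAt.comp_hasDerivAt (0 : ℝ)
        (hline 0)
      have h2 := h1.clm_apply (hasDerivAt_const (0 : ℝ) u)
      simp only [zero_smul, add_zero, map_zero] at h2
      exact h2
    have e2 := ((hG 0).inner ℝ hG').const_mul 2
    have e3 := e1.unique ((e2.congr_of_eventuallyEq (Eventually.of_forall heq)))
    rw [e3, hG0, hG'0, real_inner_self_eq_norm_sq]
    ring

end G1

end MLink

namespace MLink

section G3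

open scoped ContDiff

attribute [local instance] InnerProductSpace.complexToReal

variable {E : Type*} [NormedAddCommGroup E] [InnerProductSpace ℂ E] [FiniteDimensional ℂ E]

theorem normsq_analytic {g : E → ℂ} {z : E} (hg : AnalyticAt ℂ g z) :
    AnalyticAt ℝ (fun z => ‖g z‖ ^ 2) z := by
  have h1 : ContDiffAt ℝ ω g z := AnalyticAt.contDiffAt (hg.restrictScalars (𝕜 := ℝ))
  exact (h1.norm_sq ℝ).analyticAt

theorem normsq_id_analytic (z : E) : AnalyticAt ℝ (fun z : E => ‖z‖ ^ 2) z := by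
  have h1 : ContDiffAt ℝ ω (fun z : E => z) z := contDiffAt_id
  exact (h1.norm_sq ℝ).analyticAt

theorem rho_analytic {ε : ℝ} {z : E} (hz : z ≠ 0) : AnalyticAt ℝ (rho ε : E → E) z := by
  have h1 : ContDiffAt ℝ ω (fun z : E => (ε / ‖z‖) • z) z :=
    (contDiffAt_const.div (contDiffAt_norm ℝ hz) (norm_ne_zero_iff.2 hz)).smul contDiffAt_id
  exact h1.analyticAt

theorem adm_FF {g : E → ℂ} {ε : ℝ} (hε : 0 < ε)
    (hg : ∀ z ∈ sphere (0 : E) ε, AnalyticAt ℂ g z) : Adm (FF g ε) where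
  an z hz := by
    have h1 := normsq_analytic (hg _ (rho_mem hε hz))
    exact AnalyticAt.comp (g := fun z => ‖g z‖ ^ 2) (f := rho ε) h1 (rho_analytic hz)
  hom z c hc := by
    have : rho ε (c • z) = rho ε z := by
      by_cases hz : z = 0
      · simp [hz]
      · have := norm_pos_iff.2 hz
        rw [rho, rho, smul_smul, norm_smul, Real.norm_of_nonneg hc.le]
        congr 1
        field_simp
    simp only [FF, this]
  nonneg z := by unfold FF; positivity

theorem inner_real_eq (x y : E) : inner ℝ x y = (inner ℂ x y).re := rfl

theorem fderiv_normsq {g : E → ℂ} {p : E} (hg : AnalyticAt ℂ g p) (v : E) :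
    fderiv ℝ (fun z => ‖g z‖ ^ 2) p v = 2 * inner ℝ (g p) (fderiv ℂ g p v) := by
  have h1 : HasFDerivAt g ((fderiv ℂ g p).restrictScalars ℝ) p :=
    hg.differentiableAt.hasFDerivAt.restrictScalars ℝ
  rw [h1.norm_sq.fderiv]
  simp [two_mul]
  ring

theorem fderiv_normsq_id (p v : E) :
    fderiv ℝ (fun z : E => ‖z‖ ^ 2) p v = 2 * inner ℝ p v := by
  have h1 : HasFDerivAt (fun z : E => z) (ContinuousLinearMap.id ℝ E) p := hasFDerivAt_id p
  rw [h1.norm_sq.fderiv]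
  simp [two_mul]

theorem morse_FF {n : ℕ} (hdim : Module.finrank ℂ E = n + 1) {g : E → ℂ} {ε : ℝ} (hε : 0 < ε)
    (hg : ∀ z ∈ sphere (0 : E) ε, AnalyticAt ℂ g z)
    {p : E} (hp : p ∈ sphere (0 : E) ε)
    (hv : ∃ v, 0 < fderiv ℝ (fun z => ‖g z‖ ^ 2) p v ∧ 0 < fderiv ℝ (fun z : E => ‖z‖ ^ 2) p v)
    (hgp : g p ≠ 0) : Morse n (FF g ε) p := by
  have hA := adm_FF hε hg
  have hpn := mem_sphere_zero_iff_norm.1 hp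
  have hp0 : p ≠ 0 := by
    rw [← norm_pos_iff, hpn]; exact hε
  by_cases hF : fderiv ℝ (FF g ε) p = 0
  swap
  · exact Or.inl hF
  right
  have hz : ∀ u, inner ℝ p u = 0 → inner ℝ (g p) (fderiv ℂ g p u) = 0 := by
    intro u hu
    have := (second_FF hε hg hA hp hu).1
    rw [hF] at this
    have h2 : (0 : ℝ) = 2 * inner ℝ (g p) (fderiv ℂ g p u) := this
    linarith
  have hApos : 0 < inner ℝ (g p) (fderiv ℂ g p p) := by
    obtain ⟨v, h1, h2⟩ := hv
    rw [fderiv_normsq (hg _ hp)] at h1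
    rw [fderiv_normsq_id] at h2
    have h3 := hz (v - (inner ℝ p v / ε ^ 2) • p) (by
      rw [inner_sub_right, inner_smul_right, real_inner_self_eq_norm_sq, hpn]
      field_simp
      ring)
    have h4 : fderiv ℂ g p (v - (inner ℝ p v / ε ^ 2) • p)
        = fderiv ℂ g p v - (inner ℝ p v / ε ^ 2) • fderiv ℂ g p p := by
      rw [map_sub]
      congr 1
      exact ((fderiv ℂ g p).restrictScalars ℝ).map_smul _ _
    rw [h4, inner_sub_right, inner_smul_right] at h3
    have h5 : 0 < inner ℝ p v / ε ^ 2 := div_pos (by linarith) (by positivity)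
    by_contra hcon
    push Not at hcon
    nlinarith [mul_nonneg h5.le (neg_nonneg.2 hcon)]
  have hI : ∀ w : E, inner ℂ p w = 0 → inner ℝ p w = 0 ∧ inner ℝ p (Complex.I • w) = 0 := by
    intro w hw
    rw [inner_real_eq, inner_real_eq, inner_smul_right, hw]
    simp
  have hDg : ∀ w : E, inner ℂ p w = 0 → fderiv ℂ g p w = 0 := by
    intro w hw
    have h1 := hz _ (hI w hw).1
    have h2 := hz _ (hI w hw).2
    rw [map_smul, Complex.inner] at h2
    rw [Complex.inner] at h1
    have h3 : fderiv ℂ g p w * (starRingEnd ℂ) (g p) = 0 := by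
      apply Complex.ext
      · exact h1
      · rw [smul_eq_mul, mul_assoc, Complex.I_mul_re] at h2
        exact neg_eq_zero.1 h2
    rcases mul_eq_zero.1 h3 with h | h
    · exact h
    · exact absurd ((map_eq_zero _).1 h) hgp
  have hsum : ∀ w : E, inner ℂ p w = 0 → w ≠ 0 → fderiv ℝ (fderiv ℝ (FF g ε)) p w w +
      fderiv ℝ (fderiv ℝ (FF g ε)) p (Complex.I • w) (Complex.I • w) < 0 := by
    intro w hw hw0
    have hw' : inner ℂ p (Complex.I • w) = 0 := by rw [inner_smul_right, hw, mul_zero]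
    rw [(second_FF hε hg hA hp (hI w hw).1).2, (second_FF hε hg hA hp (hI w hw).2).2, hDg w hw,
      hDg _ hw']
    have e1 : fderiv ℂ (fderiv ℂ g) p (Complex.I • w) (Complex.I • w)
        = - fderiv ℂ (fderiv ℂ g) p w w := by
      rw [map_smul, map_smul, smul_apply, smul_smul, Complex.I_mul_I,
        neg_one_smul]
    have e2 : ‖Complex.I • w‖ = ‖w‖ := by rw [norm_smul, Complex.norm_I, one_mul]
    have e3 : ∀ r : ℝ, inner ℝ (g p) ((r : ℂ) * fderiv ℂ g p p)
        = r * inner ℝ (g p) (fderiv ℂ g p p) := by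
      intro r
      rw [← Complex.real_smul, inner_smul_right]
    rw [e1, e2, inner_sub_right, inner_sub_right, inner_neg_right, e3]
    have := norm_pos_iff.2 hw0
    have h5 : 0 < ‖w‖ ^ 2 / ε ^ 2 * inner ℝ (g p) (fderiv ℂ g p p) := by positivity
    rw [norm_zero]
    nlinarith
  have hsymm : IsSymmSndFDerivAt ℝ (FF g ε) p := by
    have h1 : ContDiffAt ℝ 2 (FF g ε) p := AnalyticAt.contDiffAt (hA.an p hp0)
    exact h1.isSymmSndFDerivAt (by simp)
  let W : Submodule ℂ E := (Submodule.span ℂ {p})ᗮ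
  have hWmem : ∀ w : W, inner ℂ p (w : E) = 0 := fun w =>
    Submodule.mem_orthogonal_singleton_iff_inner_right.1 w.2
  have hWdim : Module.finrank ℂ W = n := by
    have : Fact (Module.finrank ℂ E = n + 1) := ⟨hdim⟩
    exact Submodule.finrank_orthogonal_span_singleton hp0
  let B : W →ₗ[ℝ] W →ₗ[ℝ] ℝ := LinearMap.mk₂ ℝ
    (fun x y => fderiv ℝ (fderiv ℝ (FF g ε)) p (x : E) (y : E))
    (fun x y z => by simp) (fun r x y => by simp) (fun x y z => by simp) (fun r x y => by simp)
  let J : W →ₗ[ℝ] W := (LinearMap.lsmul ℂ W Complex.I).restrictScalars ℝ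
  obtain ⟨ι, hι⟩ := neg_map (n := n) B (fun x y => hsymm _ _) J (fun x hx => by
    refine hsum (x : E) (hWmem x) ?_
    simpa using hx) (by
      rw [finrank_real_of_complex, hWdim])
  refine ⟨LinearMap.toContinuousLinearMap ((W.subtype.restrictScalars ℝ) ∘ₗ ι), 1, one_pos,
    fun v => ?_⟩
  have := hι v
  calc _ = B (ι v) (ι v) := rfl
    _ = - ‖v‖ ^ 2 := this
    _ ≤ _ := by rw [neg_one_mul]

theorem main_abs {n : ℕ} (hn : 2 ≤ n) (hdim : Module.finrank ℂ E = n + 1) (g : E → ℂ)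
    (hg : AnalyticAt ℂ g 0) (hg0 : g 0 = 0) :
    ∃ ε₀ > 0, ∀ ε, 0 < ε → ε ≤ ε₀ →
      IsPathConnected (g ⁻¹' {0} ∩ sphere (0 : E) ε) ∧
      ∀ x, ∀ hx : x ∈ g ⁻¹' {0} ∩ sphere (0 : E) ε,
        ∀ j : ℕ, 1 ≤ j → j ≤ n - 2 →
          Subsingleton
            (HomotopyGroup (Fin j) (↥(g ⁻¹' {0} ∩ sphere (0 : E) ε)) ⟨x, hx⟩) := by
  have h1 := pos_dir (normsq_analytic hg) (normsq_id_analytic (0 : E)) (by simp [hg0]) (by simp)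
  have h2 := hg.eventually_analyticAt
  obtain ⟨r, hr, hb⟩ := Metric.eventually_nhds_iff.1 (h1.and h2)
  refine ⟨r / 2, by positivity, fun ε hε hεr => ?_⟩
  have hS : ∀ z ∈ sphere (0 : E) ε, dist z 0 < r := fun z hz => by
    rw [mem_sphere.1 hz]; linarith
  have hgS : ∀ z ∈ sphere (0 : E) ε, AnalyticAt ℂ g z := fun z hz => (hb (hS z hz)).2
  have hFS : ∀ z ∈ sphere (0 : E) ε, FF g ε z = ‖g z‖ ^ 2 := fun z hz => by
    rw [FF, rho_of_mem hε hz]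
  refine conn_abs hn ?_ (adm_FF hε hgS) hε ?_ ?_
  · rw [finrank_real_of_complex, hdim]; omega
  · intro p hp hFp
    rw [hFS p hp] at hFp
    refine morse_FF hdim hε hgS hp ((hb (hS p hp)).1 hFp ?_) ?_
    · rw [mem_sphere_zero_iff_norm.1 hp]; positivity
    · rintro h0
      simp [h0] at hFp
  · intro z
    constructor
    · rintro ⟨h1, h2⟩
      refine ⟨h2, ?_⟩
      rw [hFS z h2, show g z = 0 from h1]; simp
    · rintro ⟨h2, h1⟩
      refine ⟨?_, h2⟩
      rw [hFS z h2] at h1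
      simpa using h1

end G3

end MLink

end MLinkHelpers

/-- Milnor: the link `K_ε = g⁻¹(0) ∩ S_ε^{2n+1}` of a non-constant holomorphic function germ
`g : ℂ^{n+1} → ℂ` with `g 0 = 0` is `(n-2)`-connected for all small enough `ε > 0`:
it is nonempty and path-connected, and its homotopy groups `π_j` vanish for `1 ≤ j ≤ n - 2`. -/
theorem link_is_n_sub_two_connected (n : ℕ) (hn : 2 ≤ n)
    (g : EuclideanSpace ℂ (Fin (n + 1)) → ℂ)
    (U : Set (EuclideanSpace ℂ (Fin (n + 1)))) (hU : IsOpen U)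
    (h0U : (0 : EuclideanSpace ℂ (Fin (n + 1))) ∈ U)
    (hg : AnalyticOnNhd ℂ g U)
    (hgnc : ∃ x ∈ U, g x ≠ g 0)
    (hg0 : g 0 = 0) :
    ∃ ε₀ > 0, ∀ ε, 0 < ε → ε ≤ ε₀ →
      IsPathConnected (g ⁻¹' {0} ∩ sphere (0 : EuclideanSpace ℂ (Fin (n + 1))) ε) ∧
      ∀ x, ∀ hx : x ∈ g ⁻¹' {0} ∩ sphere (0 : EuclideanSpace ℂ (Fin (n + 1))) ε,
        ∀ j : ℕ, 1 ≤ j → j ≤ n - 2 →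
          Subsingleton
            (π_ j (↥(g ⁻¹' {0} ∩ sphere (0 : EuclideanSpace ℂ (Fin (n + 1))) ε)) ⟨x, hx⟩) := by
  obtain ⟨ε₀, h1, h2⟩ := MLink.main_abs hn (by simp) g (hg 0 h0U) hg0
  exact ⟨ε₀, h1, h2⟩
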